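/- arXiv:2205.01773 — 6 statements merged into one kernel-verified Lean document; each statement's English description precedes it below -/
import Mathlib

section
/- Let X be a random vector valued in ℝ^m on a probability space such that ‖X‖₂ ≤ 1 almost surely. Then there is an absolute constant C > 0 such that for every integer k ≥ 3, there exists a measurable partition of ℝ^m into at most k sets such that, with F the sigma-algebra generated by this partition (pulled back through X) and Y = E[X | F], one has ‖Σ_X − Σ_Y‖_F ≤ C / √(log k). -/
open MeasureTheory ProbabilityTheory Real Finset

/-- The covariance matrix `Σ_X = 𝔼[(X - 𝔼X)(X - 𝔼X)ᵀ]` of a random vector `X`. -/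
noncomputable def covMatrix {Ω : Type*} [MeasurableSpace Ω] (μ : Measure Ω) {m : ℕ}
    (X : Ω → Fin m → ℝ) : Matrix (Fin m) (Fin m) ℝ :=
  Matrix.of fun i j =>
    ∫ ω, (X ω i - ∫ ω', X ω' i ∂μ) * (X ω j - ∫ ω', X ω' j ∂μ) ∂μ

/-- The Frobenius norm `‖A‖_F = √(∑ i j, A i j ^ 2)`. -/
noncomputable def frobNorm {m : ℕ} (A : Matrix (Fin m) (Fin m) ℝ) : ℝ :=
  Real.sqrt (∑ i, ∑ j, (A i j) ^ 2)
open scoped Matrix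

theorem cl_int_add3 {Ω : Type} {mΩ : MeasurableSpace Ω} {μ : Measure Ω} {a b c : Ω → ℝ}
    (ha : Integrable a μ) (hb : Integrable b μ) (hc : Integrable c μ) :
    ∫ ω, (a ω + b ω) + c ω ∂μ = (∫ ω, a ω ∂μ + ∫ ω, b ω ∂μ) + ∫ ω, c ω ∂μ := by
  have h := integral_add (ha.add hb) hc
  have h' := integral_add ha hb
  rw [← h']
  exact h

theorem cl_int_add4 {Ω : Type} {mΩ : MeasurableSpace Ω} {μ : Measure Ω} {a b c d : Ω → ℝ}
    (ha : Integrable a μ) (hb : Integrable b μ) (hc : Integrable c μ) (hd : Integrable d μ) :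
    ∫ ω, ((a ω + b ω) + c ω) + d ω ∂μ =
      ((∫ ω, a ω ∂μ + ∫ ω, b ω ∂μ) + ∫ ω, c ω ∂μ) + ∫ ω, d ω ∂μ := by
  have h := integral_add ((ha.add hb).add hc) hd
  rw [← cl_int_add3 ha hb hc]
  exact h

theorem cl_orth {Ω : Type} {F mΩ : MeasurableSpace Ω} (μ : Measure Ω) [IsProbabilityMeasure μ]
    (hF : F ≤ mΩ) {f h : Ω → ℝ} (hf : MemLp f 2 μ) (hh : MemLp h 2 μ)
    (hm : StronglyMeasurable[F] h) :
    ∫ ω, (f ω - (μ[f | F]) ω) * h ω ∂μ = 0 := by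
  have hfi : Integrable f μ := hf.integrable (by norm_num)
  have hfh : Integrable (f * h) μ := hf.integrable_mul hh
  have hY : MemLp (μ[f | F]) 2 μ := hf.condExp (by norm_num)
  have hYh : Integrable ((μ[f | F]) * h) μ := hY.integrable_mul hh
  have h1 := condExp_mul_of_stronglyMeasurable_right hm hfh hfi
  have h2 : ∫ ω, (f * h) ω ∂μ = ∫ ω, ((μ[f | F]) * h) ω ∂μ := by
    rw [← integral_condExp hF]
    exact integral_congr_ae h1
  have h3 : ∀ ω, (f ω - (μ[f | F]) ω) * h ω = (f * h) ω - ((μ[f | F]) * h) ω := by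
    intro ω; simp [sub_mul]
  simp_rw [h3]
  rw [integral_sub hfh hYh, h2, sub_self]

theorem cl_cov {Ω : Type} {F mΩ : MeasurableSpace Ω} (μ : Measure Ω) [IsProbabilityMeasure μ]
    (hF : F ≤ mΩ) {m : ℕ} (X : Ω → Fin m → ℝ) (hX : ∀ i, MemLp (fun ω => X ω i) 2 μ)
    (i j : Fin m) :
    (covMatrix μ X - covMatrix μ (fun ω i => (μ[fun ω' => X ω' i | F]) ω)) i j =
      ∫ ω, (X ω i - (μ[fun ω' => X ω' i | F]) ω) * (X ω j - (μ[fun ω' => X ω' j | F]) ω) ∂μ := by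
  have hY : ∀ i, MemLp (μ[fun ω' => X ω' i | F]) 2 μ := fun i => (hX i).condExp (by norm_num)
  have hc : ∀ i, MemLp (fun ω => (μ[fun ω' => X ω' i | F]) ω - ∫ ω', X ω' i ∂μ) 2 μ :=
    fun i => (hY i).sub (memLp_const _)
  have hcm : ∀ i, StronglyMeasurable[F]
      (fun ω => (μ[fun ω' => X ω' i | F]) ω - ∫ ω', X ω' i ∂μ) :=
    fun i => stronglyMeasurable_condExp.sub stronglyMeasurable_const
  have hR : ∀ i, MemLp (fun ω => X ω i - (μ[fun ω' => X ω' i | F]) ω) 2 μ :=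
    fun i => (hX i).sub (hY i)
  simp only [covMatrix, Matrix.sub_apply, Matrix.of_apply]
  have hm : ∀ i, ∫ ω', (μ[fun ω' => X ω' i | F]) ω' ∂μ = ∫ ω', X ω' i ∂μ :=
    fun i => integral_condExp hF
  simp_rw [hm]
  have key : ∀ ω, (X ω i - ∫ ω', X ω' i ∂μ) * (X ω j - ∫ ω', X ω' j ∂μ) =
      (((X ω i - (μ[fun ω' => X ω' i | F]) ω) * (X ω j - (μ[fun ω' => X ω' j | F]) ω)
      + (X ω i - (μ[fun ω' => X ω' i | F]) ω) * ((μ[fun ω' => X ω' j | F]) ω - ∫ ω', X ω' j ∂μ))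
      + (X ω j - (μ[fun ω' => X ω' j | F]) ω) * ((μ[fun ω' => X ω' i | F]) ω - ∫ ω', X ω' i ∂μ))
      + ((μ[fun ω' => X ω' i | F]) ω - ∫ ω', X ω' i ∂μ) *
        ((μ[fun ω' => X ω' j | F]) ω - ∫ ω', X ω' j ∂μ) := by
    intro ω; ring
  simp_rw [key]
  have i1 : Integrable (fun ω => (X ω i - (μ[fun ω' => X ω' i | F]) ω) *
      (X ω j - (μ[fun ω' => X ω' j | F]) ω)) μ := (hR i).integrable_mul (hR j)
  have i2 : Integrable (fun ω => (X ω i - (μ[fun ω' => X ω' i | F]) ω) *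
      ((μ[fun ω' => X ω' j | F]) ω - ∫ ω', X ω' j ∂μ)) μ := (hR i).integrable_mul (hc j)
  have i3 : Integrable (fun ω => (X ω j - (μ[fun ω' => X ω' j | F]) ω) *
      ((μ[fun ω' => X ω' i | F]) ω - ∫ ω', X ω' i ∂μ)) μ := (hR j).integrable_mul (hc i)
  have i4 : Integrable (fun ω => ((μ[fun ω' => X ω' i | F]) ω - ∫ ω', X ω' i ∂μ) *
      ((μ[fun ω' => X ω' j | F]) ω - ∫ ω', X ω' j ∂μ)) μ := (hc i).integrable_mul (hc j)
  rw [cl_int_add4 i1 i2 i3 i4,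
    cl_orth μ hF (hX i) (hc j) (hcm j), cl_orth μ hF (hX j) (hc i) (hcm i)]
  ring

theorem cl_proj {Ω : Type} {F mΩ : MeasurableSpace Ω} (μ : Measure Ω) [IsProbabilityMeasure μ]
    (hF : F ≤ mΩ) {m : ℕ} (X : Ω → Fin m → ℝ) (hX : ∀ i, MemLp (fun ω => X ω i) 2 μ)
    (v : Fin m → ℝ) (g : Ω → ℝ) (hg : MemLp g 2 μ) (hgm : StronglyMeasurable[F] g) :
    ∫ ω, (∑ i, v i * (X ω i - (μ[fun ω' => X ω' i | F]) ω)) ^ 2 ∂μ ≤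
      ∫ ω, (∑ i, v i * X ω i - g ω) ^ 2 ∂μ := by
  have hY : ∀ i, MemLp (μ[fun ω' => X ω' i | F]) 2 μ := fun i => (hX i).condExp (by norm_num)
  have hR : ∀ i, MemLp (fun ω => X ω i - (μ[fun ω' => X ω' i | F]) ω) 2 μ :=
    fun i => (hX i).sub (hY i)
  set D : Ω → ℝ := fun ω => ∑ i, v i * (μ[fun ω' => X ω' i | F]) ω - g ω with hD
  have hDL : MemLp D 2 μ :=
    (memLp_finsetSum _ (fun i _ => (hY i).const_mul (v i))).sub hg
  have hDm : StronglyMeasurable[F] D := by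
    refine StronglyMeasurable.sub ?_ hgm
    exact Finset.stronglyMeasurable_fun_sum _ (fun i _ => stronglyMeasurable_condExp.const_mul _)
  have hRL : MemLp (fun ω => ∑ i, v i * (X ω i - (μ[fun ω' => X ω' i | F]) ω)) 2 μ :=
    memLp_finsetSum _ (fun i _ => (hR i).const_mul (v i))
  have hcross : ∫ ω, (∑ i, v i * (X ω i - (μ[fun ω' => X ω' i | F]) ω)) * D ω ∂μ = 0 := by
    simp_rw [Finset.sum_mul, mul_assoc]
    rw [integral_finsetSum]
    · refine Finset.sum_eq_zero fun i _ => ?_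
      rw [integral_const_mul, cl_orth μ hF (hX i) hDL hDm, mul_zero]
    · intro i _
      exact ((hR i).integrable_mul hDL).const_mul (v i)
  have key : ∀ ω, (∑ i, v i * X ω i - g ω) ^ 2 =
      ((∑ i, v i * (X ω i - (μ[fun ω' => X ω' i | F]) ω)) ^ 2 +
      2 * ((∑ i, v i * (X ω i - (μ[fun ω' => X ω' i | F]) ω)) * D ω)) + D ω ^ 2 := by
    intro ω
    simp only [hD, mul_sub, Finset.sum_sub_distrib]
    ring
  simp_rw [key]
  have i1 := hRL.integrable_sq
  have i2 : Integrable (fun ω => 2 * ((∑ i, v i * (X ω i - (μ[fun ω' => X ω' i | F]) ω)) * D ω)) μ :=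
    (hRL.integrable_mul hDL).const_mul 2
  rw [cl_int_add3 i1 i2 hDL.integrable_sq, integral_const_mul, hcross]
  have : 0 ≤ ∫ ω, D ω ^ 2 ∂μ := integral_nonneg fun ω => sq_nonneg _
  linarith

theorem cl_quad {Ω : Type} {mΩ : MeasurableSpace Ω} (μ : Measure Ω)
    {m : ℕ} (R : Ω → Fin m → ℝ) (hR : ∀ i, MemLp (fun ω => R ω i) 2 μ) (A : Matrix (Fin m) (Fin m) ℝ) :
    Integrable (fun ω => ∑ i, ∑ j, A i j * (R ω i * R ω j)) μ ∧
    ∫ ω, ∑ i, ∑ j, A i j * (R ω i * R ω j) ∂μ =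
      ∑ i, ∑ j, A i j * ∫ ω, R ω i * R ω j ∂μ := by
  have h0 : ∀ i j, Integrable (fun ω => A i j * (R ω i * R ω j)) μ :=
    fun i j => ((hR i).integrable_mul (hR j)).const_mul _
  have h1 : ∀ i, Integrable (fun ω => ∑ j, A i j * (R ω i * R ω j)) μ :=
    fun i => integrable_finsetSum _ fun j _ => h0 i j
  refine ⟨integrable_finsetSum _ fun i _ => h1 i, ?_⟩
  rw [integral_finsetSum _ fun i _ => h1 i]
  refine Finset.sum_congr rfl fun i _ => ?_
  rw [integral_finsetSum _ fun j _ => h0 i j]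
  refine Finset.sum_congr rfl fun j _ => ?_
  rw [integral_const_mul]

theorem cl_sq_sum {m : ℕ} (v r : Fin m → ℝ) :
    (∑ i, v i * r i) ^ 2 = ∑ i, ∑ j, (v i * v j) * (r i * r j) := by
  rw [sq, Finset.sum_mul_sum]
  exact Finset.sum_congr rfl fun i _ => Finset.sum_congr rfl fun j _ => by ring

theorem cl_frob {Ω : Type} {mΩ : MeasurableSpace Ω} (μ : Measure Ω)
    {m : ℕ} (R X : Ω → Fin m → ℝ) (hR : ∀ i, MemLp (fun ω => R ω i) 2 μ)
    (hX : ∀ i, MemLp (fun ω => X ω i) 2 μ)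
    (hle : ∀ v : Fin m → ℝ, ∫ ω, (∑ i, v i * R ω i) ^ 2 ∂μ ≤ ∫ ω, (∑ i, v i * X ω i) ^ 2 ∂μ)
    (U : Matrix (Fin m) (Fin m) ℝ) (l : Fin m → ℝ)
    (hM : ∀ i j, ∫ ω, X ω i * X ω j ∂μ = ∑ a, l a * (U i a * U j a)) :
    ∑ i, ∑ j, (∫ ω, R ω i * R ω j ∂μ) ^ 2 ≤ ∑ a, l a * ∫ ω, (∑ i, U i a * R ω i) ^ 2 ∂μ := by
  have q1 := fun A => cl_quad μ R hR A
  have q2 := fun A => cl_quad μ X hX A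
  have hle' : ∀ v : Fin m → ℝ, ∑ i, ∑ j, (∫ ω, R ω i * R ω j ∂μ) * (v i * v j) ≤
      ∑ i, ∑ j, (∫ ω, X ω i * X ω j ∂μ) * (v i * v j) := by
    intro v
    have := hle v
    simp_rw [cl_sq_sum] at this
    have e1 := (q1 (Matrix.of fun i j => v i * v j)).2
    have e2 := (q2 (Matrix.of fun i j => v i * v j)).2
    simp only [Matrix.of_apply] at e1 e2
    rw [e1, e2] at this
    simpa only [mul_comm] using this
  have s1 : ∑ i, ∑ j, (∫ ω, R ω i * R ω j ∂μ) ^ 2 =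
      ∫ ω, ∑ i, ∑ j, (∫ ω, R ω i * R ω j ∂μ) * (R ω i * R ω j) ∂μ := by
    have := (q1 (Matrix.of fun i j => ∫ ω, R ω i * R ω j ∂μ)).2
    simp only [Matrix.of_apply] at this
    rw [this]
    simp only [sq]
  have s2 : ∫ ω, ∑ i, ∑ j, (∫ ω, R ω i * R ω j ∂μ) * (R ω i * R ω j) ∂μ ≤
      ∫ ω, ∑ i, ∑ j, (∫ ω, X ω i * X ω j ∂μ) * (R ω i * R ω j) ∂μ :=
    integral_mono (q1 (Matrix.of fun i j => ∫ ω, R ω i * R ω j ∂μ)).1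
      (q1 (Matrix.of fun i j => ∫ ω, X ω i * X ω j ∂μ)).1 (fun ω => hle' (R ω))
  rw [s1]
  refine s2.trans (le_of_eq ?_)
  have s3 : ∀ ω, ∑ i, ∑ j, (∫ ω, X ω i * X ω j ∂μ) * (R ω i * R ω j) =
      ∑ a, l a * (∑ i, U i a * R ω i) ^ 2 := by
    intro ω
    simp_rw [cl_sq_sum, hM, Finset.mul_sum, Finset.sum_mul]
    conv_rhs => rw [Finset.sum_comm]
    refine Finset.sum_congr rfl fun i _ => ?_
    conv_rhs => rw [Finset.sum_comm]
    refine Finset.sum_congr rfl fun j _ => Finset.sum_congr rfl fun a _ => ?_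
    ring
  simp_rw [s3]
  rw [integral_finsetSum]
  · exact Finset.sum_congr rfl fun a _ => integral_const_mul _ _
  · intro a _
    exact (MemLp.integrable_sq (memLp_finsetSum _ (fun i _ => (hR i).const_mul (U i a)))).const_mul _

theorem cl_spectral {m : ℕ} (M : Matrix (Fin m) (Fin m) ℝ) (hM : M.IsHermitian) :
    ∃ (U : Matrix (Fin m) (Fin m) ℝ) (l : Fin m → ℝ), U * Uᵀ = 1 ∧ Uᵀ * U = 1 ∧
      M = U * Matrix.diagonal l * Uᵀ := by
  refine ⟨hM.eigenvectorUnitary, hM.eigenvalues, ?_, ?_, ?_⟩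
  · have := Unitary.coe_mul_star_self hM.eigenvectorUnitary
    simpa [Matrix.star_eq_conjTranspose, Matrix.conjTranspose_eq_transpose_of_trivial] using this
  · have := Unitary.coe_star_mul_self hM.eigenvectorUnitary
    simpa [Matrix.star_eq_conjTranspose, Matrix.conjTranspose_eq_transpose_of_trivial] using this
  · have := hM.spectral_theorem
    rw [Unitary.conjStarAlgAut_apply] at this
    simpa [Matrix.star_eq_conjTranspose, Matrix.conjTranspose_eq_transpose_of_trivial] using this

theorem cl_count (ι : Type) [Fintype ι] [DecidableEq ι] (t : ℕ) (hc : Fintype.card ι ≤ t) :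
    ((Fintype.piFinset (fun _ : ι => Finset.Icc (-(2 * t : ℤ)) (2 * t))).filter
      (fun z => ∑ i, (z i).natAbs ≤ 2 * t)).card ≤ 12 ^ t := by
  have hsum : ∀ n : ℕ, ∑ z ∈ Finset.Icc (-(n : ℤ)) n, ((1 : ℝ) / 2) ^ z.natAbs
      = 3 - 2 * (1 / 2) ^ n := by
    intro n
    induction n with
    | zero => simp; norm_num
    | succ n ih =>
      have : Finset.Icc (-((n + 1 : ℕ) : ℤ)) ((n + 1 : ℕ) : ℤ) =
          insert (-((n + 1 : ℕ) : ℤ)) (insert ((n + 1 : ℕ) : ℤ) (Finset.Icc (-(n : ℤ)) n)) := by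
        ext z; simp only [Finset.mem_Icc, Finset.mem_insert]; omega
      rw [this, Finset.sum_insert, Finset.sum_insert, ih]
      · simp only [Int.natAbs_neg, Int.natAbs_natCast]; ring
      · simp
      · simp only [Finset.mem_insert, Finset.mem_Icc]; omega
  have hle : ∑ z ∈ Finset.Icc (-(2 * t : ℤ)) (2 * t), ((1 : ℝ) / 2) ^ z.natAbs ≤ 3 := by
    have := hsum (2 * t)
    push_cast at this
    rw [this]
    have : (0 : ℝ) ≤ (1 / 2) ^ (2 * t) := by positivity
    linarith
  have hnn : 0 ≤ ∑ z ∈ Finset.Icc (-(2 * t : ℤ)) (2 * t), ((1 : ℝ) / 2) ^ z.natAbs :=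
    Finset.sum_nonneg fun z _ => by positivity
  have hprod : ∑ p ∈ Fintype.piFinset (fun _ : ι => Finset.Icc (-(2 * t : ℤ)) (2 * t)),
      ∏ i, ((1 : ℝ) / 2) ^ (p i).natAbs ≤ 3 ^ t := by
    rw [← Finset.prod_univ_sum (fun _ : ι => Finset.Icc (-(2 * t : ℤ)) (2 * t))
      (fun _ z => ((1 : ℝ) / 2) ^ z.natAbs)]
    rw [Finset.prod_const, Finset.card_univ]
    exact (pow_le_pow_left₀ hnn hle _).trans (pow_le_pow_right₀ (by norm_num) hc)
  set T := (Fintype.piFinset (fun _ : ι => Finset.Icc (-(2 * t : ℤ)) (2 * t))).filter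
      (fun z => ∑ i, (z i).natAbs ≤ 2 * t) with hT
  have h1 : (T.card : ℝ) * (1 / 2) ^ (2 * t) ≤ 3 ^ t := by
    refine le_trans ?_ hprod
    rw [← nsmul_eq_mul]
    refine (Finset.card_nsmul_le_sum T (fun p => ∏ i, ((1 : ℝ) / 2) ^ (p i).natAbs) _ ?_).trans ?_
    · intro p hp
      rw [Finset.prod_pow_eq_pow_sum]
      exact pow_le_pow_of_le_one (by norm_num) (by norm_num) (Finset.mem_filter.1 hp).2
    · exact Finset.sum_le_sum_of_subset_of_nonneg (Finset.filter_subset _ _)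
        fun p _ _ => Finset.prod_nonneg fun i _ => by positivity
  have h2 : (T.card : ℝ) ≤ 12 ^ t := by
    rw [pow_mul, show ((1 : ℝ) / 2) ^ 2 = 1 / 4 by norm_num, one_div, inv_pow,
      mul_inv_le_iff₀ (by positivity), ← mul_pow] at h1
    norm_num at h1
    exact h1
  exact_mod_cast h2

theorem cl_bessel {m : ℕ} (U : Matrix (Fin m) (Fin m) ℝ) (hU : U * Uᵀ = 1) (x : Fin m → ℝ) :
    ∑ a, (∑ i, U i a * x i) ^ 2 = ∑ i, x i ^ 2 := by
  have h1 : ∀ i j, ∑ a, U i a * U j a = if i = j then 1 else 0 := by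
    intro i j
    have := congrFun (congrFun hU i) j
    simpa [Matrix.mul_apply, Matrix.one_apply] using this
  simp_rw [cl_sq_sum]
  rw [Finset.sum_comm]
  refine Finset.sum_congr rfl fun i _ => ?_
  rw [Finset.sum_comm]
  simp_rw [← Finset.sum_mul, h1]
  simp [sq]

theorem cl_code_mem {m : ℕ} (I : Finset (Fin m)) (t : ℕ) (hI : I.card ≤ t) (y : Fin m → ℝ)
    (hy : ∑ a, y a ^ 2 ≤ 1) :
    (fun a : I => ⌊√(t : ℝ) * y a⌋) ∈
      (Fintype.piFinset (fun _ : I => Finset.Icc (-(2 * t : ℤ)) (2 * t))).filter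
      (fun z => ∑ i, (z i).natAbs ≤ 2 * t) := by
  have hs : ∑ a : I, (⌊√(t : ℝ) * y a⌋).natAbs ≤ 2 * t := by
    have h1 : ∀ a : I, (((⌊√(t : ℝ) * y a⌋).natAbs : ℕ) : ℝ) ≤ √(t : ℝ) * |y a| + 1 := by
      intro a
      rw [Nat.cast_natAbs, Int.cast_abs]
      have e1 := Int.floor_le (√(t : ℝ) * y a)
      have e2 := Int.lt_floor_add_one (√(t : ℝ) * y a)
      have e3 : |√(t : ℝ) * y a| = √(t : ℝ) * |y a| := by
        rw [abs_mul, abs_of_nonneg (Real.sqrt_nonneg _)]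
      rw [← e3, abs_le]
      have e4 := neg_abs_le (√(t : ℝ) * y a)
      have e5 := le_abs_self (√(t : ℝ) * y a)
      constructor <;> linarith
    have h2 : ((∑ a : I, (⌊√(t : ℝ) * y a⌋).natAbs : ℕ) : ℝ) ≤ √(t : ℝ) * ∑ a : I, |y a| + I.card := by
      push_cast
      refine (Finset.sum_le_sum fun a _ => by simpa using h1 a).trans (le_of_eq ?_)
      rw [Finset.sum_add_distrib, Finset.mul_sum]
      simp
    have h3 : ∑ a : I, |y a| ≤ √(t : ℝ) := by
      apply Real.le_sqrt_of_sq_le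
      have h4 := sq_sum_le_card_mul_sum_sq (s := (Finset.univ : Finset I)) (f := fun a => |y a|)
      have h5 : ∑ a : I, |y a| ^ 2 ≤ 1 := by
        simp_rw [sq_abs]
        rw [Finset.sum_coe_sort I (fun a => y a ^ 2)]
        exact (Finset.sum_le_sum_of_subset_of_nonneg (Finset.subset_univ _)
          fun _ _ _ => sq_nonneg _).trans hy
      have h6 : ((Finset.univ : Finset I).card : ℝ) ≤ t := by
        rw [Finset.card_univ, Fintype.card_coe]; exact_mod_cast hI
      refine h4.trans ?_
      calc _ ≤ (t : ℝ) * 1 := by gcongr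
        _ = t := mul_one _
    have h7 : ((∑ a : I, (⌊√(t : ℝ) * y a⌋).natAbs : ℕ) : ℝ) ≤ ((2 * t : ℕ) : ℝ) := by
      refine h2.trans ?_
      have : √(t : ℝ) * ∑ a : I, |y a| ≤ √(t : ℝ) * √(t : ℝ) := by gcongr
      rw [Real.mul_self_sqrt (Nat.cast_nonneg t)] at this
      have h8 : (I.card : ℝ) ≤ t := by exact_mod_cast hI
      push_cast
      linarith
    exact_mod_cast h7
  rw [Finset.mem_filter]
  refine ⟨?_, hs⟩
  rw [Fintype.mem_piFinset]
  intro a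
  have : (⌊√(t : ℝ) * y a⌋).natAbs ≤ 2 * t :=
    (Finset.single_le_sum (f := fun a : I => (⌊√(t : ℝ) * y a⌋).natAbs)
      (fun _ _ => Nat.zero_le _) (Finset.mem_univ a)).trans hs
  rw [Finset.mem_Icc]
  omega

theorem cl_quant {m : ℕ} (U : Matrix (Fin m) (Fin m) ℝ) (hU : U * Uᵀ = 1) (I : Finset (Fin m))
    (t k : ℕ) (hI : I.card ≤ t) (hk : 12 ^ t ≤ k) :
    ∃ q : (Fin m → ℝ) → Fin k, Measurable q ∧ ∃ h : Fin m → Fin k → ℝ,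
      ∀ x : Fin m → ℝ, ∑ i, x i ^ 2 ≤ 1 → ∀ a ∈ I,
        (∑ i, U i a * x i - h a (q x)) ^ 2 ≤ 1 / t := by
  classical
  set T := (Fintype.piFinset (fun _ : I => Finset.Icc (-(2 * t : ℤ)) (2 * t))).filter
      (fun z => ∑ i, (z i).natAbs ≤ 2 * t) with hT
  have hTk : T.card ≤ k := (cl_count I t (by simpa using hI)).trans hk
  have hk0 : 0 < k := lt_of_lt_of_le (by positivity) hk
  obtain ⟨e⟩ : Nonempty (T ↪ Fin k) :=
    Function.Embedding.nonempty_of_card_le (by simpa using hTk)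
  let f : (I → ℤ) → Fin k := fun z => if h : z ∈ T then e ⟨z, h⟩ else ⟨0, hk0⟩
  have hf : Set.InjOn f T := by
    intro z hz w hw hzw
    have hz' : z ∈ T := hz
    have hw' : w ∈ T := hw
    simp only [f, dif_pos hz', dif_pos hw'] at hzw
    exact congrArg Subtype.val (e.injective hzw)
  let code : (Fin m → ℝ) → (I → ℤ) := fun x a => ⌊√(t : ℝ) * ∑ i, U i a * x i⌋
  have hcode : Measurable code := by
    refine measurable_pi_lambda _ fun a => Int.measurable_floor.comp ?_
    fun_prop
  refine ⟨f ∘ code, (measurable_of_countable f).comp hcode,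
    fun a j => if ha : a ∈ I then ((Function.invFunOn f T j ⟨a, ha⟩ : ℤ) : ℝ) / √(t : ℝ) else 0, ?_⟩
  intro x hx a ha
  have hmem : code x ∈ T :=
    cl_code_mem I t hI (fun a => ∑ i, U i a * x i) (by rw [cl_bessel U hU]; exact hx)
  have hinv : Function.invFunOn f T (f (code x)) = code x := hf.leftInvOn_invFunOn hmem
  simp only [Function.comp_apply, dif_pos ha, hinv]
  have ht : 0 < (t : ℝ) := by
    exact_mod_cast lt_of_lt_of_le (Finset.card_pos.2 ⟨a, ha⟩) hI
  have hst : 0 < √(t : ℝ) := Real.sqrt_pos.2 ht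
  set y := ∑ i, U i a * x i with hy
  change (y - ((⌊√(t : ℝ) * y⌋ : ℤ) : ℝ) / √(t : ℝ)) ^ 2 ≤ 1 / t
  have e1 := Int.floor_le (√(t : ℝ) * y)
  have e2 := Int.lt_floor_add_one (√(t : ℝ) * y)
  have e3 : y - ((⌊√(t : ℝ) * y⌋ : ℤ) : ℝ) / √(t : ℝ) =
      (√(t : ℝ) * y - ((⌊√(t : ℝ) * y⌋ : ℤ) : ℝ)) / √(t : ℝ) := by
    field_simp
  rw [e3, div_pow, Real.sq_sqrt ht.le]
  gcongr
  rw [sq_le_one_iff_abs_le_one, abs_le]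
  constructor <;> linarith

theorem covariance_loss_optimal :
    ∃ C : ℝ, 0 < C ∧
      ∀ (Ω : Type) [MeasurableSpace Ω] (μ : Measure Ω) [IsProbabilityMeasure μ]
        (m : ℕ) (X : Ω → Fin m → ℝ), Measurable X →
        (∀ᵐ ω ∂μ, Real.sqrt (∑ i, X ω i ^ 2) ≤ 1) →
        ∀ k : ℕ, 3 ≤ k →
        ∃ P : Fin k → Set (Fin m → ℝ),
          (∀ j, MeasurableSet (P j)) ∧
          (Pairwise fun j j' => Disjoint (P j) (P j')) ∧
          (⋃ j, P j) = Set.univ ∧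
          frobNorm (covMatrix μ X - covMatrix μ
              (fun ω i => (μ[fun ω' => X ω' i |
                MeasurableSpace.generateFrom {s : Set Ω | ∃ j, s = X ⁻¹' P j}]) ω))
            ≤ C / Real.sqrt (Real.log k) := by
  have hlog12 : 0 < Real.log 12 := Real.log_pos (by norm_num)
  refine ⟨√(2 * Real.log 12), Real.sqrt_pos.2 (by positivity), ?_⟩
  intro Ω mΩ μ _ m X hXm hXb k hk
  have hb : ∀ᵐ ω ∂μ, ∑ i, X ω i ^ 2 ≤ 1 := by
    filter_upwards [hXb] with ω h
    simpa using (Real.sqrt_le_iff.1 h).2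
  have hXi : ∀ i, Measurable fun ω => X ω i := fun i => (measurable_pi_apply i).comp hXm
  have hX : ∀ i, MemLp (fun ω => X ω i) 2 μ := by
    intro i
    refine MemLp.of_bound (hXi i).aestronglyMeasurable 1 ?_
    filter_upwards [hb] with ω h
    rw [Real.norm_eq_abs, ← sq_le_one_iff_abs_le_one]
    exact (Finset.single_le_sum (f := fun i => X ω i ^ 2) (fun _ _ => sq_nonneg _)
      (Finset.mem_univ i)).trans h
  -- spectral decomposition of the second moment matrix
  obtain ⟨U, l, hU1, hU2, hUM⟩ := cl_spectral (Matrix.of fun i j => ∫ ω, X ω i * X ω j ∂μ) (by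
    ext i j
    simp [Matrix.conjTranspose_apply, mul_comm])
  have hM : ∀ i j, ∫ ω, X ω i * X ω j ∂μ = ∑ a, l a * (U i a * U j a) := by
    intro i j
    have := congrFun (congrFun hUM i) j
    rw [Matrix.of_apply] at this
    rw [this, Matrix.mul_apply]
    refine Finset.sum_congr rfl fun a _ => ?_
    rw [Matrix.mul_diagonal, Matrix.transpose_apply]
    ring
  have hl : ∀ a, ∫ ω, (∑ i, U i a * X ω i) ^ 2 ∂μ = l a := by
    intro a
    simp_rw [cl_sq_sum]
    have e := (cl_quad μ X hX (Matrix.of fun i j => U i a * U j a)).2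
    simp only [Matrix.of_apply] at e
    rw [e]
    have h1 : Uᵀ * (Matrix.of fun i j => ∫ ω, X ω i * X ω j ∂μ) * U = Matrix.diagonal l := by
      rw [hUM, ← Matrix.mul_assoc, ← Matrix.mul_assoc, hU2, Matrix.one_mul, Matrix.mul_assoc, hU2,
        Matrix.mul_one]
    have h2 := congrFun (congrFun h1 a) a
    rw [Matrix.diagonal_apply_eq] at h2
    rw [← h2, Matrix.mul_apply]
    simp_rw [Matrix.mul_apply, Finset.sum_mul]
    rw [Finset.sum_comm]
    refine Finset.sum_congr rfl fun i _ => Finset.sum_congr rfl fun j _ => ?_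
    simp only [Matrix.transpose_apply, Matrix.of_apply]
    ring
  have hl0 : ∀ a, 0 ≤ l a := fun a => by
    rw [← hl a]; exact integral_nonneg fun ω => sq_nonneg _
  have hl1 : ∑ a, l a ≤ 1 := by
    have hi : ∀ a, Integrable (fun ω => (∑ i, U i a * X ω i) ^ 2) μ := fun a =>
      (memLp_finsetSum _ (fun i _ => (hX i).const_mul (U i a))).integrable_sq
    simp_rw [← hl]
    rw [← integral_finsetSum _ fun a _ => hi a]
    calc _ ≤ ∫ _ : Ω, (1 : ℝ) ∂μ := by
          refine integral_mono_ae (integrable_finsetSum _ fun a _ => hi a) (integrable_const _) ?_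
          filter_upwards [hb] with ω h
          exact (cl_bessel U hU1 (X ω)).trans_le h
      _ = 1 := by simp
  -- the threshold
  set t := Nat.log 12 k with ht
  have hkt : 12 ^ t ≤ k := Nat.pow_log_le_self 12 (by omega)
  have hkt' : k < 12 ^ (t + 1) := Nat.lt_pow_succ_log_self (by norm_num) k
  set I : Finset (Fin m) := Finset.univ.filter (fun a => 1 / ((t : ℝ) + 1) < l a) with hIdef
  have htp : (0 : ℝ) < (t : ℝ) + 1 := by positivity
  have hI : I.card ≤ t := by
    by_contra hcon
    have h1 : t + 1 ≤ I.card := by omega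
    have hne : I.Nonempty := Finset.card_pos.1 (by omega)
    have h2 : ∑ a ∈ I, 1 / ((t : ℝ) + 1) < ∑ a ∈ I, l a :=
      Finset.sum_lt_sum_of_nonempty hne fun a ha => (Finset.mem_filter.1 ha).2
    have h3 : ∑ a ∈ I, l a ≤ ∑ a, l a :=
      Finset.sum_le_sum_of_subset_of_nonneg (Finset.subset_univ _) fun a _ _ => hl0 a
    rw [Finset.sum_const, nsmul_eq_mul, mul_one_div] at h2
    have h4 : (1 : ℝ) ≤ (I.card : ℝ) / ((t : ℝ) + 1) := by
      rw [one_le_div htp]; exact_mod_cast h1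
    linarith
  obtain ⟨q, hq, h, hqh⟩ := cl_quant U hU1 I t k hI hkt
  refine ⟨fun j => q ⁻¹' {j}, fun j => hq (measurableSet_singleton j), ?_, ?_, ?_⟩
  · intro j j' hjj
    rw [Set.disjoint_left]
    intro x hx hx'
    exact hjj (hx.symm.trans hx')
  · ext x; simp
  set F := MeasurableSpace.generateFrom {s : Set Ω | ∃ j, s = X ⁻¹' (q ⁻¹' {j})} with hFdef
  have hF : F ≤ mΩ := by
    refine MeasurableSpace.generateFrom_le ?_
    rintro s ⟨j, rfl⟩
    exact hXm (hq (measurableSet_singleton j))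
  have hqF : Measurable[F] (q ∘ X) := by
    refine @measurable_to_countable' _ _ _ _ F _ fun j => ?_
    exact MeasurableSpace.measurableSet_generateFrom ⟨j, rfl⟩
  have hgF : ∀ a, StronglyMeasurable[F] (fun ω => h a (q (X ω))) := by
    intro a
    have hm : Measurable[F] (fun ω => h a (q (X ω))) := (measurable_of_countable (h a)).comp hqF
    exact hm.stronglyMeasurable
  have hgL : ∀ a, MemLp (fun ω => h a (q (X ω))) 2 μ := by
    intro a
    refine MemLp.of_bound ((hgF a).mono hF).aestronglyMeasurable (∑ j, |h a j|) ?_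
    refine Filter.Eventually.of_forall fun ω => ?_
    rw [Real.norm_eq_abs]
    exact Finset.single_le_sum (f := fun j => |h a j|) (fun _ _ => abs_nonneg _)
      (Finset.mem_univ _)
  have hle : ∀ v : Fin m → ℝ, ∫ ω, (∑ i, v i * (X ω i - (μ[fun ω' => X ω' i | F]) ω)) ^ 2 ∂μ ≤
      ∫ ω, (∑ i, v i * X ω i) ^ 2 ∂μ := by
    intro v
    have := cl_proj μ hF X hX v (fun _ => 0) (memLp_const 0) stronglyMeasurable_const
    simpa using this
  have hR : ∀ i, MemLp (fun ω => X ω i - (μ[fun ω' => X ω' i | F]) ω) 2 μ :=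
    fun i => (hX i).sub ((hX i).condExp (by norm_num))
  have hfrob := cl_frob μ (fun ω i => X ω i - (μ[fun ω' => X ω' i | F]) ω) X hR hX hle U l hM
  have hdiag : ∀ a, ∫ ω, (∑ i, U i a * (X ω i - (μ[fun ω' => X ω' i | F]) ω)) ^ 2 ∂μ ≤
      2 / ((t : ℝ) + 1) := by
    intro a
    by_cases ha : a ∈ I
    · have ht1 : (1 : ℝ) ≤ t := by
        exact_mod_cast (Finset.card_pos.2 ⟨a, ha⟩ : 0 < I.card).trans_le hI
      have h1 := cl_proj μ hF X hX (fun i => U i a) _ (hgL a) (hgF a)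
      refine h1.trans ?_
      calc _ ≤ ∫ _ : Ω, 1 / (t : ℝ) ∂μ := by
            refine integral_mono_ae ?_ (integrable_const _) ?_
            · exact ((memLp_finsetSum _
                (fun i _ => (hX i).const_mul (U i a))).sub (hgL a)).integrable_sq
            · filter_upwards [hb] with ω hω
              exact hqh (X ω) hω a ha
        _ = 1 / (t : ℝ) := by simp
        _ ≤ 2 / ((t : ℝ) + 1) := by
            rw [div_le_div_iff₀ (by linarith) htp]; linarith
    · have h1 : l a ≤ 1 / ((t : ℝ) + 1) := by
        by_contra hcon
        exact ha (Finset.mem_filter.2 ⟨Finset.mem_univ _, not_le.1 hcon⟩)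
      refine (hle fun i => U i a).trans ?_
      rw [hl a]
      refine h1.trans ?_
      gcongr
      norm_num
  have hfinal : ∑ i, ∑ j, (∫ ω, (X ω i - (μ[fun ω' => X ω' i | F]) ω) *
      (X ω j - (μ[fun ω' => X ω' j | F]) ω) ∂μ) ^ 2 ≤ 2 / ((t : ℝ) + 1) := by
    refine hfrob.trans ?_
    calc _ ≤ ∑ a, l a * (2 / ((t : ℝ) + 1)) :=
          Finset.sum_le_sum fun a _ => mul_le_mul_of_nonneg_left (hdiag a) (hl0 a)
      _ = (∑ a, l a) * (2 / ((t : ℝ) + 1)) := by rw [Finset.sum_mul]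
      _ ≤ 1 * (2 / ((t : ℝ) + 1)) := by gcongr
      _ = _ := one_mul _
  have hk3 : (3 : ℝ) ≤ k := by exact_mod_cast hk
  have hlogk : 0 < Real.log k := Real.log_pos (by linarith)
  have hlogle : Real.log k ≤ ((t : ℝ) + 1) * Real.log 12 := by
    have h1 : Real.log k ≤ Real.log ((12 : ℝ) ^ (t + 1)) :=
      Real.log_le_log (by linarith) (by exact_mod_cast hkt'.le)
    rw [Real.log_pow] at h1
    exact_mod_cast h1
  rw [← Real.sqrt_div (by positivity), frobNorm]
  apply Real.sqrt_le_sqrt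
  simp_rw [cl_cov μ hF X hX]
  refine hfinal.trans ?_
  rw [div_le_div_iff₀ htp hlogk]
  nlinarith
end

section
/- Let X be a random vector valued in ℝ^m such that ‖X‖₂ ≤ 1 almost surely, and let C be the absolute constant from the main covariance-loss theorem. Then for every integer k ≥ 3 and every integer d ≥ 2, there exists a measurable partition of ℝ^m into at most k sets such that, with F the generated sigma-algebra and Y = E[X | F], one has ‖E[X^{⊗d}] − E[Y^{⊗d}]‖_F ≤ 4^d · C / √(log k). -/
open MeasureTheory ProbabilityTheory Real Finset


lemma cl_rounding {ι : Type*} [DecidableEq ι] (M : ι → ι → ℝ) (hsym : ∀ i j, M i j = M j i)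
    (hdiag : ∀ i, 0 ≤ M i i) (a : ι → ℝ) (h : ℝ) (hh : 0 < h) (s : Finset ι) :
    ∃ e : ι → ℝ, (∀ i, ∃ z : ℤ, e i = a i - h * z ∧ |e i| ≤ h) ∧
      ∑ i ∈ s, ∑ j ∈ s, M i j * (e i * e j) ≤ h ^ 2 * ∑ i ∈ s, M i i := by
  have hi : ∀ i, ∃ z : ℤ, 0 ≤ a i - h * z ∧ a i - h * z ≤ h := by
    intro i
    refine ⟨⌊a i / h⌋, ?_, ?_⟩
    · have := Int.floor_le (a i / h)
      rw [le_div_iff₀ hh] at this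
      linarith
    · have := (Int.lt_floor_add_one (a i / h)).le
      rw [div_le_iff₀ hh] at this
      linarith
  have lo : ∀ i, ∃ z : ℤ, -h ≤ a i - h * z ∧ a i - h * z ≤ 0 := by
    intro i
    obtain ⟨z, h1, h2⟩ := hi i
    refine ⟨z + 1, ?_, ?_⟩ <;> push_cast <;> linarith
  induction s using Finset.induction_on with
  | empty =>
    choose z h1 h2 using hi
    refine ⟨fun i => a i - h * z i, fun i => ⟨z i, rfl, ?_⟩, by simp⟩
    rw [abs_le]; constructor <;> linarith [h1 i, h2 i]
  | insert x s hx ih =>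
    obtain ⟨e, he, hs⟩ := ih
    have : ∃ v : ℝ, (∃ z : ℤ, v = a x - h * z ∧ |v| ≤ h) ∧
        v * (∑ j ∈ s, M x j * e j) ≤ 0 := by
      rcases le_total 0 (∑ j ∈ s, M x j * e j) with h0 | h0
      · obtain ⟨z, h1, h2⟩ := lo x
        exact ⟨_, ⟨z, rfl, by rw [abs_le]; constructor <;> linarith⟩,
          mul_nonpos_of_nonpos_of_nonneg h2 h0⟩
      · obtain ⟨z, h1, h2⟩ := hi x
        exact ⟨_, ⟨z, rfl, by rw [abs_le]; constructor <;> linarith⟩,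
          mul_nonpos_of_nonneg_of_nonpos h1 h0⟩
    obtain ⟨v, hv, hv0⟩ := this
    refine ⟨Function.update e x v, ?_, ?_⟩
    · intro i
      by_cases hix : i = x
      · subst hix; simpa using hv
      · simpa [Function.update_of_ne hix] using he i
    · have hne : ∀ i ∈ s, Function.update e x v i = e i := fun i hi =>
        Function.update_of_ne (by rintro rfl; exact hx hi) _ _
      rw [Finset.sum_insert hx, Finset.sum_insert hx, Finset.sum_insert hx]
      have e1 : ∑ j ∈ s, M x j * (Function.update e x v x * Function.update e x v j)
          = v * (∑ j ∈ s, M x j * e j) := by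
        rw [Finset.mul_sum]
        refine Finset.sum_congr rfl fun j hj => ?_
        rw [hne j hj]; simp; ring
      have e2 : ∑ i ∈ s, ∑ j ∈ insert x s,
            M i j * (Function.update e x v i * Function.update e x v j)
          = v * (∑ j ∈ s, M x j * e j) + ∑ i ∈ s, ∑ j ∈ s, M i j * (e i * e j) := by
        rw [Finset.mul_sum, ← Finset.sum_add_distrib]
        refine Finset.sum_congr rfl fun i hi => ?_
        rw [Finset.sum_insert hx, hne i hi]
        congr 1
        · simp; rw [hsym]; ring
        · exact Finset.sum_congr rfl fun j hj => by rw [hne j hj]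
      rw [e1, e2]
      simp only [Function.update_self]
      obtain ⟨z, -, hvh⟩ := hv
      have : v * v ≤ h ^ 2 := by
        have := sq_le_sq' (by linarith [(abs_le.1 hvh).1]) (abs_le.1 hvh).2
        linarith
      have := mul_le_mul_of_nonneg_left this (hdiag x)
      linarith

lemma cl_greedy {ι β : Type*} [Fintype ι] [DecidableEq ι] [DecidableEq β]
    (t : ℝ) (ht : 0 < t) (hc : (Fintype.card ι : ℝ) ≤ t) (h : ℝ) (hh : 0 < h) (hht : h ^ 2 = 1 / t)
    (p : β → ℝ) (hp : ∀ b, 0 ≤ p b) (a : β → ι → ℝ) (B : Finset β) (hB : ∑ b ∈ B, p b ≤ 1) :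
    ∃ E : β → ι → ℝ, (∀ b, (1 / t < p b → E b = 0) ∧
      (p b ≤ 1 / t → ∀ i, ∃ z : ℤ, E b i = a b i - h * z ∧ |E b i| ≤ h)) ∧
      ∑ i, ∑ j, (∑ b ∈ B, p b * (E b i * E b j)) ^ 2 ≤ 3 / t * ∑ b ∈ B, p b := by
  induction B using Finset.induction_on with
  | empty =>
    have : ∀ b, ∃ e : ι → ℝ, (∀ i, ∃ z : ℤ, e i = a b i - h * z ∧ |e i| ≤ h) := by
      intro b
      obtain ⟨e, he, -⟩ := cl_rounding (fun _ _ => 0) (fun _ _ => rfl) (fun _ => le_rfl) (a b) h hh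
        (∅ : Finset ι)
      exact ⟨e, he⟩
    choose e he using this
    refine ⟨fun b => if p b ≤ 1 / t then e b else 0, fun b => ⟨fun hb => ?_, fun hb => ?_⟩, by simp⟩
    · simp only [if_neg (not_le.2 hb)]
    · simp only [if_pos hb]; exact he b
  | insert x s hx ih =>
    rw [Finset.sum_insert hx] at hB
    obtain ⟨E, hE, hs⟩ := ih (by linarith [hp x])
    have hE1 : ∀ b, ∑ i, E b i ^ 2 ≤ 1 := by
      intro b
      rcases lt_or_ge (1 / t) (p b) with hb | hb
      · simp [(hE b).1 hb]
      · calc ∑ i, E b i ^ 2 ≤ ∑ i : ι, h ^ 2 := by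
              refine Finset.sum_le_sum fun i _ => ?_
              obtain ⟨z, -, h2⟩ := (hE b).2 hb i
              rw [← sq_abs]; gcongr
          _ = Fintype.card ι * h ^ 2 := by simp
          _ ≤ t * (1 / t) := by rw [hht]; gcongr
          _ = 1 := by field_simp
    set M : ι → ι → ℝ := fun i j => ∑ b ∈ s, p b * (E b i * E b j) with hM
    have hnew : ∃ v : ι → ℝ, ((1 / t < p x → v = 0) ∧
      (p x ≤ 1 / t → ∀ i, ∃ z : ℤ, v i = a x i - h * z ∧ |v i| ≤ h)) ∧
        ∑ i, ∑ j, (M i j + p x * (v i * v j)) ^ 2 ≤ ∑ i, ∑ j, (M i j) ^ 2 + 3 / t * p x := by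
      rcases lt_or_ge (1 / t) (p x) with hb | hb
      · refine ⟨0, ⟨fun _ => rfl, fun h' => absurd hb (not_lt.2 h')⟩, ?_⟩
        have : 0 ≤ 3 / t * p x := mul_nonneg (by positivity) (hp x)
        simpa using this
      · have hMd : ∀ i, 0 ≤ M i i := fun i => Finset.sum_nonneg fun b _ =>
          mul_nonneg (hp b) (mul_self_nonneg _)
        obtain ⟨v, hv, hvs⟩ := cl_rounding M (fun i j => by
            simp only [hM]; exact Finset.sum_congr rfl fun b _ => by ring) hMd (a x) h hh Finset.univ
        refine ⟨v, ⟨fun h' => absurd h' (not_lt.2 hb), fun _ => hv⟩, ?_⟩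
        have hv1 : ∑ i, v i ^ 2 ≤ 1 := by
          calc ∑ i, v i ^ 2 ≤ ∑ i : ι, h ^ 2 := by
                refine Finset.sum_le_sum fun i _ => ?_
                obtain ⟨z, -, h2⟩ := hv i
                rw [← sq_abs]; gcongr
            _ = Fintype.card ι * h ^ 2 := by simp
            _ ≤ t * (1 / t) := by rw [hht]; gcongr
            _ = 1 := by field_simp
        have htr : ∑ i, M i i ≤ 1 := by
          simp only [hM]
          rw [Finset.sum_comm]
          calc ∑ b ∈ s, ∑ i, p b * (E b i * E b i) = ∑ b ∈ s, p b * ∑ i, E b i ^ 2 := by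
                refine Finset.sum_congr rfl fun b _ => ?_
                rw [Finset.mul_sum]; exact Finset.sum_congr rfl fun i _ => by ring
            _ ≤ ∑ b ∈ s, p b * 1 := Finset.sum_le_sum fun b _ =>
                mul_le_mul_of_nonneg_left (hE1 b) (hp b)
            _ ≤ 1 := by simp; linarith [hp x]
        have hexp : ∑ i, ∑ j, (M i j + p x * (v i * v j)) ^ 2 = ∑ i, ∑ j, (M i j) ^ 2
            + 2 * p x * ∑ i, ∑ j, M i j * (v i * v j) + (p x) ^ 2 * (∑ i, v i ^ 2) ^ 2 := by
          rw [sq (∑ i, v i ^ 2), Finset.sum_mul_sum]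
          simp only [Finset.mul_sum, ← Finset.sum_add_distrib]
          exact Finset.sum_congr rfl fun i _ => Finset.sum_congr rfl fun j _ => by ring
        rw [hexp]
        have h1 : ∑ i, ∑ j, M i j * (v i * v j) ≤ 1 / t := by
          refine hvs.trans ?_
          rw [hht]
          have : 0 ≤ 1 / t := by positivity
          nlinarith
        have h2 : (p x) ^ 2 * (∑ i, v i ^ 2) ^ 2 ≤ 1 / t * p x := by
          have h3 : (∑ i, v i ^ 2) ^ 2 ≤ 1 :=
            pow_le_one₀ (Finset.sum_nonneg fun _ _ => sq_nonneg _) hv1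
          have := mul_le_mul_of_nonneg_left h3 (sq_nonneg (p x))
          have := mul_le_mul_of_nonneg_right hb (hp x)
          nlinarith
        have h3 := mul_le_mul_of_nonneg_left h1 (hp x)
        have : 3 / t * p x = 2 * (p x * (1 / t)) + 1 / t * p x := by ring
        linarith
    obtain ⟨v, hv, hvs⟩ := hnew
    refine ⟨Function.update E x v, ?_, ?_⟩
    · intro b
      by_cases hbx : b = x
      · subst hbx; simpa using hv
      · simpa [Function.update_of_ne hbx] using hE b
    · rw [Finset.sum_insert hx]
      have e1 : ∀ i j, ∑ b ∈ insert x s, p b * (Function.update E x v b i * Function.update E x v b j)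
          = M i j + p x * (v i * v j) := by
        intro i j
        rw [Finset.sum_insert hx, add_comm]
        congr 1
        · refine Finset.sum_congr rfl fun b hb => ?_
          rw [Function.update_of_ne (by rintro rfl; exact hx hb)]
        · simp
      simp only [e1]
      linarith

lemma cl_geom (R : ℕ) : ∑ z ∈ Finset.Icc (-(R : ℤ)) R, (1 / 2 : ℝ) ^ z.natAbs ≤ 3 := by
  have : ∑ z ∈ Finset.Icc (-(R : ℤ)) R, (1 / 2 : ℝ) ^ z.natAbs = 3 - 2 * (1/2) ^ R := by
    induction R with
    | zero => norm_num
    | succ n ih =>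
      have : Finset.Icc (-((n + 1 : ℕ) : ℤ)) ((n + 1 : ℕ) : ℤ)
          = insert (-((n : ℤ) + 1)) (insert ((n : ℤ) + 1) (Finset.Icc (-(n : ℤ)) n)) := by
        ext z; simp; omega
      rw [this, Finset.sum_insert (by simp; omega), Finset.sum_insert (by simp), ih]
      have h1 : ((n : ℤ) + 1).natAbs = n + 1 := by omega
      rw [Int.natAbs_neg, h1]
      ring
  rw [this]; have : (0:ℝ) ≤ (1/2)^R := by positivity
  linarith

lemma cl_count_s2 {ι : Type*} [Fintype ι] [DecidableEq ι] (R : ℕ) (A : Finset (ι → ℤ))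
    (hA : ∀ z ∈ A, ∑ i, (z i) ^ 2 ≤ (R : ℤ)) : (A.card : ℝ) ≤ 2 ^ R * 3 ^ Fintype.card ι := by
  have hab : ∀ z ∈ A, ∑ i, (z i).natAbs ≤ R := by
    intro z hz
    have h1 := hA z hz
    have : ∑ i, ((z i).natAbs : ℤ) ≤ ∑ i, (z i) ^ 2 := by
      refine Finset.sum_le_sum fun i _ => ?_
      rw [← Int.natAbs_sq]
      exact_mod_cast Nat.le_self_pow two_ne_zero _
    exact_mod_cast this.trans h1
  have hsub : A ⊆ Fintype.piFinset fun _ : ι => Finset.Icc (-(R : ℤ)) R := by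
    intro z hz
    rw [Fintype.mem_piFinset]
    intro i
    have := (Finset.single_le_sum (f := fun i => (z i).natAbs) (fun _ _ => Nat.zero_le _)
      (Finset.mem_univ i)).trans (hab z hz)
    rw [Finset.mem_Icc]; omega
  calc (A.card : ℝ) = ∑ z ∈ A, 1 := by simp
    _ ≤ ∑ z ∈ A, 2 ^ R * ∏ i, (1 / 2 : ℝ) ^ (z i).natAbs := by
        refine Finset.sum_le_sum fun z hz => ?_
        rw [Finset.prod_pow_eq_pow_sum]
        have : (1 / 2 : ℝ) ^ R ≤ (1 / 2) ^ (∑ i, (z i).natAbs) :=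
          pow_le_pow_of_le_one (by norm_num) (by norm_num) (hab z hz)
        calc (1 : ℝ) = 2 ^ R * (1 / 2) ^ R := by rw [← mul_pow]; norm_num
          _ ≤ _ := by gcongr
    _ ≤ ∑ z ∈ Fintype.piFinset fun _ : ι => Finset.Icc (-(R : ℤ)) R,
          2 ^ R * ∏ i, (1 / 2 : ℝ) ^ (z i).natAbs :=
        Finset.sum_le_sum_of_subset_of_nonneg hsub fun _ _ _ => by positivity
    _ = 2 ^ R * ∏ i : ι, ∑ z ∈ Finset.Icc (-(R : ℤ)) R, (1 / 2 : ℝ) ^ z.natAbs := by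
        rw [← Finset.mul_sum, Finset.prod_univ_sum]
    _ ≤ 2 ^ R * ∏ i : ι, 3 := by
        gcongr with i
        exact cl_geom R
    _ = _ := by simp

lemma cl_sq_sum_s2 {Ω I : Type*} [Fintype I] {mΩ : MeasurableSpace Ω} (μ : Measure Ω)
    [IsProbabilityMeasure μ] (F : I → Ω → ℝ) (hF : ∀ i, Integrable (F i) μ) :
    Integrable (fun p : Ω × Ω => ∑ i, F i p.1 * F i p.2) (μ.prod μ) ∧
    ∑ i, (∫ ω, F i ω ∂μ) ^ 2 = ∫ p, ∑ i, F i p.1 * F i p.2 ∂(μ.prod μ) := by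
  have h : ∀ i, Integrable (fun p : Ω × Ω => F i p.1 * F i p.2) (μ.prod μ) :=
    fun i => (hF i).mul_prod (hF i)
  refine ⟨integrable_finsetSum _ fun i _ => h i, ?_⟩
  rw [integral_finsetSum _ fun i _ => h i]
  refine Finset.sum_congr rfl fun i _ => ?_
  rw [integral_prod_mul, sq]

/-- Squared Frobenius norm of the second-moment matrix. -/
noncomputable def clG {Ω ι : Type*} [Fintype ι] {mΩ : MeasurableSpace Ω} (μ : Measure Ω)
    (f : ι → Ω → ℝ) : ℝ := ∑ i, ∑ j, (∫ ω, f i ω * f j ω ∂μ) ^ 2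

lemma clG_eq {Ω ι : Type*} [Fintype ι] {mΩ : MeasurableSpace Ω} (μ : Measure Ω)
    [IsProbabilityMeasure μ] (f : ι → Ω → ℝ) (hf : ∀ i, MemLp (f i) 2 μ) :
    Integrable (fun p : Ω × Ω => (∑ i, f i p.1 * f i p.2) ^ 2) (μ.prod μ) ∧
    clG μ f = ∫ p, (∑ i, f i p.1 * f i p.2) ^ 2 ∂(μ.prod μ) := by
  have h := cl_sq_sum_s2 μ (fun (x : ι × ι) ω => f x.1 ω * f x.2 ω)
    (fun x => (hf x.1).integrable_mul (hf x.2))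
  have e : (fun p : Ω × Ω => ∑ x : ι × ι, (f x.1 p.1 * f x.2 p.1) * (f x.1 p.2 * f x.2 p.2))
      = fun p : Ω × Ω => (∑ i, f i p.1 * f i p.2) ^ 2 := by
    funext p
    rw [sq, Finset.sum_mul_sum, Fintype.sum_prod_type]
    exact Finset.sum_congr rfl fun i _ => Finset.sum_congr rfl fun j _ => by ring
  rw [e] at h
  refine ⟨h.1, ?_⟩
  have h2 := h.2
  rw [Fintype.sum_prod_type] at h2
  rw [clG, h2]

lemma clG_kernel_le {Ω ι κ τ : Type*} [Fintype ι] [Fintype κ] [Fintype τ] {mΩ : MeasurableSpace Ω}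
    (μ : Measure Ω) [IsProbabilityMeasure μ] (f : ι → Ω → ℝ) (hf : ∀ i, MemLp (f i) 2 μ)
    (g : κ → Ω → ℝ) (hg : ∀ i, MemLp (g i) 2 μ) (g' : τ → Ω → ℝ) (hg' : ∀ i, MemLp (g' i) 2 μ)
    (c1 c2 c : ℝ)
    (h : ∀ᵐ p ∂(μ.prod μ), (∑ i, f i p.1 * f i p.2) ^ 2 ≤
      c1 * (∑ i, g i p.1 * g i p.2) ^ 2 + c2 * (∑ i, g' i p.1 * g' i p.2) ^ 2 + c) :
    clG μ f ≤ c1 * clG μ g + c2 * clG μ g' + c := by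
  obtain ⟨i1, e1⟩ := clG_eq μ f hf
  obtain ⟨i2, e2⟩ := clG_eq μ g hg
  obtain ⟨i3, e3⟩ := clG_eq μ g' hg'
  rw [e1, e2, e3]
  refine (integral_mono_ae i1 (((i2.const_mul c1).add (i3.const_mul c2)).add
    (integrable_const c)) h).trans (le_of_eq ?_)
  have i23 : Integrable (fun p : Ω × Ω => c1 * (∑ i, g i p.1 * g i p.2) ^ 2
      + c2 * (∑ i, g' i p.1 * g' i p.2) ^ 2) (μ.prod μ) :=
    (i2.const_mul c1).add (i3.const_mul c2)
  simp only [Pi.add_apply]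
  rw [integral_add i23 (integrable_const c),
    integral_add (i2.const_mul c1) (i3.const_mul c2), integral_const_mul, integral_const_mul]
  simp

lemma clG_mono {Ω ι : Type*} [Fintype ι] {mΩ : MeasurableSpace Ω} (μ : Measure Ω)
    [IsProbabilityMeasure μ] (f g : ι → Ω → ℝ) (hf : ∀ i, MemLp (f i) 2 μ)
    (hg : ∀ i, MemLp (g i) 2 μ)
    (h : ∀ v : ι → ℝ, ∫ ω, (∑ i, v i * f i ω) ^ 2 ∂μ ≤ ∫ ω, (∑ i, v i * g i ω) ^ 2 ∂μ) :
    clG μ f ≤ clG μ g := by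
  have key : ∀ (g : ι → Ω → ℝ), (∀ i, MemLp (g i) 2 μ) → ∀ v : ι → ℝ,
      ∫ ω, (∑ i, v i * g i ω) ^ 2 ∂μ = ∑ i, ∑ j, v i * v j * ∫ ω, g i ω * g j ω ∂μ := by
    intro g hg v
    have hi : ∀ i j, Integrable (fun ω => v i * v j * (g i ω * g j ω)) μ :=
      fun i j => ((hg i).integrable_mul (hg j)).const_mul _
    have : ∀ ω, (∑ i, v i * g i ω) ^ 2 = ∑ i, ∑ j, v i * v j * (g i ω * g j ω) := by
      intro ω
      rw [sq, Finset.sum_mul_sum]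
      exact Finset.sum_congr rfl fun i _ => Finset.sum_congr rfl fun j _ => by ring
    simp only [this]
    rw [integral_finsetSum _ fun i _ => integrable_finsetSum _ fun j _ => hi i j]
    refine Finset.sum_congr rfl fun i _ => ?_
    rw [integral_finsetSum _ fun j _ => hi i j]
    exact Finset.sum_congr rfl fun j _ => integral_const_mul _ _
  have key2 : ∀ (f g : ι → Ω → ℝ), (∀ i, MemLp (f i) 2 μ) →
      Integrable (fun ω' => ∑ i, ∑ j, f i ω' * f j ω' * ∫ ω, g i ω * g j ω ∂μ) μ ∧
      ∫ ω', (∑ i, ∑ j, f i ω' * f j ω' * ∫ ω, g i ω * g j ω ∂μ) ∂μ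
      = ∑ i, ∑ j, (∫ ω, f i ω * f j ω ∂μ) * ∫ ω, g i ω * g j ω ∂μ := by
    intro f g hf
    have hi : ∀ i j, Integrable (fun ω' => f i ω' * f j ω' * ∫ ω, g i ω * g j ω ∂μ) μ :=
      fun i j => ((hf i).integrable_mul (hf j)).mul_const _
    refine ⟨integrable_finsetSum _ fun i _ => integrable_finsetSum _ fun j _ => hi i j, ?_⟩
    rw [integral_finsetSum _ fun i _ => integrable_finsetSum _ fun j _ => hi i j]
    refine Finset.sum_congr rfl fun i _ => ?_
    rw [integral_finsetSum _ fun j _ => hi i j]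
    exact Finset.sum_congr rfl fun j _ => integral_mul_const _ _
  have h' : ∀ v : ι → ℝ, ∑ i, ∑ j, v i * v j * ∫ ω, f i ω * f j ω ∂μ
      ≤ ∑ i, ∑ j, v i * v j * ∫ ω, g i ω * g j ω ∂μ := by
    intro v; rw [← key f hf, ← key g hg]; exact h v
  have s1 : clG μ f ≤ ∑ i, ∑ j, (∫ ω, f i ω * f j ω ∂μ) * ∫ ω, g i ω * g j ω ∂μ := by
    rw [← (key2 f g hf).2]
    have : clG μ f = ∑ i, ∑ j, (∫ ω, f i ω * f j ω ∂μ) * ∫ ω, f i ω * f j ω ∂μ := by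
      simp only [clG, sq]
    rw [this, ← (key2 f f hf).2]
    exact integral_mono (key2 f f hf).1 (key2 f g hf).1 fun ω => h' fun i => f i ω
  have s2 : ∑ i, ∑ j, (∫ ω, f i ω * f j ω ∂μ) * ∫ ω, g i ω * g j ω ∂μ ≤ clG μ g := by
    have : clG μ g = ∑ i, ∑ j, (∫ ω, g i ω * g j ω ∂μ) * ∫ ω, g i ω * g j ω ∂μ := by
      simp only [clG, sq]
    rw [this, ← (key2 g g hg).2]
    have e : ∑ i, ∑ j, (∫ ω, f i ω * f j ω ∂μ) * ∫ ω, g i ω * g j ω ∂μ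
        = ∑ i, ∑ j, (∫ ω, g i ω * g j ω ∂μ) * ∫ ω, f i ω * f j ω ∂μ :=
      Finset.sum_congr rfl fun i _ => Finset.sum_congr rfl fun j _ => mul_comm _ _
    rw [e, ← (key2 g f hg).2]
    exact integral_mono (key2 g f hg).1 (key2 g g hg).1 fun ω => h' fun i => g i ω
  exact s1.trans s2

lemma cl_memLp {Ω : Type*} {mΩ : MeasurableSpace Ω} {μ : Measure Ω} [IsProbabilityMeasure μ]
    {f : Ω → ℝ} (hf : AEStronglyMeasurable f μ) (c : ℝ) (h : ∀ᵐ ω ∂μ, |f ω| ≤ c)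
    (p : ENNReal) : MemLp f p μ :=
  MemLp.of_bound hf c (by simpa using h)

lemma cl_fst {Ω : Type*} {mΩ : MeasurableSpace Ω} {μ : Measure Ω} [IsProbabilityMeasure μ]
    {P : Ω → Prop} (h : ∀ᵐ ω ∂μ, P ω) : ∀ᵐ p ∂(μ.prod μ), P p.1 ∧ P p.2 :=
  (Measure.quasiMeasurePreserving_fst.ae h).and (Measure.quasiMeasurePreserving_snd.ae h)

lemma cl_core {Ω ι : Type*} [Fintype ι] [DecidableEq ι] {mΩ : MeasurableSpace Ω} (μ : Measure Ω)
    [IsProbabilityMeasure μ] (W : Ω → ι → ℝ) (hW : Measurable W)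
    (hb : ∀ᵐ ω ∂μ, ∑ i, W ω i ^ 2 ≤ 1) (t : ℕ) (ht : 1 ≤ t) (hc : Fintype.card ι ≤ t) :
    ∃ (q : (ι → ℝ) → (ι → ℝ)) (V : Finset (ι → ℝ)), Measurable q ∧ V.card ≤ 2 ^ (13 * t) ∧
      (∀ w, q w ∈ V) ∧ clG μ (fun i ω => W ω i - q (W ω) i) ≤ 24 / t := by
  have ht' : (1 : ℝ) ≤ t := by exact_mod_cast ht
  have ht0 : (0 : ℝ) < t := by linarith
  have hc' : (Fintype.card ι : ℝ) ≤ t := by exact_mod_cast hc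
  set h : ℝ := 1 / √(t : ℝ) with hh
  have hh0 : 0 < h := by positivity
  have hh2 : h ^ 2 = 1 / t := by rw [hh, div_pow, Real.sq_sqrt ht0.le]; norm_num
  have hh1 : h ^ 2 ≤ 1 := by rw [hh2, div_le_one ht0]; exact ht'
  set fl : (ι → ℝ) → (ι → ℤ) := fun w i => ⌊w i * t⌋ with hfl
  have hflm : Measurable fl := by
    refine measurable_pi_lambda _ fun i => ?_
    exact Int.measurable_floor.comp ((measurable_pi_apply i).mul_const _)
  set a : (ι → ℤ) → ι → ℝ := fun b i => (b i : ℝ) / t with ha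
  set B : Finset (ι → ℤ) := (Fintype.piFinset fun _ : ι => Finset.Icc (-(t : ℤ)) t).filter
    (fun b => ∑ i, a b i ^ 2 ≤ 4) with hBdef
  -- residual of the fine discretisation
  have heta : ∀ w : ι → ℝ, ∑ i, (w i - a (fl w) i) ^ 2 ≤ 1 / t := by
    intro w
    calc ∑ i, (w i - a (fl w) i) ^ 2 ≤ ∑ i : ι, (1 / (t : ℝ)) ^ 2 := by
          refine Finset.sum_le_sum fun i _ => ?_
          have h1 := Int.floor_le (w i * t)
          have h2 := (Int.lt_floor_add_one (w i * t)).le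
          simp only [ha, hfl]
          have e : w i - (⌊w i * t⌋ : ℝ) / t = (w i * t - ⌊w i * t⌋) / t := by field_simp
          rw [e]
          have : 0 ≤ w i * t - ⌊w i * t⌋ := by linarith
          have : w i * t - ⌊w i * t⌋ ≤ 1 := by linarith
          gcongr
      _ = Fintype.card ι * (1 / (t : ℝ)) ^ 2 := by simp
      _ ≤ t * (1 / (t : ℝ)) ^ 2 := by gcongr
      _ = 1 / t := by field_simp
  have h1t : 1 / (t : ℝ) ≤ 1 := by rw [div_le_one ht0]; exact ht'
  have hmemB : ∀ w : ι → ℝ, ∑ i, w i ^ 2 ≤ 1 → fl w ∈ B := by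
    intro w hw
    rw [hBdef, Finset.mem_filter, Fintype.mem_piFinset]
    constructor
    · intro i
      have h1 : w i ^ 2 ≤ 1 := (Finset.single_le_sum (f := fun i => w i ^ 2)
        (fun _ _ => sq_nonneg _) (Finset.mem_univ i)).trans hw
      have h2 := abs_le.1 ((sq_le_one_iff_abs_le_one _).1 h1)
      rw [Finset.mem_Icc]
      constructor
      · simp only [hfl]
        rw [Int.le_floor]; push_cast; nlinarith [h2.1]
      · simp only [hfl]
        rw [← Int.lt_add_one_iff, Int.floor_lt]; push_cast; nlinarith [h2.2]
    · calc ∑ i, a (fl w) i ^ 2 ≤ ∑ i, (2 * w i ^ 2 + 2 * (w i - a (fl w) i) ^ 2) := by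
            refine Finset.sum_le_sum fun i _ => ?_
            nlinarith [sq_nonneg (2 * w i - a (fl w) i)]
        _ = 2 * ∑ i, w i ^ 2 + 2 * ∑ i, (w i - a (fl w) i) ^ 2 := by
            rw [Finset.sum_add_distrib, Finset.mul_sum, Finset.mul_sum]
        _ ≤ 4 := by linarith [heta w]
  set L : Ω → (ι → ℤ) := fun ω => fl (W ω) with hL
  have hLm : Measurable L := hflm.comp hW
  have hLB : ∀ᵐ ω ∂μ, L ω ∈ B := hb.mono fun ω hω => hmemB _ hω
  set p : (ι → ℤ) → ℝ := fun b => μ.real (L ⁻¹' {b}) with hp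
  have hms : ∀ b, MeasurableSet (L ⁻¹' {b}) := fun b => hLm (measurableSet_singleton b)
  have hint : ∀ φ : (ι → ℤ) → ℝ, ∫ ω, φ (L ω) ∂μ = ∑ b ∈ B, p b * φ b := by
    intro φ
    have e : (fun ω => φ (L ω)) =ᵐ[μ]
        fun ω => ∑ b ∈ B, (L ⁻¹' {b}).indicator (fun _ => φ b) ω := by
      filter_upwards [hLB] with ω hω
      rw [Finset.sum_eq_single_of_mem (L ω) hω]
      · simp
      · intro b _ hne
        rw [Set.indicator_of_notMem]
        simpa using hne.symm
    rw [integral_congr_ae e, integral_finsetSum _ fun b _ =>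
      (integrable_const (φ b)).indicator (hms b)]
    refine Finset.sum_congr rfl fun b _ => ?_
    rw [integral_indicator_const _ (hms b)]; rfl
  have hpsum : ∑ b ∈ B, p b = 1 := by
    have := hint fun _ => 1
    simpa using this.symm
  have hp0 : ∀ b, 0 ≤ p b := fun b => measureReal_nonneg
  obtain ⟨E, hE, hEs⟩ := cl_greedy (t : ℝ) ht0 hc' h hh0 hh2 p hp0 a B hpsum.le
  rw [hpsum, mul_one] at hEs
  have hE1 : ∀ b, ∑ i, E b i ^ 2 ≤ 1 := by
    intro b
    rcases lt_or_ge (1 / (t : ℝ)) (p b) with hb | hb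
    · simp [(hE b).1 hb]
    · calc ∑ i, E b i ^ 2 ≤ ∑ i : ι, h ^ 2 := by
            refine Finset.sum_le_sum fun i _ => ?_
            obtain ⟨z, -, h2⟩ := (hE b).2 hb i
            rw [← sq_abs]; gcongr
        _ = Fintype.card ι * h ^ 2 := by simp
        _ ≤ t * (1 / t) := by rw [hh2]; gcongr
        _ = 1 := by field_simp
  set qv : (ι → ℤ) → ι → ℝ := fun b => if b ∈ B then (fun i => a b i - E b i) else 0 with hqv
  have hqm : Measurable (fun w => qv (fl w)) := (Measurable.of_discrete (f := qv)).comp hflm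
  refine ⟨fun w => qv (fl w), insert 0 (B.image qv), hqm, ?_, ?_, ?_⟩
  · -- counting
    set H := B.filter fun b => 1 / (t : ℝ) < p b with hH
    set S := B.filter fun b => ¬ (1 / (t : ℝ) < p b) with hS
    have hHc : H.card ≤ t := by
      have h1 : (H.card : ℝ) * (1 / t) ≤ 1 := by
        calc (H.card : ℝ) * (1 / t) = ∑ b ∈ H, 1 / (t : ℝ) := by simp
          _ ≤ ∑ b ∈ H, p b := Finset.sum_le_sum fun b hb => (Finset.mem_filter.1 hb).2.le
          _ ≤ ∑ b ∈ B, p b := Finset.sum_le_sum_of_subset_of_nonneg (Finset.filter_subset _ _)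
              fun _ _ _ => hp0 _
          _ = 1 := hpsum
      rw [mul_one_div, div_le_one ht0] at h1
      exact_mod_cast h1
    have hz : ∀ b, ∃ z : ι → ℤ, b ∈ S → ∀ i, E b i = a b i - h * z i := by
      intro b
      by_cases hb : b ∈ S
      · have := (hE b).2 (not_lt.1 (Finset.mem_filter.1 hb).2)
        choose z hz using this
        exact ⟨z, fun _ i => (hz i).1⟩
      · exact ⟨0, fun h => absurd h hb⟩
    choose z hz using hz
    have hAc : ((S.image z).card : ℝ) ≤ 2 ^ (10 * t) * 3 ^ Fintype.card ι := by
      apply cl_count_s2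
      intro y hy
      obtain ⟨b, hbS, rfl⟩ := Finset.mem_image.1 hy
      have hbB := (Finset.mem_filter.1 hbS).1
      have hb4 : ∑ i, a b i ^ 2 ≤ 4 := (Finset.mem_filter.1 hbB).2
      have : ∑ i, (h * z b i) ^ 2 ≤ 10 := by
        calc ∑ i, (h * z b i) ^ 2 ≤ ∑ i, (2 * a b i ^ 2 + 2 * E b i ^ 2) := by
              refine Finset.sum_le_sum fun i _ => ?_
              rw [hz b hbS i]
              nlinarith [sq_nonneg (2 * a b i - h * z b i)]
          _ = 2 * ∑ i, a b i ^ 2 + 2 * ∑ i, E b i ^ 2 := by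
              rw [Finset.sum_add_distrib, Finset.mul_sum, Finset.mul_sum]
          _ ≤ 10 := by linarith [hE1 b]
      simp only [mul_pow] at this
      rw [← Finset.mul_sum, hh2, one_div, inv_mul_le_iff₀ ht0] at this
      have h2 : (∑ i, (z b i : ℝ) ^ 2) ≤ 10 * t := by linarith
      exact_mod_cast h2
    have hAc2 : (S.image z).card ≤ 2 ^ (12 * t) := by
      have : ((S.image z).card : ℝ) ≤ 2 ^ (12 * t) := by
        refine hAc.trans ?_
        calc (2 : ℝ) ^ (10 * t) * 3 ^ Fintype.card ι ≤ 2 ^ (10 * t) * 4 ^ t := by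
              gcongr
              calc (3 : ℝ) ^ Fintype.card ι ≤ 3 ^ t := pow_le_pow_right₀ (by norm_num) hc
                _ ≤ 4 ^ t := by gcongr; norm_num
          _ = 2 ^ (12 * t) := by
              rw [show (4 : ℝ) = 2 ^ 2 by norm_num, ← pow_mul, ← pow_add]; congr 1; ring
      exact_mod_cast this
    have hsub : B.image qv ⊆ H.image qv ∪ (S.image z).image (fun y i => h * (y i : ℝ)) := by
      intro v hv
      obtain ⟨b, hbB, rfl⟩ := Finset.mem_image.1 hv
      by_cases hbp : 1 / (t : ℝ) < p b
      · exact Finset.mem_union_left _ (Finset.mem_image_of_mem _ (Finset.mem_filter.2 ⟨hbB, hbp⟩))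
      · refine Finset.mem_union_right _ ?_
        have hbS : b ∈ S := Finset.mem_filter.2 ⟨hbB, hbp⟩
        refine Finset.mem_image.2 ⟨z b, Finset.mem_image_of_mem _ hbS, ?_⟩
        funext i
        simp only [hqv, if_pos hbB, hz b hbS i]; ring
    have h1 : (B.image qv).card ≤ t + 2 ^ (12 * t) := by
      refine (Finset.card_le_card hsub).trans ((Finset.card_union_le _ _).trans ?_)
      exact add_le_add (Finset.card_image_le.trans hHc) (Finset.card_image_le.trans hAc2)
    have h2 : (insert 0 (B.image qv)).card ≤ (B.image qv).card + 1 := Finset.card_insert_le _ _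
    have h3 : t + 1 ≤ 2 ^ t := Nat.lt_two_pow_self
    have h4 : 2 ^ t ≤ 2 ^ (12 * t) := Nat.pow_le_pow_right (by norm_num) (by omega)
    have h5 : 2 * 2 ^ (12 * t) ≤ 2 ^ (13 * t) := by
      rw [← pow_succ']; exact Nat.pow_le_pow_right (by norm_num) (by omega)
    omega
  · intro w
    by_cases hw : fl w ∈ B
    · exact Finset.mem_insert_of_mem (Finset.mem_image_of_mem _ hw)
    · simp [hqv, hw]
  · -- error bound
    set f : ι → Ω → ℝ := fun i ω => W ω i - qv (fl (W ω)) i with hf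
    set e : ι → Ω → ℝ := fun i ω => E (L ω) i with he
    have hem : ∀ i, Measurable (e i) := fun i =>
      (Measurable.of_discrete (f := fun b => E b i)).comp hLm
    have hfm : ∀ i, Measurable (f i) := fun i =>
      ((measurable_pi_apply i).comp hW).sub ((measurable_pi_apply i).comp (hqm.comp hW))
    have he1 : ∀ ω, ∑ i, e i ω ^ 2 ≤ 1 := fun ω => hE1 _
    have hfe : ∀ᵐ ω ∂μ, ∀ i, f i ω = (W ω i - a (L ω) i) + e i ω := by
      filter_upwards [hLB] with ω hω i
      simp only [hf, hqv, he]
      rw [if_pos hω]; ring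
    have hf4 : ∀ᵐ ω ∂μ, ∑ i, f i ω ^ 2 ≤ 4 := by
      filter_upwards [hfe] with ω hω
      calc ∑ i, f i ω ^ 2 ≤ ∑ i, (2 * (W ω i - a (L ω) i) ^ 2 + 2 * e i ω ^ 2) := by
            refine Finset.sum_le_sum fun i _ => ?_
            rw [hω i]
            nlinarith [sq_nonneg ((W ω i - a (L ω) i) - e i ω)]
        _ = 2 * ∑ i, (W ω i - a (L ω) i) ^ 2 + 2 * ∑ i, e i ω ^ 2 := by
            rw [Finset.sum_add_distrib, Finset.mul_sum, Finset.mul_sum]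
        _ ≤ 4 := by linarith [heta (W ω), he1 ω]
    have hsingle : ∀ (x : ι → ℝ) (i : ι), x i ^ 2 ≤ ∑ i, x i ^ 2 := fun x i =>
      Finset.single_le_sum (f := fun i => x i ^ 2) (fun _ _ => sq_nonneg _) (Finset.mem_univ i)
    have heL : ∀ i, MemLp (e i) 2 μ := fun i => cl_memLp (hem i).aestronglyMeasurable 1
      (Filter.Eventually.of_forall fun ω => by
        have := (hsingle (fun i => e i ω) i).trans (he1 ω)
        exact (sq_le_one_iff_abs_le_one _).1 this) 2
    have hfL : ∀ i, MemLp (f i) 2 μ := fun i => cl_memLp (hfm i).aestronglyMeasurable 2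
      (hf4.mono fun ω hω => by
        have := (hsingle (fun i => f i ω) i).trans hω
        exact abs_le_of_sq_le_sq (by simpa using this.trans (by norm_num)) (by norm_num)) 2
    have hGe : clG μ e ≤ 3 / t := by
      refine le_trans (le_of_eq ?_) hEs
      simp only [clG]
      refine Finset.sum_congr rfl fun i _ => Finset.sum_congr rfl fun j _ => ?_
      congr 1
      exact hint fun b => E b i * E b j
    have := clG_kernel_le μ f hfL e heL e heL 3 0 (15 / t) (by
      filter_upwards [cl_fst hfe, cl_fst hf4] with x h1 h2
      have k : ∑ i, f i x.1 * f i x.2 = ∑ i, e i x.1 * e i x.2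
          + ∑ i, (W x.1 i - a (L x.1) i) * f i x.2 + ∑ i, e i x.1 * (W x.2 i - a (L x.2) i) := by
        rw [← Finset.sum_add_distrib, ← Finset.sum_add_distrib]
        refine Finset.sum_congr rfl fun i _ => ?_
        rw [h1.1 i, h1.2 i]; ring
      rw [k]
      have c1 := Finset.sum_mul_sq_le_sq_mul_sq Finset.univ (fun i => W x.1 i - a (L x.1) i)
        (fun i => f i x.2)
      have c2 := Finset.sum_mul_sq_le_sq_mul_sq Finset.univ (fun i => e i x.1)
        (fun i => W x.2 i - a (L x.2) i)
      have d1 : (∑ i, (W x.1 i - a (L x.1) i) ^ 2) * ∑ i, f i x.2 ^ 2 ≤ 1 / t * 4 :=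
        mul_le_mul (heta _) h2.2 (Finset.sum_nonneg fun _ _ => sq_nonneg _) (by positivity)
      have d2 : (∑ i, e i x.1 ^ 2) * ∑ i, (W x.2 i - a (L x.2) i) ^ 2 ≤ 1 * (1 / t) :=
        mul_le_mul (he1 _) (heta _) (Finset.sum_nonneg fun _ _ => sq_nonneg _) (by norm_num)
      have hs : (15 : ℝ) / t = 3 * (1 / t * 4) + 3 * (1 * (1 / t)) := by ring
      rw [hs]
      generalize (∑ i, e i x.1 * e i x.2) = A at *
      generalize (∑ i, (W x.1 i - a (L x.1) i) * f i x.2) = A2 at *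
      generalize (∑ i, e i x.1 * (W x.2 i - a (L x.2) i)) = A3 at *
      nlinarith [sq_nonneg (A - A2), sq_nonneg (A - A3), sq_nonneg (A2 - A3)])
    have e24 : (24 : ℝ) / t = 3 * (3 / t) + 15 / t := by ring
    rw [e24]
    linarith

lemma cl_proj_s2 {Ω : Type*} {mΩ : MeasurableSpace Ω} (μ : Measure Ω) [IsProbabilityMeasure μ]
    (m' : MeasurableSpace Ω) (hm : m' ≤ mΩ) (f g : Ω → ℝ) (hf : MemLp f 2 μ) (hg : MemLp g 2 μ)
    (hgm : StronglyMeasurable[m'] g) : ∫ ω, (f ω - (μ[f|m']) ω) * g ω ∂μ = 0 := by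
  have hfi : Integrable f μ := hf.integrable one_le_two
  have hfg : Integrable (f * g) μ := hf.integrable_mul hg
  have hFg : Integrable (μ[f|m'] * g) μ := (hf.condExp one_le_two).integrable_mul hg
  have h1 := condExp_mul_of_stronglyMeasurable_right hgm hfg hfi
  have h2 : ∫ ω, (f * g) ω ∂μ = ∫ ω, (μ[f|m'] * g) ω ∂μ := by
    rw [← integral_condExp hm, integral_congr_ae h1]
  have : ∀ ω, (f ω - (μ[f|m']) ω) * g ω = (f * g) ω - (μ[f|m'] * g) ω := by
    intro ω; simp only [Pi.mul_apply]; ring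
  simp only [this]
  rw [integral_sub hfg hFg, h2, sub_self]

lemma cl_best {Ω ι : Type*} [Fintype ι] {mΩ : MeasurableSpace Ω} (μ : Measure Ω)
    [IsProbabilityMeasure μ]
    (m' : MeasurableSpace Ω) (hm : m' ≤ mΩ) (f : ι → Ω → ℝ) (g : Ω → ℝ)
    (hf : ∀ i, MemLp (f i) 2 μ) (hg : MemLp g 2 μ)
    (hgm : StronglyMeasurable[m'] g) (w : ι → ℝ) :
    ∫ ω, (∑ i, w i * (f i ω - (μ[f i|m']) ω)) ^ 2 ∂μ ≤ ∫ ω, (∑ i, w i * f i ω - g ω) ^ 2 ∂μ := by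
  set D : Ω → ℝ := fun ω => ∑ i, w i * (f i ω - (μ[f i|m']) ω) with hD
  set A : Ω → ℝ := fun ω => ∑ i, w i * (μ[f i|m']) ω - g ω with hA
  have hDL : MemLp D 2 μ := memLp_finsetSum _ fun i _ =>
    ((hf i).sub ((hf i).condExp one_le_two)).const_mul (w i)
  have hAL : MemLp A 2 μ := (memLp_finsetSum _ fun i _ =>
    ((hf i).condExp one_le_two).const_mul (w i)).sub hg
  have hAm : StronglyMeasurable[m'] A := by
    refine StronglyMeasurable.sub ?_ hgm
    refine Finset.stronglyMeasurable_fun_sum _ fun i _ => ?_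
    exact stronglyMeasurable_condExp.const_mul (w i)
  have hDA : ∫ ω, D ω * A ω ∂μ = 0 := by
    have e : ∀ ω, D ω * A ω = ∑ i, w i * ((f i ω - (μ[f i|m']) ω) * A ω) := by
      intro ω
      simp only [hD]
      rw [Finset.sum_mul]
      exact Finset.sum_congr rfl fun i _ => by ring
    simp only [e]
    have hi : ∀ i, Integrable (fun ω => w i * ((f i ω - (μ[f i|m']) ω) * A ω)) μ := fun i =>
      (((hf i).sub ((hf i).condExp one_le_two)).integrable_mul hAL).const_mul (w i)
    rw [integral_finsetSum _ fun i _ => hi i]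
    refine Finset.sum_eq_zero fun i _ => ?_
    rw [integral_const_mul, cl_proj_s2 μ m' hm (f i) A (hf i) hAL hAm, mul_zero]
  have e : ∀ ω, (∑ i, w i * f i ω - g ω) ^ 2 = D ω ^ 2 + (2 * (D ω * A ω) + A ω ^ 2) := by
    intro ω
    have : ∑ i, w i * f i ω - g ω = D ω + A ω := by
      simp only [hD, hA]
      rw [← add_sub_assoc, ← Finset.sum_add_distrib]
      congr 1
      exact Finset.sum_congr rfl fun i _ => by ring
    rw [this]; ring
  simp only [e]
  have i1 : Integrable (fun ω => D ω ^ 2) μ := hDL.integrable_sq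
  have i2 : Integrable (fun ω => 2 * (D ω * A ω)) μ := (hDL.integrable_mul hAL).const_mul 2
  have i3 : Integrable (fun ω => A ω ^ 2) μ := hAL.integrable_sq
  have i23 : Integrable (fun ω => 2 * (D ω * A ω) + A ω ^ 2) μ := i2.add i3
  rw [integral_add i1 i23, integral_add i2 i3, integral_const_mul, hDA]
  have : 0 ≤ ∫ ω, A ω ^ 2 ∂μ := integral_nonneg fun ω => sq_nonneg _
  linarith

lemma cl_Ybound {Ω ι : Type*} [Fintype ι] {mΩ : MeasurableSpace Ω} (μ : Measure Ω)
    [IsProbabilityMeasure μ]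
    (m' : MeasurableSpace Ω) (hm : m' ≤ mΩ) (f : ι → Ω → ℝ)
    (hf : ∀ i, MemLp (f i) 2 μ) (hb : ∀ᵐ ω ∂μ, ∑ i, f i ω ^ 2 ≤ 1) :
    ∀ᵐ ω ∂μ, ∑ i, (μ[f i|m']) ω ^ 2 ≤ 1 := by
  have h1 : ∀ i, ∀ᵐ ω ∂μ, (μ[f i|m']) ω ^ 2 ≤ (μ[f i ^ 2|m']) ω := by
    intro i
    have hnn : 0 ≤ᵐ[μ] condVar m' (f i) μ :=
      condExp_nonneg (Filter.Eventually.of_forall fun ω => by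
        simp only [Pi.pow_apply, Pi.zero_apply]; exact sq_nonneg _)
    filter_upwards [condVar_ae_eq_condExp_sq_sub_sq_condExp hm (hf i), hnn] with ω h2 h3
    rw [h2] at h3
    simp only [Pi.sub_apply, Pi.pow_apply, Pi.zero_apply] at h3
    linarith
  have hi : ∀ i, Integrable (f i ^ 2) μ := fun i => (hf i).integrable_sq
  have h2 := condExp_finsetSum (μ := μ) (s := Finset.univ) (f := fun i => f i ^ 2)
    (fun i _ => hi i) m'
  have h3 : μ[∑ i, f i ^ 2|m'] ≤ᵐ[μ] μ[fun _ => (1 : ℝ)|m'] :=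
    condExp_mono (integrable_finsetSum' _ fun i _ => hi i) (integrable_const _)
      (hb.mono fun ω h => by simpa using h)
  rw [condExp_const hm] at h3
  filter_upwards [ae_all_iff.2 h1, h2, h3] with ω a1 a2 a3
  rw [a2] at a3
  simp only [Finset.sum_apply] at a3
  exact (Finset.sum_le_sum fun i _ => a1 i).trans a3

lemma cl_spec {m : ℕ} (S : Fin m → Fin m → ℝ) (hS : ∀ i j, S i j = S j i) :
    ∃ (U : Fin m → Fin m → ℝ) (l : Fin m → ℝ),
      (∀ x y : Fin m → ℝ, ∑ i, (∑ j, U i j * x j) * (∑ j, U i j * y j) = ∑ j, x j * y j) ∧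
      (∀ i i', ∑ j, ∑ k, U i j * U i' k * S j k = if i = i' then l i else 0) := by
  have hH : (Matrix.of S).IsHermitian := by
    ext i j; simp [hS i j]
  refine ⟨fun i j => hH.eigenvectorBasis i j, hH.eigenvalues, ?_, ?_⟩
  · intro x y
    have := hH.eigenvectorBasis.sum_inner_mul_inner (WithLp.toLp 2 x) (WithLp.toLp 2 y)
    simp only [PiLp.inner_apply, RCLike.inner_apply, conj_trivial] at this
    simp only [mul_comm (x _) (y _)]
    rw [← this]
    refine Finset.sum_congr rfl fun i _ => ?_
    congr 1
    exact Finset.sum_congr rfl fun j _ => mul_comm _ _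
  · intro i i'
    have h1 := fun j => congrFun (hH.mulVec_eigenvectorBasis i') j
    have h2 := orthonormal_iff_ite.1 hH.eigenvectorBasis.orthonormal i i'
    simp only [PiLp.inner_apply, RCLike.inner_apply, conj_trivial] at h2
    have h3 : ∀ j, ∑ k, S j k * hH.eigenvectorBasis i' k
        = hH.eigenvalues i' * hH.eigenvectorBasis i' j := by
      intro j
      simpa [Matrix.mulVec, dotProduct] using h1 j
    calc ∑ j, ∑ k, hH.eigenvectorBasis i j * hH.eigenvectorBasis i' k * S j k
        = ∑ j, hH.eigenvectorBasis i j * ∑ k, S j k * hH.eigenvectorBasis i' k := by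
          refine Finset.sum_congr rfl fun j _ => ?_
          rw [Finset.mul_sum]
          exact Finset.sum_congr rfl fun k _ => by ring
      _ = hH.eigenvalues i' * ∑ j, hH.eigenvectorBasis i' j * hH.eigenvectorBasis i j := by
          rw [Finset.mul_sum]
          refine Finset.sum_congr rfl fun j _ => ?_
          rw [h3]; ring
      _ = _ := by
          rw [h2]
          split_ifs with h
          · rw [h]; simp
          · simp

lemma cl_main {Ω : Type*} {mΩ : MeasurableSpace Ω} (μ : Measure Ω) [IsProbabilityMeasure μ]
    (m : ℕ) (X : Ω → Fin m → ℝ) (hX : Measurable X) (hb : ∀ᵐ ω ∂μ, ∑ i, X ω i ^ 2 ≤ 1)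
    (t k : ℕ) (ht : 1 ≤ t) (hk : 2 ^ (13 * t) ≤ k) :
    ∃ c : (Fin m → ℝ) → Fin k, Measurable c ∧ ∀ m' : MeasurableSpace Ω, m' ≤ mΩ →
      Measurable[m'] (fun ω => c (X ω)) →
      clG μ (fun i ω => X ω i - (μ[fun ω' => X ω' i|m']) ω) ≤ 50 / t := by
  have ht' : (1 : ℝ) ≤ t := by exact_mod_cast ht
  have ht0 : (0 : ℝ) < t := by linarith
  have hsingle : ∀ (x : Fin m → ℝ) (i : Fin m), x i ^ 2 ≤ ∑ i, x i ^ 2 := fun x i =>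
    Finset.single_le_sum (f := fun i => x i ^ 2) (fun _ _ => sq_nonneg _) (Finset.mem_univ i)
  have hXm : ∀ i, Measurable fun ω => X ω i := fun i => (measurable_pi_apply i).comp hX
  have hXL : ∀ i, MemLp (fun ω => X ω i) 2 μ := fun i =>
    cl_memLp (hXm i).aestronglyMeasurable 1 (hb.mono fun ω hω =>
      (sq_le_one_iff_abs_le_one _).1 ((hsingle (X ω) i).trans hω)) 2
  obtain ⟨U, l, hU, hUS⟩ := cl_spec (fun j k => ∫ ω, X ω j * X ω k ∂μ)
    (fun i j => by simp only [mul_comm])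
  set R : (Fin m → ℝ) → Fin m → ℝ := fun x i => ∑ j, U i j * x j with hR
  have hRm : Measurable R := by
    refine measurable_pi_lambda _ fun i => ?_
    exact Finset.measurable_fun_sum _ fun j _ => (measurable_pi_apply j).const_mul _
  have hRsq : ∀ x, ∑ i, R x i ^ 2 = ∑ i, x i ^ 2 := by
    intro x
    have := hU x x
    simpa [hR, sq] using this
  have hRL : ∀ i, MemLp (fun ω => R (X ω) i) 2 μ := fun i =>
    memLp_finsetSum _ fun j _ => (hXL j).const_mul (U i j)
  have hRR : ∀ i i', ∫ ω, R (X ω) i * R (X ω) i' ∂μ = if i = i' then l i else 0 := by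
    intro i i'
    rw [← hUS i i']
    have hi : ∀ j k, Integrable (fun ω => U i j * U i' k * (X ω j * X ω k)) μ := fun j k =>
      ((hXL j).integrable_mul (hXL k)).const_mul _
    have e : ∀ ω, R (X ω) i * R (X ω) i' = ∑ j, ∑ k, U i j * U i' k * (X ω j * X ω k) := by
      intro ω
      simp only [hR]
      rw [Finset.sum_mul_sum]
      exact Finset.sum_congr rfl fun i _ => Finset.sum_congr rfl fun j _ => by ring
    simp only [e]
    rw [integral_finsetSum _ fun j _ => integrable_finsetSum _ fun k _ => hi j k]
    refine Finset.sum_congr rfl fun j _ => ?_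
    rw [integral_finsetSum _ fun k _ => hi j k]
    exact Finset.sum_congr rfl fun j _ => integral_const_mul _ _
  have hl : ∀ i, l i = ∫ ω, R (X ω) i ^ 2 ∂μ := by
    intro i
    have := hRR i i
    rw [if_pos rfl] at this
    rw [← this]; simp only [sq]
  have hl0 : ∀ i, 0 ≤ l i := fun i => by rw [hl]; exact integral_nonneg fun ω => sq_nonneg _
  have hlsum : ∑ i, l i ≤ 1 := by
    simp only [hl]
    rw [← integral_finsetSum _ fun i _ => (hRL i).integrable_sq]
    calc ∫ ω, ∑ i, R (X ω) i ^ 2 ∂μ ≤ ∫ ω, (1 : ℝ) ∂μ := by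
          refine integral_mono_ae (integrable_finsetSum _ fun i _ => (hRL i).integrable_sq)
            (integrable_const _) (hb.mono fun ω hω => ?_)
          simp only [hRsq]; exact hω
      _ = 1 := by simp
  classical
  have hT : Fintype.card {i : Fin m // 1 / (t : ℝ) ≤ l i} ≤ t := by
    have h1 : (Fintype.card {i : Fin m // 1 / (t : ℝ) ≤ l i} : ℝ) * (1 / t) ≤ 1 := by
      calc (Fintype.card {i : Fin m // 1 / (t : ℝ) ≤ l i} : ℝ) * (1 / t) = ∑ i : {i : Fin m // 1 / (t : ℝ) ≤ l i}, 1 / (t : ℝ) := by simp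
        _ ≤ ∑ i : {i : Fin m // 1 / (t : ℝ) ≤ l i}, l i := Finset.sum_le_sum fun i _ => i.2
        _ ≤ ∑ i : {i : Fin m // 1 / (t : ℝ) ≤ l i}, l i + ∑ i : {i : Fin m // ¬ 1 / (t : ℝ) ≤ l i}, l i := by
            linarith [Finset.sum_nonneg fun (i : {i : Fin m // ¬ 1 / (t : ℝ) ≤ l i})
              (_ : i ∈ Finset.univ) => hl0 i.1]
        _ = ∑ i, l i := Fintype.sum_subtype_add_sum_subtype (fun i => 1 / (t : ℝ) ≤ l i) l
        _ ≤ 1 := hlsum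
    rw [mul_one_div, div_le_one ht0] at h1
    exact_mod_cast h1
  have hrm : Measurable fun x (i : {i : Fin m // 1 / (t : ℝ) ≤ l i}) => R x i.1 :=
    measurable_pi_lambda _ fun i => (measurable_pi_apply i.1).comp hRm
  obtain ⟨q, V, hqm, hVc, hqV, hqG⟩ := cl_core μ (fun ω (i : {i : Fin m // 1 / (t : ℝ) ≤ l i}) => R (X ω) i.1) (hrm.comp hX)
    (hb.mono fun ω hω => by
      refine le_trans ?_ ((hRsq (X ω)).le.trans hω)
      rw [← Fintype.sum_subtype_add_sum_subtype (fun i => 1 / (t : ℝ) ≤ l i)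
        (fun i => R (X ω) i ^ 2)]
      exact le_add_of_nonneg_right (Finset.sum_nonneg fun _ _ => sq_nonneg _)) t ht hT
  have hemb : Nonempty (V ↪ Fin k) := by
    apply Function.Embedding.nonempty_of_card_le
    simpa using hVc.trans hk
  obtain ⟨e⟩ := hemb
  have : Nonempty V := ⟨⟨q 0, hqV 0⟩⟩
  set r : Fin k → {i : Fin m // 1 / (t : ℝ) ≤ l i} → ℝ := fun j => (Function.invFun e j).1 with hr
  set c : (Fin m → ℝ) → Fin k := fun x => e ⟨q (fun i : {i : Fin m // 1 / (t : ℝ) ≤ l i} => R x i.1), hqV _⟩ with hc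
  have hrc : ∀ x, r (c x) = q (fun i : {i : Fin m // 1 / (t : ℝ) ≤ l i} => R x i.1) := by
    intro x
    simp only [hr, hc]
    rw [Function.leftInverse_invFun e.injective]
  have hcm : Measurable c :=
    (Measurable.of_discrete (f := e)).comp ((hqm.comp hrm).subtype_mk)
  refine ⟨c, hcm, fun m' hm hcX => ?_⟩
  set Z : Fin m → Ω → ℝ := fun i ω => X ω i - (μ[fun ω' => X ω' i|m']) ω with hZ
  have hZL : ∀ i, MemLp (Z i) 2 μ := fun i => (hXL i).sub ((hXL i).condExp one_le_two)
  have hRZL : ∀ i, MemLp (fun ω => ∑ j, U i j * Z j ω) 2 μ := fun i =>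
    memLp_finsetSum _ fun j _ => (hZL j).const_mul (U i j)
  have s0 := clG_kernel_le μ Z hZL (fun (i : {i : Fin m // 1 / (t : ℝ) ≤ l i}) ω => ∑ j, U i j * Z j ω) (fun i => hRZL i)
    (fun (i : {i : Fin m // ¬ 1 / (t : ℝ) ≤ l i}) ω => ∑ j, U i j * Z j ω) (fun i => hRZL i) 2 2 0
    (Filter.Eventually.of_forall fun p => by
      rw [← hU (fun j => Z j p.1) (fun j => Z j p.2),
        ← Fintype.sum_subtype_add_sum_subtype (fun i => 1 / (t : ℝ) ≤ l i)]
      nlinarith [sq_nonneg ((∑ i : {i : Fin m // 1 / (t : ℝ) ≤ l i}, (∑ j, U i j * Z j p.1) * ∑ j, U i j * Z j p.2) -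
        (∑ i : {i : Fin m // ¬ 1 / (t : ℝ) ≤ l i}, (∑ j, U i j * Z j p.1) * ∑ j, U i j * Z j p.2))])
  have swap : ∀ (P : Fin m → Prop) [DecidablePred P] (v : {i // P i} → ℝ) (x : Fin m → ℝ),
      ∑ i : {i // P i}, v i * ∑ j, U i j * x j
        = ∑ j, (∑ i : {i // P i}, v i * U i j) * x j := by
    intro P _ v x
    simp only [Finset.mul_sum, Finset.sum_mul]
    rw [Finset.sum_comm]
    exact Finset.sum_congr rfl fun i _ => Finset.sum_congr rfl fun j _ => by ring
  have hqi : ∀ i : {i : Fin m // 1 / (t : ℝ) ≤ l i}, StronglyMeasurable[m'] fun ω => r (c (X ω)) i := fun i =>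
    Measurable.stronglyMeasurable
      ((Measurable.of_discrete (f := fun j => r j i)).comp hcX)
  have hqL : ∀ i : {i : Fin m // 1 / (t : ℝ) ≤ l i}, MemLp (fun ω => r (c (X ω)) i) 2 μ := fun i =>
    cl_memLp ((hqi i).mono hm).aestronglyMeasurable (∑ j, |r j i|)
      (Filter.Eventually.of_forall fun ω =>
        Finset.single_le_sum (f := fun j => |r j i|) (fun _ _ => abs_nonneg _)
          (Finset.mem_univ (c (X ω)))) 2
  have s1 : clG μ (fun (i : {i : Fin m // 1 / (t : ℝ) ≤ l i}) ω => ∑ j, U i j * Z j ω) ≤ 24 / t := by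
    refine le_trans (clG_mono μ _ (fun (i : {i : Fin m // 1 / (t : ℝ) ≤ l i}) ω => R (X ω) i.1 - r (c (X ω)) i)
      (fun i => hRZL i) (fun i => (hRL i).sub (hqL i)) fun v => ?_) ?_
    · simp only [swap _ v]
      have := cl_best μ m' hm (fun i ω => X ω i) (fun ω => ∑ i : {i : Fin m // 1 / (t : ℝ) ≤ l i}, v i * r (c (X ω)) i) hXL
        (memLp_finsetSum _ fun i _ => (hqL i).const_mul (v i))
        (Finset.stronglyMeasurable_fun_sum _ fun i _ => (hqi i).const_mul (v i))
        (fun j => ∑ i : {i : Fin m // 1 / (t : ℝ) ≤ l i}, v i * U i j)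
      refine this.trans (le_of_eq ?_)
      congr 1
      funext ω
      rw [← swap _ v, ← Finset.sum_sub_distrib]
      simp only [mul_sub, hR]
    · simp only [hrc]; exact hqG
  have s2 : clG μ (fun (i : {i : Fin m // ¬ 1 / (t : ℝ) ≤ l i}) ω => ∑ j, U i j * Z j ω)
      ≤ 1 / t := by
    refine le_trans (clG_mono μ _ (fun (i : {i : Fin m // ¬ 1 / (t : ℝ) ≤ l i}) ω => R (X ω) i.1)
      (fun i => hRZL i) (fun i => hRL i) fun v => ?_) ?_
    · simp only [swap _ v]
      have := cl_best μ m' hm (fun i ω => X ω i) (fun ω => 0) hXL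
        (MemLp.zero) stronglyMeasurable_const
        (fun j => ∑ i : {i : Fin m // ¬ 1 / (t : ℝ) ≤ l i}, v i * U i j)
      refine this.trans (le_of_eq ?_)
      congr 1
      funext ω
      rw [← swap _ v, sub_zero]
    · simp only [clG, hRR]
      calc ∑ i : {i : Fin m // ¬ 1 / (t : ℝ) ≤ l i}, ∑ j : {i : Fin m // ¬ 1 / (t : ℝ) ≤ l i},
            (if i.1 = j.1 then l i.1 else 0) ^ 2
          = ∑ i : {i : Fin m // ¬ 1 / (t : ℝ) ≤ l i}, l i.1 ^ 2 := by
            refine Finset.sum_congr rfl fun i _ => ?_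
            rw [Finset.sum_eq_single i]
            · simp
            · intro j _ hj
              rw [if_neg (fun h => hj (Subtype.ext h.symm))]; simp
            · simp
        _ ≤ ∑ i : {i : Fin m // ¬ 1 / (t : ℝ) ≤ l i}, 1 / t * l i.1 := by
            refine Finset.sum_le_sum fun i _ => ?_
            rw [sq]
            exact mul_le_mul_of_nonneg_right (not_le.1 i.2).le (hl0 _)
        _ = 1 / t * ∑ i : {i : Fin m // ¬ 1 / (t : ℝ) ≤ l i}, l i.1 := by rw [Finset.mul_sum]
        _ ≤ 1 / t * 1 := by
            gcongr
            refine le_trans ?_ hlsum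
            rw [← Fintype.sum_subtype_add_sum_subtype (fun i => 1 / (t : ℝ) ≤ l i) l]
            exact le_add_of_nonneg_left (Finset.sum_nonneg fun i _ => hl0 i.1)
        _ = 1 / t := mul_one _
  have : (50 : ℝ) / t = 2 * (24 / t) + 2 * (1 / t) := by ring
  rw [this]
  linarith

lemma cl_moment {Ω : Type*} {mΩ : MeasurableSpace Ω} (μ : Measure Ω) [IsProbabilityMeasure μ]
    (m d : ℕ) (X : Ω → Fin m → ℝ) (hX : Measurable X) (hb : ∀ᵐ ω ∂μ, ∑ i, X ω i ^ 2 ≤ 1)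
    (m' : MeasurableSpace Ω) (hm : m' ≤ mΩ) :
    clG μ (fun i ω => X ω i - (μ[fun ω' => X ω' i|m']) ω) ≤ 16 ∧
    ∑ idx : Fin d → Fin m, ((∫ ω, ∏ s, X ω (idx s) ∂μ)
        - ∫ ω, ∏ s, (μ[fun ω' => X ω' (idx s)|m']) ω ∂μ) ^ 2
      ≤ 16 ^ d * clG μ (fun i ω => X ω i - (μ[fun ω' => X ω' i|m']) ω) := by
  have hsingle : ∀ (x : Fin m → ℝ) (i : Fin m), x i ^ 2 ≤ ∑ i, x i ^ 2 := fun x i =>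
    Finset.single_le_sum (f := fun i => x i ^ 2) (fun _ _ => sq_nonneg _) (Finset.mem_univ i)
  have hXm : ∀ i, Measurable[mΩ] fun ω => X ω i := fun i => (measurable_pi_apply i).comp hX
  have hXL : ∀ i, MemLp (fun ω => X ω i) 2 μ := fun i =>
    cl_memLp (hXm i).aestronglyMeasurable 1 (hb.mono fun ω hω =>
      (sq_le_one_iff_abs_le_one _).1 ((hsingle (X ω) i).trans hω)) 2
  set Y : Fin m → Ω → ℝ := fun i => μ[fun ω' => X ω' i|m'] with hY
  set Z : Fin m → Ω → ℝ := fun i ω => X ω i - Y i ω with hZ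
  have hYm : ∀ i, StronglyMeasurable[m'] (Y i) := fun i => stronglyMeasurable_condExp
  have hYb : ∀ᵐ ω ∂μ, ∑ i, Y i ω ^ 2 ≤ 1 := cl_Ybound μ m' hm (fun i ω => X ω i) hXL hb
  have hYL : ∀ i, MemLp (Y i) 2 μ := fun i => (hXL i).condExp one_le_two
  have hZL : ∀ i, MemLp (Z i) 2 μ := fun i => (hXL i).sub (hYL i)
  have hZb : ∀ᵐ ω ∂μ, ∑ i, Z i ω ^ 2 ≤ 4 := by
    filter_upwards [hb, hYb] with ω h1 h2
    calc ∑ i, Z i ω ^ 2 ≤ ∑ i, (2 * X ω i ^ 2 + 2 * Y i ω ^ 2) := by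
          refine Finset.sum_le_sum fun i _ => ?_
          simp only [hZ]
          nlinarith [sq_nonneg (X ω i + Y i ω)]
      _ = 2 * ∑ i, X ω i ^ 2 + 2 * ∑ i, Y i ω ^ 2 := by
          rw [Finset.sum_add_distrib, Finset.mul_sum, Finset.mul_sum]
      _ ≤ 4 := by linarith
  constructor
  · have := clG_kernel_le μ Z hZL Z hZL Z hZL 0 0 16 (by
      filter_upwards [cl_fst hZb] with p hp
      have h1 := Finset.sum_mul_sq_le_sq_mul_sq Finset.univ (fun i => Z i p.1) (fun i => Z i p.2)
      have h2 := mul_le_mul hp.1 hp.2 (Finset.sum_nonneg fun _ _ => sq_nonneg _) (by norm_num)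
      linarith)
    linarith
  classical
  -- the mixed vectors
  set v : Finset (Fin d) → Fin d → Fin m → Ω → ℝ := fun S s i => if s ∈ S then Z i else Y i with hv
  have hvb : ∀ᵐ ω ∂μ, ∀ S s, ∑ i, v S s i ω ^ 2 ≤ 4 := by
    filter_upwards [hZb, hYb] with ω h1 h2 S s
    by_cases hs : s ∈ S
    · simpa [hv, hs] using h1
    · simp only [hv, hs, if_false]; linarith
  have hvm : ∀ S s i, AEStronglyMeasurable[mΩ] (v S s i) μ := by
    intro S s i
    by_cases hs : s ∈ S
    · simp only [hv, hs, if_true]; exact (hZL i).1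
    · simp only [hv, hs, if_false]; exact (hYL i).1
  have hvi : ∀ S (idx : Fin d → Fin m), Integrable (fun ω => ∏ s, v S s (idx s) ω) μ := by
    intro S idx
    refine memLp_one_iff_integrable.1 (cl_memLp ?_ (2 ^ d) ?_ 1)
    · exact Finset.aestronglyMeasurable_fun_prod _ fun s _ => hvm S s (idx s)
    · filter_upwards [hvb] with ω hω
      rw [Finset.abs_prod]
      calc ∏ s, |v S s (idx s) ω| ≤ ∏ s : Fin d, 2 := by
            refine Finset.prod_le_prod (fun _ _ => abs_nonneg _) fun s _ => ?_
            have := (hsingle (fun i => v S s i ω) (idx s)).trans (hω S s)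
            exact abs_le_of_sq_le_sq (by simpa using this.trans (by norm_num)) (by norm_num)
        _ = 2 ^ d := by simp
  have hexp : ∀ (idx : Fin d → Fin m) ω, ∏ s, X ω (idx s)
      = ∑ S : Finset (Fin d), ∏ s, v S s (idx s) ω := by
    intro idx ω
    have h1 : ∀ s, X ω (idx s) = Z (idx s) ω + Y (idx s) ω := fun s => by simp [hZ]
    simp only [h1]
    rw [Finset.prod_add, Finset.powerset_univ]
    refine Finset.sum_congr rfl fun S _ => ?_
    have h2 : ∀ s, v S s (idx s) ω = if s ∈ S then Z (idx s) ω else Y (idx s) ω := by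
      intro s; simp only [hv]; split_ifs <;> rfl
    simp only [h2]
    rw [Finset.prod_ite]
    congr 1
    · exact Finset.prod_congr (by ext; simp) fun _ _ => rfl
    · exact Finset.prod_congr (by ext; simp) fun _ _ => rfl
  set A : Finset (Fin d) → (Fin d → Fin m) → ℝ := fun S idx => ∫ ω, ∏ s, v S s (idx s) ω ∂μ with hA
  have hdiff : ∀ idx : Fin d → Fin m, (∫ ω, ∏ s, X ω (idx s) ∂μ) - ∫ ω, ∏ s, Y (idx s) ω ∂μ
      = ∑ S ∈ Finset.univ.erase (∅ : Finset (Fin d)), A S idx := by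
    intro idx
    simp only [hexp]
    rw [integral_finsetSum _ fun S _ => hvi S idx,
      ← Finset.add_sum_erase _ _ (Finset.mem_univ (∅ : Finset (Fin d)))]
    simp [hv, hA]
  have hAS : ∀ S : Finset (Fin d), S ≠ ∅ → ∑ idx, A S idx ^ 2 ≤ 4 ^ d * clG μ Z := by
    intro S hS
    have hG0 : 0 ≤ clG μ Z := Finset.sum_nonneg fun _ _ => Finset.sum_nonneg fun _ _ => sq_nonneg _
    obtain ⟨a, ha⟩ := Finset.nonempty_iff_ne_empty.2 hS
    by_cases hS1 : S = {a}
    · have : ∀ idx, A S idx = 0 := by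
        intro idx
        simp only [hA]
        have e : ∀ ω, ∏ s, v S s (idx s) ω
            = (X ω (idx a) - Y (idx a) ω) * ∏ s ∈ Finset.univ.erase a, Y (idx s) ω := by
          intro ω
          rw [← Finset.mul_prod_erase _ _ (Finset.mem_univ a)]
          congr 1
          · simp [hv, ha, hZ]
          · refine Finset.prod_congr rfl fun s hs => ?_
            have : s ∉ S := by rw [hS1]; simpa using Finset.ne_of_mem_erase hs
            simp [hv, this]
        simp only [e]
        refine cl_proj_s2 μ m' hm (fun ω => X ω (idx a)) _ (hXL _) ?_ ?_
        · refine cl_memLp (Finset.aestronglyMeasurable_fun_prod _ fun s _ => (hYL (idx s)).1) 1 ?_ 2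
          filter_upwards [hYb] with ω hω
          rw [Finset.abs_prod]
          refine Finset.prod_le_one (fun _ _ => abs_nonneg _) fun s _ => ?_
          exact (sq_le_one_iff_abs_le_one _).1 ((hsingle (fun i => Y i ω) (idx s)).trans hω)
        · exact Finset.stronglyMeasurable_fun_prod _ fun s _ => hYm (idx s)
      simp only [this]
      simp only [ne_eq, OfNat.ofNat_ne_zero, not_false_eq_true, zero_pow, Finset.sum_const_zero]
      positivity
    · obtain ⟨b, hbS, hba⟩ : ∃ b ∈ S, b ≠ a := by
        by_contra hcon
        push Not at hcon
        exact hS1 (Finset.eq_singleton_iff_unique_mem.2 ⟨ha, hcon⟩)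
      obtain ⟨i1, e1⟩ := cl_sq_sum_s2 μ (fun (idx : Fin d → Fin m) ω => ∏ s, v S s (idx s) ω) (hvi S)
      obtain ⟨i2, e2⟩ := clG_eq μ Z hZL
      simp only [hA]
      rw [e1, e2, ← integral_const_mul]
      refine integral_mono_ae i1 (i2.const_mul _) ?_
      filter_upwards [cl_fst hvb] with p hp
      have k1 : ∑ idx : Fin d → Fin m, (∏ s, v S s (idx s) p.1) * ∏ s, v S s (idx s) p.2
          = ∏ s, ∑ i, v S s i p.1 * v S s i p.2 := by
        rw [Finset.prod_univ_sum]
        simp only [Fintype.piFinset_univ, Finset.prod_mul_distrib]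
      rw [k1, ← Finset.mul_prod_erase _ _ (Finset.mem_univ a),
        ← Finset.mul_prod_erase _ _ (Finset.mem_erase.2 ⟨hba, Finset.mem_univ b⟩)]
      have ka : ∑ i, v S a i p.1 * v S a i p.2 = ∑ i, Z i p.1 * Z i p.2 := by simp [hv, ha]
      have kb : ∑ i, v S b i p.1 * v S b i p.2 = ∑ i, Z i p.1 * Z i p.2 := by simp [hv, hbS]
      rw [ka, kb, ← mul_assoc, ← sq, mul_comm]
      refine mul_le_mul_of_nonneg_right ?_ (sq_nonneg _)
      refine (le_abs_self _).trans ?_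
      rw [Finset.abs_prod]
      calc ∏ s ∈ (Finset.univ.erase a).erase b, |∑ i, v S s i p.1 * v S s i p.2|
          ≤ ∏ s ∈ (Finset.univ.erase a).erase b, (4 : ℝ) := by
            refine Finset.prod_le_prod (fun _ _ => abs_nonneg _) fun s _ => ?_
            have h1 := Finset.sum_mul_sq_le_sq_mul_sq Finset.univ (fun i => v S s i p.1)
              (fun i => v S s i p.2)
            have h2 := mul_le_mul (hp.1 S s) (hp.2 S s)
              (Finset.sum_nonneg fun _ _ => sq_nonneg _) (by norm_num)
            exact abs_le_of_sq_le_sq (by linarith) (by norm_num)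
        _ = 4 ^ ((Finset.univ.erase a).erase b).card := by simp
        _ ≤ 4 ^ d := by
            refine pow_le_pow_right₀ (by norm_num) ?_
            exact (Finset.card_le_univ _).trans (by simp)
  change ∑ idx : Fin d → Fin m, ((∫ ω, ∏ s, X ω (idx s) ∂μ) - ∫ ω, ∏ s, Y (idx s) ω ∂μ) ^ 2 ≤ 16 ^ d * clG μ Z
  simp only [hdiff]
  set P := Finset.univ.erase (∅ : Finset (Fin d)) with hP
  have hPc : (P.card : ℝ) ≤ 2 ^ d := by
    have : P.card ≤ 2 ^ d := (Finset.card_le_univ _).trans (by simp)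
    exact_mod_cast this
  have hG0 : 0 ≤ clG μ Z := Finset.sum_nonneg fun _ _ => Finset.sum_nonneg fun _ _ => sq_nonneg _
  calc ∑ idx : Fin d → Fin m, (∑ S ∈ P, A S idx) ^ 2
      ≤ ∑ idx : Fin d → Fin m, P.card * ∑ S ∈ P, A S idx ^ 2 :=
        Finset.sum_le_sum fun idx _ => sq_sum_le_card_mul_sum_sq
    _ = P.card * ∑ S ∈ P, ∑ idx, A S idx ^ 2 := by
        rw [← Finset.mul_sum, Finset.sum_comm]
    _ ≤ P.card * ∑ S ∈ P, 4 ^ d * clG μ Z := by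
        refine mul_le_mul_of_nonneg_left (Finset.sum_le_sum fun S hS => ?_) (Nat.cast_nonneg _)
        exact hAS S (Finset.ne_of_mem_erase hS)
    _ = P.card * P.card * (4 ^ d * clG μ Z) := by
        rw [Finset.sum_const, nsmul_eq_mul, mul_assoc]
    _ ≤ 2 ^ d * 2 ^ d * (4 ^ d * clG μ Z) := by gcongr
    _ = 16 ^ d * clG μ Z := by
        rw [← mul_assoc, ← mul_pow, ← mul_pow]; norm_num


/-- The **higher-moment** version of the optimal covariance-loss theorem: there is an absolute
constant `C > 0` (the constant of the main theorem) such that for every `k ≥ 3` and `d ≥ 2`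
there is a measurable partition of `ℝ^m` into at most `k` sets with
`‖𝔼[X^⊗d] - 𝔼[Y^⊗d]‖_F ≤ 4^d · C / √(log k)` for `Y = 𝔼[X ∣ 𝓕]`. -/
theorem covariance_loss_higher_moments :
    ∃ C : ℝ, 0 < C ∧
      ∀ (Ω : Type) [MeasurableSpace Ω] (μ : Measure Ω) [IsProbabilityMeasure μ]
        (m : ℕ) (X : Ω → Fin m → ℝ), Measurable X →
        (∀ᵐ ω ∂μ, Real.sqrt (∑ i, X ω i ^ 2) ≤ 1) →
        ∀ k d : ℕ, 3 ≤ k → 2 ≤ d →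
        ∃ P : Fin k → Set (Fin m → ℝ),
          (∀ j, MeasurableSet (P j)) ∧
          (Pairwise fun j j' => Disjoint (P j) (P j')) ∧
          (⋃ j, P j) = Set.univ ∧
          (let Y : Ω → Fin m → ℝ := fun ω i =>
              (μ[fun ω' => X ω' i |
                MeasurableSpace.generateFrom {s : Set Ω | ∃ j, s = X ⁻¹' P j}]) ω
           Real.sqrt (∑ idx : Fin d → Fin m,
              ((∫ ω, ∏ t, X ω (idx t) ∂μ) - ∫ ω, ∏ t, Y ω (idx t) ∂μ) ^ 2)
            ≤ 4 ^ d * C / Real.sqrt (Real.log k)) := by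
  refine ⟨40, by norm_num, ?_⟩
  intro Ω mΩ μ _ m X hX hb' k d hk hd
  have hb : ∀ᵐ ω ∂μ, ∑ i, X ω i ^ 2 ≤ 1 := hb'.mono fun ω hω => by
    rwa [Real.sqrt_le_one] at hω
  have hlog0 : 0 < Real.log k := Real.log_pos (by exact_mod_cast (by omega : 1 < k))
  set t := Nat.log 2 k / 13 with ht
  have hlogk : Real.log k ≤ 13 * (t + 1) := by
    have h1 : k < 2 ^ (Nat.log 2 k + 1) := Nat.lt_pow_succ_log_self (by norm_num) k
    have h2 : Nat.log 2 k + 1 ≤ 13 * (t + 1) := by omega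
    have h3 : (k : ℝ) ≤ 2 ^ (13 * (t + 1)) := by
      exact_mod_cast h1.le.trans (Nat.pow_le_pow_right (by norm_num) h2)
    calc Real.log k ≤ Real.log (2 ^ (13 * (t + 1))) :=
          Real.log_le_log (by exact_mod_cast (by omega : 0 < k)) h3
      _ = (13 * (t + 1) : ℕ) * Real.log 2 := by rw [Real.log_pow]
      _ ≤ (13 * (t + 1) : ℕ) * 1 := by
          gcongr
          linarith [Real.log_two_lt_d9]
      _ = 13 * (t + 1) := by push_cast; ring
  have hex : ∃ c : (Fin m → ℝ) → Fin k, Measurable c ∧ ∀ m' : MeasurableSpace Ω, m' ≤ mΩ →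
      Measurable[m'] (fun ω => c (X ω)) →
      clG μ (fun i ω => X ω i - (μ[fun ω' => X ω' i|m']) ω) ≤ 1600 / Real.log k := by
    rcases Nat.eq_zero_or_pos t with h0 | h0
    · refine ⟨fun _ => ⟨0, by omega⟩, measurable_const, fun m' hm _ => ?_⟩
      refine (cl_moment μ m d X hX hb m' hm).1.trans ?_
      rw [h0] at hlogk
      rw [le_div_iff₀ hlog0]
      norm_num at hlogk
      linarith
    · have hpow : 2 ^ (13 * t) ≤ k :=
        (Nat.pow_le_pow_right (by norm_num) (by omega)).trans
          (Nat.pow_log_le_self 2 (by omega : k ≠ 0))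
      obtain ⟨c, hc, h⟩ := cl_main μ m X hX hb t k h0 hpow
      refine ⟨c, hc, fun m' hm hcX => (h m' hm hcX).trans ?_⟩
      have h1 : (1 : ℝ) ≤ t := by exact_mod_cast h0
      rw [div_le_div_iff₀ (by linarith) hlog0]
      linarith
  obtain ⟨c, hc, hG⟩ := hex
  refine ⟨fun j => c ⁻¹' {j}, fun j => hc (measurableSet_singleton j), ?_, ?_, ?_⟩
  · intro j j' hjj
    rw [Set.disjoint_left]
    intro x hx hx'
    exact hjj (by rw [← Set.mem_singleton_iff.1 hx, ← Set.mem_singleton_iff.1 hx'])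
  · ext x; simp
  · intro Y
    set m' := MeasurableSpace.generateFrom {s : Set Ω | ∃ j, s = X ⁻¹' (c ⁻¹' {j})} with hm'
    have hm : m' ≤ mΩ := by
      refine MeasurableSpace.generateFrom_le ?_
      rintro s ⟨j, rfl⟩
      exact hX (hc (measurableSet_singleton j))
    have hcX : Measurable[m'] (fun ω => c (X ω)) := by
      refine @measurable_to_countable' _ _ _ _ m' _ fun j => ?_
      exact MeasurableSpace.measurableSet_generateFrom ⟨j, rfl⟩
    have h1 := (cl_moment μ m d X hX hb m' hm).2
    have h2 := hG m' hm hcX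
    rw [Real.sqrt_le_left (by positivity)]
    refine h1.trans ?_
    rw [div_pow, Real.sq_sqrt hlog0.le, mul_pow, ← pow_mul, mul_comm d 2, pow_mul, mul_div_assoc]
    norm_num
    gcongr
end

section
/- Let X be a random vector valued in {±1}^m / √m almost surely. Then for every integer k ≥ 3, there exists a partition of {±1}^m / √m into at most k sets such that, with F the sigma-algebra generated by this partition and Y = E[X | F], one has ‖Σ_X − Σ_Y‖_F ≤ 9 / √(log₂ k). -/
open MeasureTheory ProbabilityTheory Real Finset

/-- The discrete cube `{±1}^m / √m` inside `ℝ^m`. -/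
def signCube (m : ℕ) : Set (Fin m → ℝ) :=
  {x | ∀ i, x i = 1 / Real.sqrt m ∨ x i = -(1 / Real.sqrt m)}

lemma cl_pull {Ω : Type*} {F m0 : MeasurableSpace Ω} (μ : Measure Ω) [IsProbabilityMeasure μ]
    (hF : F ≤ m0) {f g : Ω → ℝ} (hf : MemLp f 2 μ) (hg : MemLp g 2 μ)
    (hgm : AEStronglyMeasurable[F] g μ) :
    ∫ ω, (μ[f | F]) ω * g ω ∂μ = ∫ ω, f ω * g ω ∂μ := by
  have h := condExp_mul_of_aestronglyMeasurable_right hgm (hf.integrable_mul hg)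
    (hf.integrable one_le_two)
  have h2 : ∫ ω, (μ[f * g | F]) ω ∂μ = ∫ ω, (f * g) ω ∂μ := integral_condExp hF
  rw [integral_congr_ae h] at h2
  simpa using h2

lemma cl_cov_s3 {Ω : Type*} [MeasurableSpace Ω] (μ : Measure Ω) [IsProbabilityMeasure μ]
    {f g : Ω → ℝ} (hf : MemLp f 2 μ) (hg : MemLp g 2 μ) :
    ∫ ω, (f ω - ∫ ω', f ω' ∂μ) * (g ω - ∫ ω', g ω' ∂μ) ∂μ
      = ∫ ω, f ω * g ω ∂μ - (∫ ω, f ω ∂μ) * ∫ ω, g ω ∂μ := by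
  have hfg : Integrable (fun ω => f ω * g ω) μ := hf.integrable_mul hg
  have hfi := hf.integrable one_le_two
  have hgi := hg.integrable one_le_two
  generalize ha : ∫ ω, f ω ∂μ = a
  generalize hb : ∫ ω, g ω ∂μ = b
  have : ∀ ω, (f ω - a) * (g ω - b) = f ω * g ω - b * f ω - a * g ω + a * b := fun ω => by ring
  simp_rw [this]
  have i1 : Integrable (fun ω => f ω * g ω - b * f ω) μ := hfg.sub (hfi.const_mul b)
  have i2 : Integrable (fun ω => f ω * g ω - b * f ω - a * g ω) μ := i1.sub (hgi.const_mul a)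
  rw [integral_add i2 (integrable_const _), integral_sub i1 (hgi.const_mul a),
    integral_sub hfg (hfi.const_mul b), integral_const_mul, integral_const_mul, ha, hb]
  simp
  ring

/-- expand the square `∫ (U - t V)^2 ≥ 0`. -/
lemma cl_quad_s3 {Ω : Type*} [MeasurableSpace Ω] (μ : Measure Ω)
    {U V : Ω → ℝ} (hU : MemLp U 2 μ) (hV : MemLp V 2 μ) (t : ℝ) :
    0 ≤ ∫ ω, U ω * U ω ∂μ - 2 * t * ∫ ω, U ω * V ω ∂μ + t ^ 2 * ∫ ω, V ω * V ω ∂μ := by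
  have hUV : Integrable (fun ω => U ω * V ω) μ := hU.integrable_mul hV
  have hUU : Integrable (fun ω => U ω * U ω) μ := hU.integrable_mul hU
  have hVV : Integrable (fun ω => V ω * V ω) μ := hV.integrable_mul hV
  have h : 0 ≤ ∫ ω, (U ω - t * V ω) ^ 2 ∂μ := integral_nonneg fun ω => sq_nonneg _
  have : ∀ ω, (U ω - t * V ω) ^ 2 = U ω * U ω - (2 * t) * (U ω * V ω) + t ^ 2 * (V ω * V ω) :=
    fun ω => by ring
  simp_rw [this] at h
  have i1 : Integrable (fun ω => U ω * U ω - (2 * t) * (U ω * V ω)) μ :=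
    hUU.sub (hUV.const_mul _)
  rwa [integral_add i1 (hVV.const_mul _),
    integral_sub hUU (hUV.const_mul _), integral_const_mul, integral_const_mul] at h

lemma cl_sub_mul {Ω : Type*} [MeasurableSpace Ω] (μ : Measure Ω)
    {a b c d : Ω → ℝ} (ha : MemLp a 2 μ) (hb : MemLp b 2 μ) (hc : MemLp c 2 μ)
    (hd : MemLp d 2 μ) :
    ∫ ω, (a - b) ω * (c - d) ω ∂μ = ∫ ω, a ω * c ω ∂μ - ∫ ω, a ω * d ω ∂μ
      - ∫ ω, b ω * c ω ∂μ + ∫ ω, b ω * d ω ∂μ := by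
  have h1 : Integrable (fun ω => a ω * c ω) μ := ha.integrable_mul hc
  have h2 : Integrable (fun ω => a ω * d ω) μ := ha.integrable_mul hd
  have h3 : Integrable (fun ω => b ω * c ω) μ := hb.integrable_mul hc
  have h4 : Integrable (fun ω => b ω * d ω) μ := hb.integrable_mul hd
  have : ∀ ω, (a - b) ω * (c - d) ω = a ω * c ω - a ω * d ω - b ω * c ω + b ω * d ω :=
    fun ω => by simp only [Pi.sub_apply]; ring
  simp_rw [this]
  have i1 : Integrable (fun ω => a ω * c ω - a ω * d ω) μ := h1.sub h2
  have i2 : Integrable (fun ω => a ω * c ω - a ω * d ω - b ω * c ω) μ := i1.sub h3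
  rw [integral_add i2 h4, integral_sub i1 h3, integral_sub h1 h2]

/-- energy bound -/
lemma cl_energy {Ω : Type*} {F m0 : MeasurableSpace Ω} (μ : Measure Ω) [IsProbabilityMeasure μ]
    (hF : F ≤ m0) {f : Ω → ℝ} (hf : MemLp f 2 μ) :
    ∫ ω, (μ[f | F]) ω * (μ[f | F]) ω ∂μ ≤ ∫ ω, f ω * f ω ∂μ := by
  have hY : MemLp (μ[f | F]) 2 μ := hf.condExp one_le_two
  have h1 := cl_pull μ hF hf hY stronglyMeasurable_condExp.aestronglyMeasurable
  have h2 := cl_quad_s3 μ hf hY 1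
  linarith

/-- increment bound -/
lemma cl_incr {Ω : Type*} {F F' m0 : MeasurableSpace Ω} (μ : Measure Ω) [IsProbabilityMeasure μ]
    (hFF : F ≤ F') (hF' : F' ≤ m0) {f g : Ω → ℝ} (hf : MemLp f 2 μ) (hg : MemLp g 2 μ)
    (hgm : AEStronglyMeasurable[F'] g μ) (c : ℝ) (hc : 0 < c)
    (hgc : ∫ ω, g ω * g ω ∂μ ≤ 1 / c) :
    c * (∫ ω, f ω * g ω ∂μ - ∫ ω, (μ[f | F]) ω * (μ[g | F]) ω ∂μ) ^ 2
      ≤ ∫ ω, (μ[f | F']) ω * (μ[f | F']) ω ∂μ - ∫ ω, (μ[f | F]) ω * (μ[f | F]) ω ∂μ := by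
  have hF := hFF.trans hF'
  have hY : MemLp (μ[f | F]) 2 μ := hf.condExp one_le_two
  have hY' : MemLp (μ[f | F']) 2 μ := hf.condExp one_le_two
  have hZ : MemLp (μ[g | F]) 2 μ := hg.condExp one_le_two
  have mY : StronglyMeasurable[F] (μ[f | F]) := stronglyMeasurable_condExp
  have mZ : StronglyMeasurable[F] (μ[g | F]) := stronglyMeasurable_condExp
  have e1 := cl_pull μ hF' hf hg hgm
  have e2 := cl_pull μ hF' hf hZ (mZ.mono hFF).aestronglyMeasurable
  have e3 := cl_pull μ hF hf hZ mZ.aestronglyMeasurable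
  have e4 := cl_pull μ hF hg hY mY.aestronglyMeasurable
  have e5 := cl_pull μ hF' hf hY (mY.mono hFF).aestronglyMeasurable
  have e6 := cl_pull μ hF hf hY mY.aestronglyMeasurable
  have e7 := cl_pull μ hF hg hZ mZ.aestronglyMeasurable
  have q := cl_quad_s3 μ (hY'.sub hY) (hg.sub hZ)
    (c * (∫ ω, f ω * g ω ∂μ - ∫ ω, (μ[f | F]) ω * (μ[g | F]) ω ∂μ))
  rw [cl_sub_mul μ hY' hY hY' hY, cl_sub_mul μ hY' hY hg hZ, cl_sub_mul μ hg hZ hg hZ] at q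
  have c1 : ∫ ω, (μ[f | F]) ω * (μ[f | F']) ω ∂μ = ∫ ω, (μ[f | F']) ω * (μ[f | F]) ω ∂μ := by
    simp_rw [mul_comm]
  have c2 : ∫ ω, (μ[f | F]) ω * g ω ∂μ = ∫ ω, g ω * (μ[f | F]) ω ∂μ := by
    simp_rw [mul_comm]
  have c3 : ∫ ω, (μ[g | F]) ω * (μ[f | F]) ω ∂μ = ∫ ω, (μ[f | F]) ω * (μ[g | F]) ω ∂μ := by
    simp_rw [mul_comm]
  have c4 : 0 ≤ ∫ ω, (μ[g | F]) ω * (μ[g | F]) ω ∂μ :=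
    integral_nonneg fun ω => mul_self_nonneg _
  have c5 : ∫ ω, (μ[g | F]) ω * g ω ∂μ = ∫ ω, g ω * (μ[g | F]) ω ∂μ := by
    simp_rw [mul_comm]
  rw [c1, e5, ← e6, e1, e2, ← e3, c2, ← e4, c3, c5, ← e7] at q
  set M := ∫ ω, f ω * g ω ∂μ - ∫ ω, (μ[f | F]) ω * (μ[g | F]) ω ∂μ with hM
  have hB : (c * M) ^ 2 * (∫ ω, g ω * g ω ∂μ - ∫ ω, (μ[g | F]) ω * (μ[g | F]) ω ∂μ)
      ≤ c * M ^ 2 := by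
    calc _ ≤ (c * M) ^ 2 * (1 / c) := by
          apply mul_le_mul_of_nonneg_left _ (sq_nonneg _); linarith
      _ = c * M ^ 2 := by field_simp
  nlinarith [q, hB]

/-- The cells of the cube given by the signs of the coordinates in `J`. -/
def clCell {m : ℕ} (J S : Finset (Fin m)) : Set (Fin m → ℝ) :=
  {x | x ∈ signCube m ∧ ∀ i, (i ∈ J ∧ 0 < x i) ↔ i ∈ S}

def clSigma {Ω : Type*} {m : ℕ} (X : Ω → Fin m → ℝ) (J : Finset (Fin m)) : MeasurableSpace Ω :=
  MeasurableSpace.generateFrom {s : Set Ω | ∃ S, s = X ⁻¹' clCell J S}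

lemma cl_cube_finite (m : ℕ) : (signCube m).Finite := by
  have : signCube m = Set.pi Set.univ
      (fun _ : Fin m => ({1 / Real.sqrt m, -(1 / Real.sqrt m)} : Set ℝ)) := by
    ext x; simp [signCube]
  rw [this]
  exact Set.Finite.pi fun _ => Set.toFinite _

lemma cl_meas {m : ℕ} {A : Set (Fin m → ℝ)} (h : A ⊆ signCube m) : MeasurableSet A :=
  ((cl_cube_finite m).subset h).measurableSet

lemma clSigma_le {Ω : Type*} [m0 : MeasurableSpace Ω] {m : ℕ} {X : Ω → Fin m → ℝ}
    (hX : Measurable X) (J : Finset (Fin m)) : clSigma X J ≤ m0 := by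
  apply MeasurableSpace.generateFrom_le
  rintro s ⟨S, rfl⟩
  exact hX (cl_meas fun x hx => hx.1)

lemma clSigma_mono {Ω : Type*} {m : ℕ} (X : Ω → Fin m → ℝ) {J J' : Finset (Fin m)}
    (h : J ⊆ J') : clSigma X J ≤ clSigma X J' := by
  apply MeasurableSpace.generateFrom_le
  rintro s ⟨S, rfl⟩
  have : X ⁻¹' clCell J S = ⋃ S' ∈ {S' : Finset (Fin m) | S' ∩ J = S}, X ⁻¹' clCell J' S' := by
    ext ω
    simp only [Set.mem_preimage, Set.mem_iUnion, clCell, Set.mem_ofPred_eq, exists_prop]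
    constructor
    · rintro ⟨h1, h2⟩
      refine ⟨J'.filter (fun i => 0 < X ω i), ?_, h1, fun i => by simp⟩
      ext i
      have := h2 i
      have := @h i
      simp only [Finset.mem_inter, Finset.mem_filter]
      tauto
    · rintro ⟨S', hS, h1, h2⟩
      refine ⟨h1, fun i => ?_⟩
      have := h2 i
      have := @h i
      rw [← hS, Finset.mem_inter]
      tauto
  rw [this]
  refine MeasurableSet.biUnion (Set.to_countable _) fun S' _ => ?_
  exact MeasurableSpace.measurableSet_generateFrom ⟨S', rfl⟩

lemma clSigma_coord {Ω : Type*} [MeasurableSpace Ω] (μ : Measure Ω) {m : ℕ}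
    {X : Ω → Fin m → ℝ} (hXval : ∀ᵐ ω ∂μ, X ω ∈ signCube m) {J : Finset (Fin m)} {j : Fin m}
    (hj : j ∈ J) : AEStronglyMeasurable[clSigma X J] (fun ω => X ω j) μ := by
  have hm : 0 < 1 / Real.sqrt m := by
    have : 0 < m := j.pos
    positivity
  have hA : MeasurableSet[clSigma X J]
      (⋃ S ∈ {S : Finset (Fin m) | j ∈ S}, X ⁻¹' clCell J S) := by
    refine MeasurableSet.biUnion (Set.to_countable _) fun S' _ => ?_
    exact MeasurableSpace.measurableSet_generateFrom ⟨S', rfl⟩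
  classical
  refine ⟨Set.piecewise _ (fun _ => 1 / Real.sqrt m) (fun _ => -(1 / Real.sqrt m)),
    StronglyMeasurable.piecewise hA stronglyMeasurable_const stronglyMeasurable_const, ?_⟩
  filter_upwards [hXval] with ω hω
  by_cases hp : 0 < X ω j
  · rw [Set.piecewise_eq_of_mem]
    · rcases hω j with h | h
      · exact h
      · linarith
    · simp only [Set.mem_iUnion, exists_prop, Set.mem_ofPred_eq, Set.mem_preimage]
      exact ⟨J.filter (fun i => 0 < X ω i), by simp [hj, hp], hω, fun i => by simp⟩
  · rw [Set.piecewise_eq_of_notMem]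
    · rcases hω j with h | h
      · linarith
      · exact h
    · simp only [Set.mem_iUnion, exists_prop, Set.mem_ofPred_eq, Set.mem_preimage, not_exists]
      rintro S ⟨h1, _, h3⟩
      exact hp ((h3 j).2 h1).2

lemma cl_memLp_s3 {Ω : Type*} [MeasurableSpace Ω] (μ : Measure Ω) [IsProbabilityMeasure μ] {m : ℕ}
    {X : Ω → Fin m → ℝ} (hX : Measurable X) (hXval : ∀ᵐ ω ∂μ, X ω ∈ signCube m) (i : Fin m) :
    MemLp (fun ω => X ω i) 2 μ := by
  refine MemLp.of_bound ((measurable_pi_apply i).comp hX).aestronglyMeasurable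
    (1 / Real.sqrt m) ?_
  filter_upwards [hXval] with ω hω
  rcases hω i with h | h <;> rw [h] <;> simp [abs_of_nonneg]

lemma cl_sq {Ω : Type*} [MeasurableSpace Ω] (μ : Measure Ω) [IsProbabilityMeasure μ] {m : ℕ}
    {X : Ω → Fin m → ℝ} (hXval : ∀ᵐ ω ∂μ, X ω ∈ signCube m) (i : Fin m) :
    ∫ ω, X ω i * X ω i ∂μ = 1 / m := by
  have : (fun ω => X ω i * X ω i) =ᵐ[μ] fun _ => (1 / m : ℝ) := by
    filter_upwards [hXval] with ω hω
    have h2 : (1 / Real.sqrt m) * (1 / Real.sqrt m) = (1 / m : ℝ) := by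
      rw [div_mul_div_comm, Real.mul_self_sqrt (Nat.cast_nonneg _), one_mul]
    rcases hω i with h | h <;> rw [h] <;> linarith
  rw [integral_congr_ae this]
  simp

/-- The covariance loss matrix for the partition by `J`. -/
noncomputable def clM {Ω : Type*} [MeasurableSpace Ω] (μ : Measure Ω) {m : ℕ}
    (X : Ω → Fin m → ℝ) (J : Finset (Fin m)) (i j : Fin m) : ℝ :=
  ∫ ω, X ω i * X ω j ∂μ - ∫ ω, (μ[fun ω' => X ω' i | clSigma X J]) ω *
    (μ[fun ω' => X ω' j | clSigma X J]) ω ∂μ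

/-- The potential. -/
noncomputable def clPhi {Ω : Type*} [MeasurableSpace Ω] (μ : Measure Ω) {m : ℕ}
    (X : Ω → Fin m → ℝ) (J : Finset (Fin m)) : ℝ :=
  ∑ i, ∫ ω, (μ[fun ω' => X ω' i | clSigma X J]) ω *
    (μ[fun ω' => X ω' i | clSigma X J]) ω ∂μ

lemma clPhi_le {Ω : Type*} [MeasurableSpace Ω] (μ : Measure Ω) [IsProbabilityMeasure μ] {m : ℕ}
    {X : Ω → Fin m → ℝ} (hX : Measurable X) (hXval : ∀ᵐ ω ∂μ, X ω ∈ signCube m)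
    (J : Finset (Fin m)) : clPhi μ X J ≤ 1 := by
  calc clPhi μ X J ≤ ∑ i : Fin m, (1 / m : ℝ) := by
        refine Finset.sum_le_sum fun i _ => ?_
        rw [← cl_sq μ hXval i]
        exact cl_energy μ (clSigma_le hX J) (cl_memLp_s3 μ hX hXval i)
    _ ≤ 1 := by
        rcases Nat.eq_zero_or_pos m with h | h
        · subst h; simp
        · have : (0 : ℝ) < m := by exact_mod_cast h
          simp [this.ne']

lemma clPhi_incr {Ω : Type*} [MeasurableSpace Ω] (μ : Measure Ω) [IsProbabilityMeasure μ] {m : ℕ}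
    {X : Ω → Fin m → ℝ} (hX : Measurable X) (hXval : ∀ᵐ ω ∂μ, X ω ∈ signCube m)
    (J : Finset (Fin m)) (ε : ℝ) (hε : 0 ≤ ε) (hbad : ε < ∑ i, ∑ j, clM μ X J i j ^ 2) :
    ∃ j, clPhi μ X J + ε < clPhi μ X (insert j J) := by
  by_contra! hcon
  have key : ∀ j, (m : ℝ) * ∑ i, clM μ X J i j ^ 2 ≤ ε := by
    intro j
    have hm : (0 : ℝ) < m := by exact_mod_cast j.pos
    have h1 : (m : ℝ) * ∑ i, clM μ X J i j ^ 2 ≤ clPhi μ X (insert j J) - clPhi μ X J := by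
      rw [Finset.mul_sum, clPhi, clPhi, ← Finset.sum_sub_distrib]
      refine Finset.sum_le_sum fun i _ => ?_
      exact cl_incr μ (clSigma_mono X (Finset.subset_insert j J)) (clSigma_le hX _)
        (cl_memLp_s3 μ hX hXval i) (cl_memLp_s3 μ hX hXval j)
        (clSigma_coord μ hXval (Finset.mem_insert_self j J)) m hm (cl_sq μ hXval j).le
    linarith [hcon j]
  rw [Finset.sum_comm] at hbad
  rcases Nat.eq_zero_or_pos m with h | h
  · subst h
    simp at hbad
    linarith
  · have hm : (0 : ℝ) < m := by exact_mod_cast h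
    have : (m : ℝ) * ∑ j, ∑ i, clM μ X J i j ^ 2 ≤ m * ε := by
      rw [Finset.mul_sum]
      calc _ ≤ ∑ j : Fin m, ε := Finset.sum_le_sum fun j _ => key j
        _ = m * ε := by simp
    have := le_of_mul_le_mul_left this hm
    linarith

lemma cl_greedy_s3 {Ω : Type*} [MeasurableSpace Ω] (μ : Measure Ω) [IsProbabilityMeasure μ] {m : ℕ}
    {X : Ω → Fin m → ℝ} (hX : Measurable X) (hXval : ∀ᵐ ω ∂μ, X ω ∈ signCube m)
    (t : ℕ) (ht : 0 < t) :
    ∃ J : Finset (Fin m), J.card ≤ t ∧ ∑ i, ∑ j, clM μ X J i j ^ 2 ≤ 1 / t := by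
  by_contra! hcon
  have ht' : (0 : ℝ) < t := by exact_mod_cast ht
  have step : ∀ n : ℕ, n ≤ t → ∃ J : Finset (Fin m), J.card ≤ n ∧ (n : ℝ) * (1 / t) ≤ clPhi μ X J := by
    intro n
    induction n with
    | zero =>
      intro _
      refine ⟨∅, by simp, ?_⟩
      simp only [Nat.cast_zero, zero_mul]
      exact Finset.sum_nonneg fun i _ => integral_nonneg fun ω => mul_self_nonneg _
    | succ n ih =>
      intro hn
      obtain ⟨J, hJ, hP⟩ := ih (by omega)
      obtain ⟨j, hj⟩ := clPhi_incr μ hX hXval J (1 / t) (by positivity) (hcon J (by omega))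
      refine ⟨insert j J, (Finset.card_insert_le _ _).trans (by omega), ?_⟩
      push_cast
      linarith
  obtain ⟨J, hJ, hP⟩ := step t le_rfl
  obtain ⟨j, hj⟩ := clPhi_incr μ hX hXval J (1 / t) (by positivity) (hcon J hJ)
  have h1 := clPhi_le μ hX hXval (insert j J)
  have h2 : (t : ℝ) * (1 / t) = 1 := by field_simp
  have h3 : (0 : ℝ) < 1 / t := by positivity
  linarith

lemma cl_cov_sub {Ω : Type*} [MeasurableSpace Ω] (μ : Measure Ω) [IsProbabilityMeasure μ] {m : ℕ}
    {X : Ω → Fin m → ℝ} (hX : Measurable X) (hXval : ∀ᵐ ω ∂μ, X ω ∈ signCube m)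
    (J : Finset (Fin m)) (i j : Fin m) :
    (covMatrix μ X - covMatrix μ
      (fun ω i => (μ[fun ω' => X ω' i | clSigma X J]) ω)) i j = clM μ X J i j := by
  have hi := cl_memLp_s3 μ hX hXval i
  have hj := cl_memLp_s3 μ hX hXval j
  have e1 := cl_cov_s3 μ hi hj
  have e2 := cl_cov_s3 μ (f := μ[fun ω' => X ω' i | clSigma X J])
    (g := μ[fun ω' => X ω' j | clSigma X J]) (hi.condExp one_le_two) (hj.condExp one_le_two)
  simp only [Matrix.sub_apply, covMatrix, Matrix.of_apply]
  rw [e1, e2, integral_condExp (clSigma_le hX J), integral_condExp (clSigma_le hX J), clM]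
  ring

/-- The covariance-loss theorem for **Boolean data**: if `X ∈ {±1}^m/√m` a.s., then for every
`k ≥ 3` there is a partition of `{±1}^m/√m` into at most `k` sets such that, with `𝓕` the
sigma-algebra generated by the partition (pulled back through `X`) and `Y = 𝔼[X ∣ 𝓕]`, one has
`‖Σ_X - Σ_Y‖_F ≤ 9 / √(log₂ k)`. -/
theorem covariance_loss_boolean
    (Ω : Type) [MeasurableSpace Ω] (μ : Measure Ω) [IsProbabilityMeasure μ]
    (m : ℕ) (X : Ω → Fin m → ℝ) (hXmeas : Measurable X)
    (hXval : ∀ᵐ ω ∂μ, X ω ∈ signCube m)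
    (k : ℕ) (hk : 3 ≤ k) :
    ∃ P : Fin k → Set (Fin m → ℝ),
      (∀ j, P j ⊆ signCube m) ∧
      (∀ j, MeasurableSet (P j)) ∧
      (Pairwise fun j j' => Disjoint (P j) (P j')) ∧
      (⋃ j, P j) = signCube m ∧
      frobNorm (covMatrix μ X - covMatrix μ
          (fun ω i => (μ[fun ω' => X ω' i |
            MeasurableSpace.generateFrom {s : Set Ω | ∃ j, s = X ⁻¹' P j}]) ω))
        ≤ 9 / Real.sqrt (Real.logb 2 k) := by
  classical
  set t := Nat.log 2 k with ht
  have ht0 : 0 < t := Nat.log_pos (by norm_num) (by omega)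
  have htk : 2 ^ t ≤ k := Nat.pow_log_le_self 2 (by omega)
  obtain ⟨J, hJ, hbound⟩ := cl_greedy_s3 μ hXmeas hXval t ht0
  have hcard : J.powerset.card ≤ (Finset.univ : Finset (Fin k)).card := by
    rw [Finset.card_powerset, Finset.card_univ, Fintype.card_fin]
    exact (Nat.pow_le_pow_right (by norm_num) hJ).trans htk
  obtain ⟨f, hf⟩ : ∃ f : Finset (Fin m) → Fin k, Set.InjOn f (J.powerset : Set (Finset (Fin m))) := by
    obtain ⟨e⟩ := Function.Embedding.nonempty_of_card_le
      (α := J.powerset) (β := Fin k) (by rw [Fintype.card_coe]; simpa using hcard)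
    refine ⟨fun S => if h : S ∈ J.powerset then e ⟨S, h⟩ else ⟨0, by omega⟩, ?_⟩
    intro S hS S' hS' h
    have hS1 : S ∈ J.powerset := hS
    have hS2 : S' ∈ J.powerset := hS'
    simp only [hS1, hS2, dif_pos] at h
    simpa using e.injective h
  have hpat : ∀ x ∈ signCube m, x ∈ clCell J (J.filter (fun i => 0 < x i)) :=
    fun x hx => ⟨hx, fun i => by simp⟩
  have huniq : ∀ x S, x ∈ clCell J S → S = J.filter (fun i => 0 < x i) := by
    rintro x S ⟨_, h⟩
    ext i
    rw [← h i]; simp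
  have hgen : MeasurableSpace.generateFrom {s : Set Ω | ∃ j, s = X ⁻¹'
      {x | x ∈ signCube m ∧ f (J.filter (fun i => 0 < x i)) = j}} = clSigma X J := by
    apply le_antisymm
    · apply MeasurableSpace.generateFrom_le
      rintro s ⟨j, rfl⟩
      have : X ⁻¹' {x | x ∈ signCube m ∧ f (J.filter (fun i => 0 < x i)) = j}
          = ⋃ S ∈ {S : Finset (Fin m) | f S = j}, X ⁻¹' clCell J S := by
        ext ω
        simp only [Set.mem_preimage, Set.mem_iUnion, Set.mem_ofPred_eq, exists_prop]
        constructor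
        · rintro ⟨h1, h2⟩
          exact ⟨_, h2, hpat _ h1⟩
        · rintro ⟨S, h1, h2⟩
          refine ⟨h2.1, ?_⟩
          rw [← huniq _ _ h2, h1]
      rw [this]
      refine MeasurableSet.biUnion (Set.to_countable _) fun S' _ => ?_
      exact MeasurableSpace.measurableSet_generateFrom ⟨S', rfl⟩
    · apply MeasurableSpace.generateFrom_le
      rintro s ⟨S, rfl⟩
      by_cases hS : S ⊆ J
      · apply MeasurableSpace.measurableSet_generateFrom
        refine ⟨f S, ?_⟩
        ext ω
        simp only [Set.mem_preimage, Set.mem_ofPred_eq]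
        constructor
        · intro h
          exact ⟨h.1, by rw [← huniq _ _ h]⟩
        · rintro ⟨h1, h2⟩
          have := hf (Finset.mem_coe.2 (Finset.mem_powerset.2 (Finset.filter_subset _ _)))
            (Finset.mem_coe.2 (Finset.mem_powerset.2 hS)) h2
          rw [← this]
          exact hpat _ h1
      · have : X ⁻¹' clCell J S = ∅ := by
          ext ω
          simp only [Set.mem_preimage, Set.mem_empty_iff_false, iff_false]
          intro h
          apply hS
          rw [huniq _ _ h]
          exact Finset.filter_subset _ _
        rw [this]
        exact @MeasurableSet.empty _ (_)
  refine ⟨fun j => {x | x ∈ signCube m ∧ f (J.filter (fun i => 0 < x i)) = j},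
    fun j x hx => hx.1, fun j => cl_meas fun x hx => hx.1, ?_, ?_, ?_⟩
  · intro j j' hne
    rw [Set.disjoint_left]
    rintro x ⟨_, h1⟩ ⟨_, h2⟩
    exact hne (h1.symm.trans h2)
  · ext x
    simp
  · rw [hgen, frobNorm]
    simp_rw [cl_cov_sub μ hXmeas hXval J]
    have hlog0 : 0 < Real.logb 2 k :=
      Real.logb_pos (by norm_num) (by exact_mod_cast (by omega : 1 < k))
    have hlog : Real.logb 2 k ≤ t + 1 := by
      rw [Real.logb_le_iff_le_rpow (by norm_num) (by exact_mod_cast (by omega : 0 < k))]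
      have := (Nat.lt_pow_succ_log_self (b := 2) (by norm_num) k).le
      have h2 : (k : ℝ) ≤ 2 ^ (t + 1) := by exact_mod_cast this
      exact_mod_cast h2
    have ht1 : (1 : ℝ) ≤ t := by exact_mod_cast ht0
    rw [le_div_iff₀ (Real.sqrt_pos.2 hlog0), ← Real.sqrt_mul' _ hlog0.le]
    apply Real.sqrt_le_iff.2
    refine ⟨by norm_num, ?_⟩
    calc _ ≤ (1 / (t : ℝ)) * (t + 1) := by gcongr
      _ ≤ 9 ^ 2 := by
        rw [div_mul_eq_mul_div, div_le_iff₀ (by linarith)]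
        linarith
end

section
/- Let X be a random vector valued in {±1}^m / √m almost surely, let k ≥ 3, and suppose m ≥ log₂ k. Let t be chosen uniformly at random from {0, 1, …, ⌊log₂ k⌋}, and given t let S be a uniformly random subset of [m] of size t; let Y = E[X | X_S], where X_S := (X_i)_{i ∈ S}. Then the expectation over the random choice of (t, S) satisfies E_S ‖Σ_X − Σ_Y‖_F ≤ 3 / √(log₂ k). -/
open MeasureTheory ProbabilityTheory Real Finset

/-- The sigma-algebra on `Ω` generated by the coordinates of `X` indexed by `S ⊆ [m]`. -/
noncomputable def coordSigma {Ω : Type*} {m : ℕ} (X : Ω → Fin m → ℝ) (S : Finset (Fin m)) :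
    MeasurableSpace Ω :=
  MeasurableSpace.comap (fun ω => fun i : {i // i ∈ S} => X ω (i : Fin m)) inferInstance

lemma frobNorm_sq {m : ℕ} (A : Matrix (Fin m) (Fin m) ℝ) :
    frobNorm A ^ 2 = ∑ i, ∑ j, (A i j) ^ 2 :=
  Real.sq_sqrt (sum_nonneg fun _ _ => sum_nonneg fun _ _ => sq_nonneg _)

lemma int_sub4 {Ω : Type*} [MeasurableSpace Ω] {μ : Measure Ω} {a b c d : Ω → ℝ}
    (ha : Integrable a μ) (hb : Integrable b μ) (hc : Integrable c μ) (hd : Integrable d μ) :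
    ∫ ω, ((a ω - b ω) - (c ω - d ω)) ∂μ
      = ((∫ ω, a ω ∂μ) - ∫ ω, b ω ∂μ) - ((∫ ω, c ω ∂μ) - ∫ ω, d ω ∂μ) := by
  have h := integral_sub (ha.sub hb) (hc.sub hd)
  rw [integral_sub' ha hb, integral_sub' hc hd] at h
  exact h

lemma int_add3 {Ω : Type*} [MeasurableSpace Ω] {μ : Measure Ω} {a b c : Ω → ℝ}
    (ha : Integrable a μ) (hb : Integrable b μ) (hc : Integrable c μ) :
    ∫ ω, (a ω + b ω + c ω) ∂μ = (∫ ω, a ω ∂μ) + (∫ ω, b ω ∂μ) + (∫ ω, c ω ∂μ) := by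
  have h := integral_add (ha.add hb) hc
  rw [integral_add' ha hb] at h
  exact h

lemma cs_aux {Ω : Type*} [MeasurableSpace Ω] {μ : Measure Ω} [IsProbabilityMeasure μ]
    {a b : Ω → ℝ} (ha : MemLp a ⊤ μ) (hb : MemLp b ⊤ μ) :
    (∫ ω, a ω * b ω ∂μ) ^ 2 ≤ (∫ ω, a ω * a ω ∂μ) * (∫ ω, b ω * b ω ∂μ) := by
  have iab : Integrable (fun ω => a ω * b ω) μ := (hb.mul' ha : MemLp _ ⊤ μ).integrable le_top
  have iaa : Integrable (fun ω => a ω * a ω) μ := (ha.mul' ha : MemLp _ ⊤ μ).integrable le_top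
  have ibb : Integrable (fun ω => b ω * b ω) μ := (hb.mul' hb : MemLp _ ⊤ μ).integrable le_top
  have key : ∀ s : ℝ, 0 ≤ (∫ ω, b ω * b ω ∂μ) * (s * s) + (-2 * ∫ ω, a ω * b ω ∂μ) * s
      + ∫ ω, a ω * a ω ∂μ := by
    intro s
    have h : 0 ≤ ∫ ω, (a ω - s * b ω) * (a ω - s * b ω) ∂μ :=
      integral_nonneg fun ω => mul_self_nonneg _
    have e : ∀ ω, (a ω - s * b ω) * (a ω - s * b ω)
        = (s * s) * (b ω * b ω) + (-2 * s) * (a ω * b ω) + a ω * a ω := fun ω => by ring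
    simp_rw [e] at h
    rw [int_add3 (ibb.const_mul _) (iab.const_mul _) iaa, integral_const_mul,
      integral_const_mul] at h
    linarith
  have := discrim_le_zero key
  unfold discrim at this
  linarith

lemma proj_aux {Ω : Type*} {m1 m0 : MeasurableSpace Ω} {μ : Measure Ω} [IsProbabilityMeasure μ]
    (h1 : m1 ≤ m0) {f g : Ω → ℝ} (hf : MemLp f ⊤ μ) (hg : MemLp g ⊤ μ)
    (hgm : StronglyMeasurable[m1] g) :
    ∫ ω, g ω * (μ[f|m1]) ω ∂μ = ∫ ω, g ω * f ω ∂μ := by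
  have h := condExp_mul_of_stronglyMeasurable_left (μ := μ) hgm
    ((hf.mul hg : MemLp (g * f) ⊤ μ).integrable le_top) (hf.integrable le_top)
  have h2 : ∫ ω, (μ[g * f|m1]) ω ∂μ = ∫ ω, (g * f) ω ∂μ := integral_condExp h1
  rw [integral_congr_ae h] at h2
  exact h2

lemma memLp_condExp_aux {Ω : Type*} {m1 m0 : MeasurableSpace Ω} {μ : Measure Ω}
    [IsProbabilityMeasure μ] {f : Ω → ℝ} (hf : MemLp f ⊤ μ) :
    MemLp (μ[f|m1]) ⊤ μ := hf.condExp le_top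

lemma core_aux {Ω : Type*} {m1 m2 m0 : MeasurableSpace Ω} {μ : Measure Ω}
    [IsProbabilityMeasure μ] (h12 : m1 ≤ m2) (h2 : m2 ≤ m0)
    {f g : Ω → ℝ} (hf : MemLp f ⊤ μ) (hg : MemLp g ⊤ μ)
    (hfm : StronglyMeasurable[m2] f) :
    (∫ ω, f ω * g ω ∂μ - ∫ ω, (μ[f|m1]) ω * (μ[g|m1]) ω ∂μ) ^ 2 ≤ (∫ ω, f ω * f ω ∂μ) *
      (∫ ω, (μ[g|m2]) ω * (μ[g|m2]) ω ∂μ - ∫ ω, (μ[g|m1]) ω * (μ[g|m1]) ω ∂μ) := by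
  have h1 := h12.trans h2
  set F := μ[f|m1] with hF
  set G1 := μ[g|m1] with hG1
  set G2 := μ[g|m2] with hG2
  have lF : MemLp F ⊤ μ := memLp_condExp_aux hf
  have lG1 : MemLp G1 ⊤ μ := memLp_condExp_aux hg
  have lG2 : MemLp G2 ⊤ μ := memLp_condExp_aux hg
  have sF : StronglyMeasurable[m1] F := stronglyMeasurable_condExp
  have sG1 : StronglyMeasurable[m1] G1 := stronglyMeasurable_condExp
  have I : ∀ {a b : Ω → ℝ}, MemLp a ⊤ μ → MemLp b ⊤ μ →
      Integrable (fun ω => a ω * b ω) μ :=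
    fun ha hb => (hb.mul' ha : MemLp _ ⊤ μ).integrable le_top
  -- projections
  have p1 : ∫ ω, f ω * G2 ω ∂μ = ∫ ω, f ω * g ω ∂μ := proj_aux h2 hg hf hfm
  have p2 : ∫ ω, F ω * G2 ω ∂μ = ∫ ω, F ω * g ω ∂μ := proj_aux h2 hg lF (sF.mono h12)
  have p3 : ∫ ω, F ω * G1 ω ∂μ = ∫ ω, F ω * g ω ∂μ := proj_aux h1 hg lF sF
  have p4 : ∫ ω, G1 ω * F ω ∂μ = ∫ ω, G1 ω * f ω ∂μ := proj_aux h1 hf lG1 sG1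
  have p5 : ∫ ω, G1 ω * G2 ω ∂μ = ∫ ω, G1 ω * g ω ∂μ := proj_aux h2 hg lG1 (sG1.mono h12)
  have p6 : ∫ ω, G1 ω * G1 ω ∂μ = ∫ ω, G1 ω * g ω ∂μ := proj_aux h1 hg lG1 sG1
  have p7 : ∫ ω, F ω * F ω ∂μ = ∫ ω, F ω * f ω ∂μ := proj_aux h1 hf lF sF
  have c1 : ∫ ω, G1 ω * F ω ∂μ = ∫ ω, F ω * G1 ω ∂μ := by simp_rw [mul_comm]
  have e1 : ∫ ω, (f - F) ω * (G2 - G1) ω ∂μ = ∫ ω, f ω * g ω ∂μ - ∫ ω, F ω * G1 ω ∂μ := by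
    have e : ∀ ω, (f - F) ω * (G2 - G1) ω
        = (f ω * G2 ω - F ω * G2 ω) - (G1 ω * f ω - G1 ω * F ω) := fun ω => by
      simp only [Pi.sub_apply]; ring
    simp_rw [e]
    rw [int_sub4 (I hf lG2) (I lF lG2) (I lG1 hf) (I lG1 lF)]
    linarith
  have e2 : ∫ ω, (f - F) ω * (f - F) ω ∂μ ≤ ∫ ω, f ω * f ω ∂μ := by
    have e : ∀ ω, (f - F) ω * (f - F) ω
        = (f ω * f ω - F ω * f ω) - (F ω * f ω - F ω * F ω) := fun ω => by
      simp only [Pi.sub_apply]; ring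
    simp_rw [e]
    rw [int_sub4 (I hf hf) (I lF hf) (I lF hf) (I lF lF)]
    have : 0 ≤ ∫ ω, F ω * F ω ∂μ := integral_nonneg fun ω => mul_self_nonneg _
    linarith
  have e3 : ∫ ω, (G2 - G1) ω * (G2 - G1) ω ∂μ
      = ∫ ω, G2 ω * G2 ω ∂μ - ∫ ω, G1 ω * G1 ω ∂μ := by
    have e : ∀ ω, (G2 - G1) ω * (G2 - G1) ω
        = (G2 ω * G2 ω - G1 ω * G2 ω) - (G1 ω * G2 ω - G1 ω * G1 ω) := fun ω => by
      simp only [Pi.sub_apply]; ring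
    simp_rw [e]
    rw [int_sub4 (I lG2 lG2) (I lG1 lG2) (I lG1 lG2) (I lG1 lG1)]
    linarith
  have h := cs_aux (hf.sub lF) (lG2.sub lG1)
  have n3 : 0 ≤ ∫ ω, (G2 - G1) ω * (G2 - G1) ω ∂μ := integral_nonneg fun ω => mul_self_nonneg _
  rw [e1] at h
  rw [← e3]
  exact h.trans (mul_le_mul_of_nonneg_right e2 n3)

lemma condExp_sq_le_aux {Ω : Type*} {m1 m0 : MeasurableSpace Ω} {μ : Measure Ω}
    [IsProbabilityMeasure μ] (h1 : m1 ≤ m0) {f : Ω → ℝ} (hf : MemLp f ⊤ μ) :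
    ∫ ω, (μ[f|m1]) ω * (μ[f|m1]) ω ∂μ ≤ ∫ ω, f ω * f ω ∂μ := by
  have lF : MemLp (μ[f|m1]) ⊤ μ := memLp_condExp_aux hf
  have p7 := proj_aux h1 hf lF stronglyMeasurable_condExp
  have h := cs_aux lF hf
  rw [← p7] at h
  have n0 : 0 ≤ ∫ ω, (μ[f|m1]) ω * (μ[f|m1]) ω ∂μ := integral_nonneg fun ω => mul_self_nonneg _
  have n1 : 0 ≤ ∫ ω, f ω * f ω ∂μ := integral_nonneg fun ω => mul_self_nonneg _
  rcases n0.eq_or_lt with h0 | h0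
  · rw [← h0]; exact n1
  · rw [sq] at h
    exact le_of_mul_le_mul_left h h0

/-- Double counting. -/
lemma double_count {m : ℕ} (t : ℕ) (Φ : Finset (Fin m) → ℝ) :
    ∑ S ∈ powersetCard t (univ : Finset (Fin m)), ∑ i ∈ Sᶜ, Φ (insert i S)
      = (t + 1) * ∑ U ∈ powersetCard (t + 1) (univ : Finset (Fin m)), Φ U := by
  have : (t + 1 : ℝ) * ∑ U ∈ powersetCard (t + 1) (univ : Finset (Fin m)), Φ U
      = ∑ U ∈ powersetCard (t + 1) (univ : Finset (Fin m)), ∑ i ∈ U, Φ U := by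
    rw [mul_sum]
    refine sum_congr rfl fun U hU => ?_
    rw [sum_const, (mem_powersetCard.1 hU).2]
    simp
  rw [this, sum_sigma', sum_sigma']
  refine sum_bij' (fun x _ => ⟨insert x.2 x.1, x.2⟩) (fun x _ => ⟨x.1.erase x.2, x.2⟩)
    ?_ ?_ ?_ ?_ ?_
  · rintro ⟨S, i⟩ h
    simp only [mem_sigma, mem_powersetCard, mem_compl, subset_univ, true_and] at h ⊢
    rw [card_insert_of_notMem h.2, h.1]
    simp
  · rintro ⟨S, i⟩ h
    simp only [mem_sigma, mem_powersetCard, mem_compl, subset_univ, true_and] at h ⊢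
    rw [card_erase_of_mem h.2, h.1]
    simp
  · rintro ⟨S, i⟩ h
    simp only [mem_sigma, mem_compl] at h
    simp [erase_insert h.2]
  · rintro ⟨S, i⟩ h
    simp only [mem_sigma] at h
    simp [insert_erase h.2]
  · rintro ⟨S, i⟩ h
    rfl

/-- Combinatorial averaging. -/
lemma comb_aux {m T : ℕ} (hm : 0 < m) (hT : T ≤ m) (Φ G : Finset (Fin m) → ℝ)
    (h0 : ∀ S, 0 ≤ Φ S) (h1 : ∀ S, Φ S ≤ 1) (hmono : ∀ S i, Φ S ≤ Φ (insert i S))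
    (hG : ∀ S, G S ≤ (m : ℝ)⁻¹ * ∑ i, (Φ (insert i S) - Φ S)) :
    ∑ t ∈ range (T + 1), ((m.choose t : ℝ))⁻¹ * ∑ S ∈ powersetCard t univ, G S ≤ 1 := by
  set A : ℕ → ℝ := fun t => ((m.choose t : ℝ))⁻¹ * ∑ S ∈ powersetCard t univ, Φ S with hA
  have hm' : (0 : ℝ) < m := by exact_mod_cast hm
  have hAle : ∀ t ≤ m, A t ≤ 1 := by
    intro t ht
    have hc : (0 : ℝ) < m.choose t := by exact_mod_cast Nat.choose_pos ht
    have : ∑ S ∈ powersetCard t (univ : Finset (Fin m)), Φ S ≤ m.choose t := by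
      calc _ ≤ ∑ S ∈ powersetCard t (univ : Finset (Fin m)), (1 : ℝ) := sum_le_sum fun S _ => h1 S
        _ = _ := by simp
    simp only [hA]
    rw [inv_mul_le_iff₀ hc]; linarith
  have hA0 : 0 ≤ A 0 := by
    simp only [hA]; exact mul_nonneg (by positivity) (sum_nonneg fun S _ => h0 S)
  have hG' : ∀ S, G S ≤ (m : ℝ)⁻¹ * ∑ i ∈ Sᶜ, (Φ (insert i S) - Φ S) := by
    intro S
    refine (hG S).trans_eq ?_
    congr 1
    symm
    refine sum_subset (subset_univ _) fun i _ hi => ?_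
    rw [insert_eq_of_mem (by simpa using hi), sub_self]
  have step : ∀ t < m, ((m.choose t : ℝ))⁻¹ * ∑ S ∈ powersetCard t univ, G S
      ≤ A (t + 1) - A t := by
    intro t ht
    have hc : (0 : ℝ) < m.choose t := by exact_mod_cast Nat.choose_pos ht.le
    have hc' : (0 : ℝ) < m.choose (t + 1) := by exact_mod_cast Nat.choose_pos ht
    have hmt : (0 : ℝ) < (m : ℝ) - t := by
      rw [sub_pos]; exact_mod_cast ht
    have hch : (m.choose (t + 1) : ℝ) * (t + 1) = m.choose t * ((m : ℝ) - t) := by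
      have := Nat.choose_succ_right_eq m t
      rw [← Nat.cast_sub ht.le]
      exact_mod_cast this
    have hsum : ∑ S ∈ powersetCard t (univ : Finset (Fin m)), ∑ i ∈ Sᶜ, (Φ (insert i S) - Φ S)
        = m.choose t * (((m : ℝ) - t) * (A (t + 1) - A t)) := by
      simp_rw [sum_sub_distrib]
      rw [double_count]
      have : ∑ S ∈ powersetCard t (univ : Finset (Fin m)), ∑ i ∈ Sᶜ, Φ S
          = ((m : ℝ) - t) * ∑ S ∈ powersetCard t (univ : Finset (Fin m)), Φ S := by
        rw [mul_sum]
        refine sum_congr rfl fun S hS => ?_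
        rw [sum_const, card_compl, (mem_powersetCard.1 hS).2, nsmul_eq_mul, Fintype.card_fin,
          Nat.cast_sub ht.le]
      rw [this]
      have e1 : ∑ S ∈ powersetCard t (univ : Finset (Fin m)), Φ S = m.choose t * A t := by
        simp only [hA]; field_simp
      have e2 : ∑ S ∈ powersetCard (t + 1) (univ : Finset (Fin m)), Φ S
          = m.choose (t + 1) * A (t + 1) := by
        simp only [hA]; field_simp
      rw [e1, e2]
      linear_combination A (t + 1) * hch
    have hnn : 0 ≤ A (t + 1) - A t := by
      have : 0 ≤ m.choose t * (((m : ℝ) - t) * (A (t + 1) - A t)) := by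
        rw [← hsum]
        exact sum_nonneg fun S _ => sum_nonneg fun i _ => sub_nonneg.2 (hmono S i)
      exact nonneg_of_mul_nonneg_right (nonneg_of_mul_nonneg_right this hc) hmt
    calc _ ≤ ((m.choose t : ℝ))⁻¹ * ∑ S ∈ powersetCard t univ,
          ((m : ℝ)⁻¹ * ∑ i ∈ Sᶜ, (Φ (insert i S) - Φ S)) := by
          gcongr with S _
          exact hG' S
      _ = (((m : ℝ) - t) / m) * (A (t + 1) - A t) := by
          rw [← mul_sum, hsum]; field_simp
      _ ≤ 1 * (A (t + 1) - A t) := by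
          gcongr
          rw [div_le_one hm']
          have : (0 : ℝ) ≤ t := by positivity
          linarith
      _ = _ := one_mul _
  have tele : ∀ n ≤ m, ∑ t ∈ range n, ((m.choose t : ℝ))⁻¹ * ∑ S ∈ powersetCard t univ, G S ≤ 1 := by
    intro n hn
    calc _ ≤ ∑ t ∈ range n, (A (t + 1) - A t) :=
          sum_le_sum fun t ht => step t ((mem_range.1 ht).trans_le hn)
      _ = A n - A 0 := sum_range_sub _ _
      _ ≤ 1 := by linarith [hAle n hn]
  rcases hT.lt_or_eq with h | h
  · exact tele _ h
  · subst h
    rw [sum_range_succ]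
    have : ((T.choose T : ℝ))⁻¹ * ∑ S ∈ powersetCard T (univ : Finset (Fin T)), G S ≤ 0 := by
      have hp : powersetCard T (univ : Finset (Fin T)) = {univ} := by
        have h := powersetCard_self (univ : Finset (Fin T))
        rwa [Finset.card_fin] at h
      rw [hp, sum_singleton]
      have := hG' univ
      simp only [compl_univ, sum_empty, mul_zero] at this
      simpa using this
    linarith [tele T le_rfl]

/-- For Boolean data `X ∈ {±1}^m/√m` with `m ≥ log₂ k`, the average covariance loss over a
uniformly random `t ∈ {0, …, ⌊log₂ k⌋}` and a uniformly random subset `S ⊆ [m]` of size `t`,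
conditioning on the coordinates `X_S`, satisfies `𝔼_S ‖Σ_X - Σ_Y‖_F ≤ 3/√(log₂ k)`. -/
theorem covariance_loss_boolean_average
    (Ω : Type) [MeasurableSpace Ω] (μ : Measure Ω) [IsProbabilityMeasure μ]
    (m : ℕ) (X : Ω → Fin m → ℝ) (hXmeas : Measurable X)
    (hXval : ∀ᵐ ω ∂μ, ∀ i, X ω i = 1 / Real.sqrt m ∨ X ω i = -(1 / Real.sqrt m))
    (k : ℕ) (hk : 3 ≤ k) (hm : Real.logb 2 k ≤ m)
    (Y : Finset (Fin m) → Ω → Fin m → ℝ)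
    (hY : ∀ S, Y S = fun ω i => (μ[fun ω' => X ω' i | coordSigma X S]) ω) :
    ((Nat.log 2 k : ℝ) + 1)⁻¹ *
        ∑ t ∈ Finset.range (Nat.log 2 k + 1),
          ((m.choose t : ℝ))⁻¹ *
            ∑ S ∈ Finset.powersetCard t (Finset.univ : Finset (Fin m)),
              frobNorm (covMatrix μ X - covMatrix μ (Y S))
      ≤ 3 / Real.sqrt (Real.logb 2 k) := by
  have hl1 : (1 : ℝ) < Real.logb 2 k := by
    rw [Real.lt_logb_iff_rpow_lt (by norm_num) (by positivity)]
    have : (3 : ℝ) ≤ k := by exact_mod_cast hk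
    norm_num
    linarith
  have hm0 : 0 < m := by
    have : (0 : ℝ) < m := by linarith
    exact_mod_cast this
  have hm' : (0 : ℝ) < m := by exact_mod_cast hm0
  set T := Nat.log 2 k with hTdef
  have hTm : T ≤ m := by
    have : (T : ℝ) ≤ Real.logb 2 k := by
      rw [Real.le_logb_iff_rpow_le (by norm_num) (by positivity), Real.rpow_natCast]
      exact_mod_cast Nat.pow_log_le_self 2 (by omega)
    exact_mod_cast this.trans hm
  have hlT : Real.logb 2 k ≤ (T : ℝ) + 1 := by
    rw [Real.logb_le_iff_le_rpow (by norm_num) (by positivity)]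
    have : k ≤ 2 ^ (T + 1) := (Nat.lt_pow_succ_log_self (by norm_num) k).le
    have h2 : (k : ℝ) ≤ 2 ^ (T + 1) := by exact_mod_cast this
    rw [← Real.rpow_natCast] at h2
    exact_mod_cast h2
  -- the coordinates
  set f : Fin m → Ω → ℝ := fun i ω => X ω i with hf
  have hfmeas : ∀ i, Measurable (f i) := fun i => (measurable_pi_apply i).comp hXmeas
  have hfL : ∀ i, MemLp (f i) ⊤ μ := by
    intro i
    refine memLp_top_of_bound (hfmeas i).aestronglyMeasurable (1 / Real.sqrt m) ?_
    filter_upwards [hXval] with ω hω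
    have h0 : 0 ≤ 1 / Real.sqrt m := by positivity
    rcases hω i with h | h
    · simp only [hf, h, Real.norm_eq_abs, abs_of_nonneg h0, le_refl]
    · simp only [hf, h, Real.norm_eq_abs, abs_neg, abs_of_nonneg h0, le_refl]
  have hff : ∀ i, ∫ ω, f i ω * f i ω ∂μ = (m : ℝ)⁻¹ := by
    intro i
    have : (fun ω => f i ω * f i ω) =ᵐ[μ] fun _ => (m : ℝ)⁻¹ := by
      filter_upwards [hXval] with ω hω
      have hs : Real.sqrt m * Real.sqrt m = m := Real.mul_self_sqrt hm'.le
      have : (1 / Real.sqrt m) * (1 / Real.sqrt m) = (m : ℝ)⁻¹ := by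
        rw [div_mul_div_comm, hs]; simp
      rcases hω i with h | h
      · simp only [hf, h, this]
      · simp only [hf, h, neg_mul_neg, this]
    rw [integral_congr_ae this]
    simp
  have hsig : ∀ S, coordSigma X S ≤ (inferInstance : MeasurableSpace Ω) := fun S =>
    Measurable.comap_le (f := fun ω => fun i : {i // i ∈ S} => X ω (i : Fin m))
      (measurable_pi_lambda _ fun i => hfmeas i)
  have hcoord : ∀ S, ∀ i ∈ S, Measurable[coordSigma X S] (f i) := by
    intro S i hi
    exact (measurable_pi_apply (⟨i, hi⟩ : {i // i ∈ S})).comp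
      (comap_measurable (fun ω => fun i : {i // i ∈ S} => X ω (i : Fin m)))
  have hmono : ∀ S i, coordSigma X S ≤ coordSigma X (insert i S) := by
    intro S i
    refine Measurable.comap_le ?_
    exact @measurable_pi_lambda _ _ _ (coordSigma X (insert i S)) _ _
      fun j => hcoord (insert i S) j (mem_insert_of_mem j.2)
  set Φ : Finset (Fin m) → ℝ := fun S =>
    ∑ j, ∫ ω, (μ[f j|coordSigma X S]) ω * (μ[f j|coordSigma X S]) ω ∂μ with hΦ
  have hcov : ∀ (Z : Ω → Fin m → ℝ), (∀ i, MemLp (fun ω => Z ω i) ⊤ μ) → ∀ i j,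
      covMatrix μ Z i j = ∫ ω, Z ω i * Z ω j ∂μ - (∫ ω, Z ω i ∂μ) * ∫ ω, Z ω j ∂μ := by
    intro Z hZ i j
    exact covariance_eq_sub ((hZ i).mono_exponent le_top) ((hZ j).mono_exponent le_top)
  have hent : ∀ S i j, (covMatrix μ X - covMatrix μ (Y S)) i j
      = ∫ ω, f i ω * f j ω ∂μ
        - ∫ ω, (μ[f i|coordSigma X S]) ω * (μ[f j|coordSigma X S]) ω ∂μ := by
    intro S i j
    rw [Matrix.sub_apply, hcov X hfL, hcov (Y S), hY S]
    · have e : ∀ i, ∫ ω, (μ[fun ω' => X ω' i|coordSigma X S]) ω ∂μ = ∫ ω, X ω i ∂μ :=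
        fun i => integral_condExp (hsig S)
      simp only [e]
      ring
    · intro i
      rw [hY S]
      exact memLp_condExp_aux (hfL i)
  have hkey : ∀ S i j, ((covMatrix μ X - covMatrix μ (Y S)) i j) ^ 2 ≤ (m : ℝ)⁻¹ *
      (∫ ω, (μ[f j|coordSigma X (insert i S)]) ω * (μ[f j|coordSigma X (insert i S)]) ω ∂μ
        - ∫ ω, (μ[f j|coordSigma X S]) ω * (μ[f j|coordSigma X S]) ω ∂μ) := by
    intro S i j
    rw [hent, ← hff i]
    exact core_aux (hmono S i) (hsig _) (hfL i) (hfL j)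
      (hcoord _ i (mem_insert_self i S)).stronglyMeasurable
  have hΦ0 : ∀ S, 0 ≤ Φ S := fun S =>
    sum_nonneg fun j _ => integral_nonneg fun ω => mul_self_nonneg _
  have hΦ1 : ∀ S, Φ S ≤ 1 := by
    intro S
    calc Φ S ≤ ∑ j : Fin m, (m : ℝ)⁻¹ := sum_le_sum fun j _ => by
          rw [← hff j]; exact condExp_sq_le_aux (hsig S) (hfL j)
      _ = 1 := by simp [hm'.ne']
  have hΦm : ∀ S i, Φ S ≤ Φ (insert i S) := by
    intro S i
    refine sum_le_sum fun j _ => ?_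
    have h := (sq_nonneg _).trans (hkey S i j)
    exact sub_nonneg.1 (nonneg_of_mul_nonneg_right h (by positivity))
  set N : Finset (Fin m) → ℝ := fun S => frobNorm (covMatrix μ X - covMatrix μ (Y S)) with hN
  have hG : ∀ S, (N S) ^ 2 ≤ (m : ℝ)⁻¹ * ∑ i, (Φ (insert i S) - Φ S) := by
    intro S
    simp only [hN]
    rw [frobNorm_sq, mul_sum]
    refine sum_le_sum fun i _ => ?_
    simp only [hΦ]
    rw [← sum_sub_distrib, mul_sum]
    exact sum_le_sum fun j _ => hkey S i j
  have hcomb := comb_aux hm0 hTm Φ (fun S => (N S) ^ 2) hΦ0 hΦ1 hΦm hG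
  -- final averaging: N ≤ (c + N² / c) / 2
  have hT1 : (0 : ℝ) < (T : ℝ) + 1 := by positivity
  set r := Real.sqrt ((T : ℝ) + 1) with hr
  have hrpos : 0 < r := Real.sqrt_pos.2 hT1
  have hrr : r * r = (T : ℝ) + 1 := Real.mul_self_sqrt hT1.le
  have hpt : ∀ S, N S ≤ (1 / 2) * r⁻¹ + (r / 2) * (N S) ^ 2 := by
    intro S
    have h : 0 ≤ (r / 2) * (N S - r⁻¹) ^ 2 := by positivity
    have e : (r / 2) * (N S - r⁻¹) ^ 2 = (1 / 2) * r⁻¹ + (r / 2) * (N S) ^ 2 - N S := by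
      field_simp
      ring
    linarith
  have hin : ∀ t ∈ range (T + 1), ((m.choose t : ℝ))⁻¹ * ∑ S ∈ powersetCard t univ, N S
      ≤ (1 / 2) * r⁻¹ + (r / 2) * (((m.choose t : ℝ))⁻¹ * ∑ S ∈ powersetCard t univ, (N S) ^ 2) := by
    intro t ht
    have htm : t ≤ m := by have := mem_range.1 ht; omega
    have hc : (0 : ℝ) < m.choose t := by exact_mod_cast Nat.choose_pos htm
    calc _ ≤ ((m.choose t : ℝ))⁻¹ * ∑ S ∈ powersetCard t (univ : Finset (Fin m)),
          ((1 / 2) * r⁻¹ + (r / 2) * (N S) ^ 2) := by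
          gcongr with S _
          exact hpt S
      _ = _ := by
          rw [sum_add_distrib, sum_const, card_powersetCard, card_univ,
            Fintype.card_fin, nsmul_eq_mul, ← mul_sum]
          field_simp
  have hfin : ((T : ℝ) + 1)⁻¹ * ∑ t ∈ range (T + 1),
      ((m.choose t : ℝ))⁻¹ * ∑ S ∈ powersetCard t univ, N S ≤ r⁻¹ := by
    rw [inv_mul_le_iff₀ hT1]
    calc _ ≤ _ := sum_le_sum hin
      _ = ((T : ℝ) + 1) * ((1 / 2) * r⁻¹) + (r / 2) * ∑ t ∈ range (T + 1),
            (((m.choose t : ℝ))⁻¹ * ∑ S ∈ powersetCard t univ, (N S) ^ 2) := by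
          rw [sum_add_distrib, sum_const, card_range, nsmul_eq_mul, ← mul_sum]
          push_cast
          ring
      _ ≤ ((T : ℝ) + 1) * ((1 / 2) * r⁻¹) + (r / 2) * 1 := by gcongr
      _ = ((T : ℝ) + 1) * r⁻¹ := by
          rw [← hrr]; field_simp; ring
  refine hfin.trans ?_
  have hs : 0 < Real.sqrt (Real.logb 2 k) := Real.sqrt_pos.2 (by linarith)
  calc r⁻¹ ≤ (Real.sqrt (Real.logb 2 k))⁻¹ := by
        apply inv_anti₀ hs
        exact Real.sqrt_le_sqrt hlT
    _ ≤ 3 / Real.sqrt (Real.logb 2 k) := by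
        rw [inv_eq_one_div]
        gcongr
        norm_num
end

section
/- Let X be a random vector valued in {±1}^m / √m almost surely, let k ≥ 3, and suppose m ≥ log₂ k. Let t be chosen uniformly at random from {0, 1, …, ⌊log₂ k⌋}, and given t let S be a uniformly random subset of [m] of size t; let Y = E[X | X_S]. Then the probability over the random choice of (t, S) satisfies P_S[ ‖Σ_X − Σ_Y‖_F ≥ 9 / √(log₂ k) ] ≤ 1/3. -/
open MeasureTheory ProbabilityTheory Real Finset
open scoped Classical

lemma aux_pull {Ω : Type*} {m1 m0 : MeasurableSpace Ω} {μ : Measure[m0] Ω}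
    [IsProbabilityMeasure μ] (hle : m1 ≤ m0) {f h : Ω → ℝ} (hf : MemLp f 2 μ) (hh : MemLp h 2 μ)
    (hm : StronglyMeasurable[m1] h) :
    ∫ ω, (μ[f | m1]) ω * h ω ∂μ = ∫ ω, f ω * h ω ∂μ := by
  have h1 : μ[f * h | m1] =ᵐ[μ] μ[f | m1] * h :=
    condExp_mul_of_stronglyMeasurable_right hm (hf.integrable_mul hh)
      (hf.integrable one_le_two)
  have h2 := integral_condExp (μ := μ) (f := f * h) hle
  rw [integral_congr_ae h1] at h2
  simpa using h2

lemma aux_sq {Ω : Type*} {m1 m2 m0 : MeasurableSpace Ω} {μ : Measure[m0] Ω}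
    [IsProbabilityMeasure μ] (h12 : m1 ≤ m2) (hle : m2 ≤ m0) {f : Ω → ℝ} (hf : MemLp f 2 μ) :
    ∫ ω, ((μ[f | m2]) ω - (μ[f | m1]) ω) ^ 2 ∂μ
      = ∫ ω, (μ[f | m2]) ω ^ 2 ∂μ - ∫ ω, (μ[f | m1]) ω ^ 2 ∂μ := by
  have M1 : MemLp (μ[f | m1]) 2 μ := hf.condExp one_le_two
  have M2 : MemLp (μ[f | m2]) 2 μ := hf.condExp one_le_two
  have e1 := aux_pull (h12.trans hle) hf M1 stronglyMeasurable_condExp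
  have e2 := aux_pull hle hf M1 (stronglyMeasurable_condExp.mono h12)
  have i1 := M1.integrable_sq
  have i2 := M2.integrable_sq
  have i3 : Integrable (fun ω => (μ[f | m2]) ω * (μ[f | m1]) ω) μ := M2.integrable_mul M1
  have : ∀ ω, ((μ[f | m2]) ω - (μ[f | m1]) ω) ^ 2
      = ((μ[f | m2]) ω ^ 2 + (μ[f | m1]) ω ^ 2) - 2 * ((μ[f | m2]) ω * (μ[f | m1]) ω) := by
    intro ω; ring
  simp_rw [this]
  have i4 : Integrable (fun ω => (μ[f | m2]) ω ^ 2 + (μ[f | m1]) ω ^ 2) μ := i2.add i1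
  rw [integral_sub i4 (i3.const_mul 2), integral_add i2 i1, integral_const_mul, e2, ← e1]
  simp_rw [← pow_two]
  ring

lemma aux_jensen {Ω : Type*} {m0 : MeasurableSpace Ω} {μ : Measure[m0] Ω}
    [IsProbabilityMeasure μ] {f : Ω → ℝ} (hf : MemLp f 2 μ) :
    (∫ ω, f ω ∂μ) ^ 2 ≤ ∫ ω, f ω ^ 2 ∂μ := by
  have h := variance_nonneg f μ
  rw [variance_eq_sub hf] at h
  simpa using h

lemma aux_sum {m : ℕ} (hm : 0 < m) (g : Finset (Fin m) → ℝ) (hg0 : ∀ S, 0 ≤ g S)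
    (hg1 : ∀ S, g S ≤ 1) (hmono : ∀ S j, g S ≤ g (insert j S)) (n : ℕ) (hn : n ≤ m) :
    ∑ t ∈ range (n + 1), ((m.choose t : ℝ))⁻¹ *
      ∑ S ∈ powersetCard t (univ : Finset (Fin m)),
        (m : ℝ)⁻¹ * ∑ j, (g (insert j S) - g S) ≤ 1 := by
  set A : ℕ → ℝ := fun t => ((m.choose t : ℝ))⁻¹ *
    ∑ S ∈ powersetCard t (univ : Finset (Fin m)), g S with hA
  set B : ℕ → ℝ := fun t => ((m.choose t : ℝ))⁻¹ *
      ∑ S ∈ powersetCard t (univ : Finset (Fin m)),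
        (m : ℝ)⁻¹ * ∑ j, (g (insert j S) - g S) with hB
  have hm' : (0 : ℝ) < m := by exact_mod_cast hm
  have hBnn : ∀ t, 0 ≤ B t := by
    intro t
    refine mul_nonneg (by positivity) (sum_nonneg fun S _ => mul_nonneg (by positivity)
      (sum_nonneg fun j _ => by linarith [hmono S j]))
  have hBm : B m = 0 := by
    have : ∀ S ∈ powersetCard m (univ : Finset (Fin m)),
        (m : ℝ)⁻¹ * ∑ j, (g (insert j S) - g S) = 0 := by
      intro S hS
      have hS : S = univ := by
        rw [← card_eq_iff_eq_univ, (mem_powersetCard.1 hS).2, Fintype.card_fin]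
      subst hS
      simp
    simp only [hB]
    rw [sum_eq_zero this, mul_zero]
  have hcount : ∀ t, ∑ S ∈ powersetCard t (univ : Finset (Fin m)), ∑ j ∈ Sᶜ, g (insert j S)
      = (t + 1) * ∑ U ∈ powersetCard (t + 1) (univ : Finset (Fin m)), g U := by
    intro t
    have : ∑ U ∈ powersetCard (t + 1) (univ : Finset (Fin m)), ∑ j ∈ U, g U
      = (t + 1) * ∑ U ∈ powersetCard (t + 1) (univ : Finset (Fin m)), g U := by
      rw [mul_sum]
      refine sum_congr rfl fun U hU => ?_
      rw [sum_const, (mem_powersetCard.1 hU).2]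
      simp
    rw [← this, sum_sigma', sum_sigma']
    refine sum_bij' (fun p _ => ⟨insert p.2 p.1, p.2⟩) (fun p _ => ⟨p.1.erase p.2, p.2⟩)
      ?_ ?_ ?_ ?_ ?_
    · rintro ⟨S, j⟩ h
      simp only [mem_sigma, mem_powersetCard, mem_compl] at h ⊢
      simp [card_insert_of_notMem h.2, h.1.2]
    · rintro ⟨S, j⟩ h
      simp only [mem_sigma, mem_powersetCard, mem_compl] at h ⊢
      simp [card_erase_of_mem h.2, h.1.2]
    · rintro ⟨S, j⟩ h
      simp only [mem_sigma, mem_powersetCard, mem_compl] at h ⊢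
      simp [h.2]
    · rintro ⟨S, j⟩ h
      simp only [mem_sigma, mem_powersetCard, mem_compl] at h ⊢
      simp [h.2]
    · rintro ⟨S, j⟩ h
      rfl
  have hBA : ∀ t, t < m → B t = ((m - t : ℝ) / m) * (A (t + 1) - A t) := by
    intro t ht
    have e1 : ∀ S ∈ powersetCard t (univ : Finset (Fin m)),
        ∑ j, (g (insert j S) - g S) = ∑ j ∈ Sᶜ, g (insert j S) - (m - t) * g S := by
      intro S hS
      have hc := (mem_powersetCard.1 hS).2
      rw [← sum_add_sum_compl S]
      rw [sum_eq_zero (s := S) (fun j hj => by rw [insert_eq_of_mem hj, sub_self]), zero_add,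
        sum_sub_distrib, sum_const, card_compl, hc, Fintype.card_fin, nsmul_eq_mul,
        Nat.cast_sub ht.le]
    have hch : ((m.choose (t + 1) : ℕ) : ℝ) * (t + 1) = m.choose t * (m - t) := by
      have := Nat.choose_succ_right_eq m t
      have h2 : ((m.choose (t + 1) * (t + 1) : ℕ) : ℝ) = ((m.choose t * (m - t) : ℕ) : ℝ) := by
        rw [this]
      rw [Nat.cast_mul, Nat.cast_mul, Nat.cast_sub ht.le] at h2
      exact_mod_cast h2
    have p1 : (0 : ℝ) < m.choose t := by exact_mod_cast Nat.choose_pos ht.le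
    have p2 : (0 : ℝ) < m.choose (t + 1) := by exact_mod_cast Nat.choose_pos ht
    have p3 : (0 : ℝ) < t + 1 := by positivity
    simp only [hB, hA]
    rw [← mul_sum, sum_congr rfl e1, sum_sub_distrib, hcount, ← mul_sum]
    set P := ∑ S ∈ powersetCard t (univ : Finset (Fin m)), g S
    set Q := ∑ S ∈ powersetCard (t + 1) (univ : Finset (Fin m)), g S
    have hx : (m.choose t : ℝ)⁻¹ * (t + 1) = (m - t) * (m.choose (t + 1) : ℝ)⁻¹ := by
      field_simp
      linarith
    linear_combination (m : ℝ)⁻¹ * Q * hx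
  have hstep : ∀ t, t < m → B t ≤ A (t + 1) - A t := by
    intro t ht
    have h1 := hBA t ht
    have ht' : (t : ℝ) < m := by exact_mod_cast ht
    have hq : 0 < (m - t : ℝ) / m := div_pos (by linarith) hm'
    have hq1 : (m - t : ℝ) / m ≤ 1 := by
      rw [div_le_one hm']; linarith [(Nat.cast_nonneg t : (0 : ℝ) ≤ t)]
    have h2 : 0 ≤ A (t + 1) - A t := by
      have := hBnn t
      rw [h1] at this
      exact nonneg_of_mul_nonneg_right this hq
    rw [h1]
    nlinarith
  have hA0 : 0 ≤ A 0 := mul_nonneg (by positivity) (sum_nonneg fun S _ => hg0 S)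
  have hAm : A m ≤ 1 := by
    have : powersetCard m (univ : Finset (Fin m)) = {univ} := by
      have := powersetCard_self (univ : Finset (Fin m))
      rwa [card_univ, Fintype.card_fin] at this
    simp only [hA]
    rw [this]
    simpa using hg1 univ
  calc ∑ t ∈ range (n + 1), B t ≤ ∑ t ∈ range (m + 1), B t :=
        sum_le_sum_of_subset_of_nonneg (range_subset_range.2 (by omega)) fun t _ _ => hBnn t
    _ = ∑ t ∈ range m, B t := by rw [sum_range_succ, hBm, add_zero]
    _ ≤ ∑ t ∈ range m, (A (t + 1) - A t) := sum_le_sum fun t ht => hstep t (mem_range.1 ht)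
    _ = A m - A 0 := sum_range_sub A m
    _ ≤ 1 := by linarith

lemma aux_cov {Ω : Type*} [MeasurableSpace Ω] (μ : Measure Ω) [IsProbabilityMeasure μ] {m : ℕ}
    (X : Ω → Fin m → ℝ) (i j : Fin m) (hi : MemLp (fun ω => X ω i) 2 μ)
    (hj : MemLp (fun ω => X ω j) 2 μ) :
    covMatrix μ X i j = ∫ ω, X ω i * X ω j ∂μ - (∫ ω, X ω i ∂μ) * ∫ ω, X ω j ∂μ := by
  exact covariance_eq_sub hi hj

lemma aux_entry {Ω : Type*} [MeasurableSpace Ω] (μ : Measure Ω) [IsProbabilityMeasure μ]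
    (m : ℕ) (hm : 0 < m) (X : Ω → Fin m → ℝ) (hXmeas : Measurable X)
    (hsq : ∀ᵐ ω ∂μ, ∀ i, X ω i ^ 2 = (m : ℝ)⁻¹)
    (hL : ∀ i, MemLp (fun ω => X ω i) 2 μ)
    (hbd : ∀ i, ∀ᵐ ω ∂μ, ‖X ω i‖ ≤ 1)
    (hle : ∀ S, coordSigma X S ≤ ‹MeasurableSpace Ω›)
    (Y : Finset (Fin m) → Ω → Fin m → ℝ)
    (hY : ∀ S, Y S = fun ω i => (μ[fun ω' => X ω' i | coordSigma X S]) ω)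
    (S : Finset (Fin m)) (i j : Fin m) :
    (covMatrix μ X i j - covMatrix μ (Y S) i j) ^ 2 ≤
      (m : ℝ)⁻¹ * (∫ ω, Y (insert j S) ω i ^ 2 ∂μ - ∫ ω, Y S ω i ^ 2 ∂μ) := by
  have hYL : ∀ S i, MemLp (fun ω => Y S ω i) 2 μ := by
    intro S i
    rw [hY]
    exact (hL i).condExp one_le_two
  have hmono : coordSigma X S ≤ coordSigma X (insert j S) := by
    refine measurable_iff_comap_le.1 ?_
    refine @measurable_pi_lambda _ _ _ (coordSigma X (insert j S)) _ _ fun a => ?_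
    have : Measurable[coordSigma X (insert j S)]
        (fun ω => fun i : {i // i ∈ insert j S} => X ω (i : Fin m)) := comap_measurable _
    exact (measurable_pi_apply (⟨a, mem_insert_of_mem a.2⟩ : {i // i ∈ insert j S})).comp this
  have hXj : StronglyMeasurable[coordSigma X (insert j S)] (fun ω => X ω j) := by
    have : Measurable[coordSigma X (insert j S)]
        (fun ω => fun i : {i // i ∈ insert j S} => X ω (i : Fin m)) := comap_measurable _
    exact ((measurable_pi_apply (⟨j, mem_insert_self j S⟩ : {i // i ∈ insert j S})).comp
      this).stronglyMeasurable
  rw [aux_cov μ X i j (hL i) (hL j), aux_cov μ (Y S) i j (hYL S i) (hYL S j)]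
  have hmean : ∀ i, ∫ ω, Y S ω i ∂μ = ∫ ω, X ω i ∂μ := by
    intro i
    rw [hY]
    exact integral_condExp (hle S)
  rw [hmean, hmean]
  have e1 : ∫ ω, Y S ω i * Y S ω j ∂μ = ∫ ω, Y S ω i * X ω j ∂μ := by
    have := aux_pull (hle S) (hL j) ((hL i).condExp one_le_two)
      (stronglyMeasurable_condExp (f := fun ω => X ω i) (μ := μ) (m := coordSigma X S))
    rw [hY]
    refine Eq.trans ?_ (this.trans ?_)
    · exact integral_congr_ae (Filter.Eventually.of_forall fun ω => mul_comm _ _)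
    · exact integral_congr_ae (Filter.Eventually.of_forall fun ω => mul_comm _ _)
  have e2 : ∫ ω, X ω i * X ω j ∂μ = ∫ ω, Y (insert j S) ω i * X ω j ∂μ := by
    rw [hY]
    exact (aux_pull (hle _) (hL i) (hL j) hXj).symm
  have e3 : ∫ ω, (Y (insert j S) ω i - Y S ω i) ^ 2 ∂μ
      = ∫ ω, Y (insert j S) ω i ^ 2 ∂μ - ∫ ω, Y S ω i ^ 2 ∂μ := by
    rw [hY, hY]
    exact aux_sq hmono (hle _) (hL i)
  have i1 : Integrable (fun ω => Y (insert j S) ω i * X ω j) μ := (hYL _ i).integrable_mul (hL j)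
  have i2 : Integrable (fun ω => Y S ω i * X ω j) μ := (hYL _ i).integrable_mul (hL j)
  have hD : MemLp (fun ω => (Y (insert j S) ω i - Y S ω i) * X ω j) 2 μ := by
    refine (((hYL (insert j S) i).sub (hYL S i))).of_le
      ((((hYL (insert j S) i).sub (hYL S i))).aestronglyMeasurable.mul
        (hL j).aestronglyMeasurable) ?_
    filter_upwards [hbd j] with ω hω
    rw [norm_mul]
    exact mul_le_of_le_one_right (norm_nonneg _) hω
  have e4 := aux_jensen hD
  have e5 : ∫ ω, (Y (insert j S) ω i - Y S ω i) * X ω j ∂μ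
      = ∫ ω, X ω i * X ω j ∂μ - ∫ ω, Y S ω i * Y S ω j ∂μ := by
    rw [e1, e2, ← integral_sub i1 i2]
    simp_rw [sub_mul]
  have e6 : ∫ ω, ((Y (insert j S) ω i - Y S ω i) * X ω j) ^ 2 ∂μ
      = (m : ℝ)⁻¹ * ∫ ω, (Y (insert j S) ω i - Y S ω i) ^ 2 ∂μ := by
    rw [← integral_const_mul]
    refine integral_congr_ae ?_
    filter_upwards [hsq] with ω hω
    rw [mul_pow, hω j, mul_comm]
  rw [e5, e6, e3] at e4
  convert e4 using 2
  ring

/-- For Boolean data `X ∈ {±1}^m/√m` with `m ≥ log₂ k`, if `t` is uniform in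
`{0, …, ⌊log₂ k⌋}` and `S` is a uniform size-`t` subset of `[m]`, then with probability at
least `2/3` (over `(t, S)`) the covariance loss from conditioning on `X_S` is below
`9/√(log₂ k)`: the probability of the bad event is at most `1/3`. -/
theorem covariance_loss_boolean_probability
    (Ω : Type) [MeasurableSpace Ω] (μ : Measure Ω) [IsProbabilityMeasure μ]
    (m : ℕ) (X : Ω → Fin m → ℝ) (hXmeas : Measurable X)
    (hXval : ∀ᵐ ω ∂μ, ∀ i, X ω i = 1 / Real.sqrt m ∨ X ω i = -(1 / Real.sqrt m))
    (k : ℕ) (hk : 3 ≤ k) (hm : Real.logb 2 k ≤ m)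
    (Y : Finset (Fin m) → Ω → Fin m → ℝ)
    (hY : ∀ S, Y S = fun ω i => (μ[fun ω' => X ω' i | coordSigma X S]) ω) :
    ((Nat.log 2 k : ℝ) + 1)⁻¹ *
        ∑ t ∈ Finset.range (Nat.log 2 k + 1),
          ((m.choose t : ℝ))⁻¹ *
            ∑ S ∈ Finset.powersetCard t (Finset.univ : Finset (Fin m)),
              (if 9 / Real.sqrt (Real.logb 2 k) ≤
                  frobNorm (covMatrix μ X - covMatrix μ (Y S)) then (1 : ℝ) else 0)
      ≤ 1 / 3 := by
  have hL0 : 1 < Real.logb 2 k := by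
    rw [Real.lt_logb_iff_rpow_lt (by norm_num) (by positivity)]
    have : (3 : ℝ) ≤ k := by exact_mod_cast hk
    norm_num
    linarith
  have hmpos : 0 < m := by
    have : (0 : ℝ) < m := by linarith
    exact_mod_cast this
  have hm' : (0 : ℝ) < m := by exact_mod_cast hmpos
  have hTle : Nat.log 2 k ≤ m := by
    have h1 : (Nat.log 2 k : ℝ) ≤ Real.logb 2 k := by
      exact_mod_cast Real.natLog_le_logb k 2
    exact_mod_cast h1.trans hm
  have hTlt : Real.logb 2 k ≤ Nat.log 2 k + 1 := by
    rw [Real.logb_le_iff_le_rpow (by norm_num) (by positivity)]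
    have := (Nat.lt_pow_succ_log_self (b := 2) (by norm_num) k).le
    exact_mod_cast this
  have hsq : ∀ᵐ ω ∂μ, ∀ i, X ω i ^ 2 = (m : ℝ)⁻¹ := by
    filter_upwards [hXval] with ω hω i
    have : (1 / Real.sqrt m) ^ 2 = (m : ℝ)⁻¹ := by
      rw [div_pow, Real.sq_sqrt hm'.le]; simp
    rcases hω i with h | h
    · rw [h, this]
    · rw [h, neg_sq, this]
  have hbd : ∀ i, ∀ᵐ ω ∂μ, ‖X ω i‖ ≤ 1 := by
    intro i
    filter_upwards [hsq] with ω hω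
    have h1 : (m : ℝ)⁻¹ ≤ 1 := inv_le_one_of_one_le₀ (by exact_mod_cast hmpos)
    rw [← hω i] at h1
    rw [Real.norm_eq_abs]
    exact (sq_le_one_iff_abs_le_one _).1 h1
  have hL : ∀ i, MemLp (fun ω => X ω i) 2 μ := by
    intro i
    exact MemLp.of_bound ((measurable_pi_apply i).comp hXmeas).aestronglyMeasurable 1 (hbd i)
  have hle : ∀ S, coordSigma X S ≤ ‹MeasurableSpace Ω› := by
    intro S
    unfold coordSigma
    rw [← measurable_iff_comap_le, measurable_pi_iff]
    intro a
    exact (measurable_pi_apply (a : Fin m)).comp hXmeas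
  have hent := aux_entry μ m hmpos X hXmeas hsq hL hbd hle Y hY
  set g : Finset (Fin m) → ℝ := fun S => ∑ i, ∫ ω, Y S ω i ^ 2 ∂μ with hg
  have hg0 : ∀ S, 0 ≤ g S := fun S =>
    sum_nonneg fun i _ => integral_nonneg fun ω => sq_nonneg _
  have hinv : 0 < (m : ℝ)⁻¹ := by positivity
  have hmono : ∀ S j, g S ≤ g (insert j S) := by
    intro S j
    refine sum_le_sum fun i _ => ?_
    have h1 := (sq_nonneg _).trans (hent S i j)
    linarith [nonneg_of_mul_nonneg_right h1 hinv]
  have hg1 : ∀ S, g S ≤ 1 := by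
    intro S
    have : ∀ i ∈ (univ : Finset (Fin m)), ∫ ω, Y S ω i ^ 2 ∂μ ≤ (m : ℝ)⁻¹ := by
      intro i _
      have h1 := aux_sq (μ := μ) (hle S) le_rfl (hL i)
      rw [condExp_of_stronglyMeasurable (f := fun ω => X ω i) le_rfl
        ((measurable_pi_apply i).comp hXmeas).stronglyMeasurable
        ((hL i).integrable one_le_two)] at h1
      have h2 : 0 ≤ ∫ ω, (X ω i - (μ[fun ω => X ω i | coordSigma X S]) ω) ^ 2 ∂μ :=
        integral_nonneg fun ω => sq_nonneg _
      rw [h1] at h2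
      have h3 : ∫ ω, X ω i ^ 2 ∂μ = (m : ℝ)⁻¹ := by
        have : (fun ω => X ω i ^ 2) =ᵐ[μ] fun _ => (m : ℝ)⁻¹ := by
          filter_upwards [hsq] with ω hω using hω i
        rw [integral_congr_ae this]
        simp
      rw [h3] at h2
      rw [hY]
      linarith
    refine (sum_le_sum this).trans ?_
    rw [sum_const, card_univ, Fintype.card_fin, nsmul_eq_mul, mul_inv_cancel₀ hm'.ne']
  have hfrob : ∀ S, frobNorm (covMatrix μ X - covMatrix μ (Y S)) ^ 2
      ≤ (m : ℝ)⁻¹ * ∑ j, (g (insert j S) - g S) := by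
    intro S
    unfold frobNorm
    have hnn : 0 ≤ ∑ i, ∑ j, (covMatrix μ X - covMatrix μ (Y S)) i j ^ 2 :=
      sum_nonneg fun i _ => sum_nonneg fun j _ => sq_nonneg _
    refine (Real.sq_sqrt hnn).le.trans ?_
    rw [sum_comm, mul_sum]
    refine sum_le_sum fun j _ => ?_
    simp only [hg]
    rw [← sum_sub_distrib, mul_sum]
    exact sum_le_sum fun i _ => hent S i j
  set l := Real.logb 2 k with hl
  have hlpos : 0 < l := by linarith
  have hind : ∀ S, (if 9 / Real.sqrt l ≤
      frobNorm (covMatrix μ X - covMatrix μ (Y S)) then (1 : ℝ) else 0)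
      ≤ (l / 81) * ((m : ℝ)⁻¹ * ∑ j, (g (insert j S) - g S)) := by
    intro S
    have h1 := hfrob S
    split_ifs with h
    · have h2 : (9 / Real.sqrt l) ^ 2 ≤ frobNorm (covMatrix μ X - covMatrix μ (Y S)) ^ 2 :=
        pow_le_pow_left₀ (by positivity) h 2
      rw [div_pow, Real.sq_sqrt hlpos.le] at h2
      have h3 := mul_le_mul_of_nonneg_left (h2.trans h1) (by positivity : 0 ≤ l / 81)
      have h4 : l / 81 * (9 ^ 2 / l) = 1 := by field_simp; norm_num
      linarith
    · exact mul_nonneg (by positivity) ((sq_nonneg _).trans h1)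
  have hsum := aux_sum hmpos g hg0 hg1 hmono (Nat.log 2 k) hTle
  have hbig : ∑ t ∈ Finset.range (Nat.log 2 k + 1),
          ((m.choose t : ℝ))⁻¹ *
            ∑ S ∈ Finset.powersetCard t (Finset.univ : Finset (Fin m)),
              (if 9 / Real.sqrt l ≤
                  frobNorm (covMatrix μ X - covMatrix μ (Y S)) then (1 : ℝ) else 0)
      ≤ l / 81 := by
    calc _ ≤ ∑ t ∈ range (Nat.log 2 k + 1), (l / 81) * (((m.choose t : ℝ))⁻¹ *
          ∑ S ∈ powersetCard t (univ : Finset (Fin m)),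
            (m : ℝ)⁻¹ * ∑ j, (g (insert j S) - g S)) := by
          refine sum_le_sum fun t _ => ?_
          rw [mul_left_comm, mul_sum (a := l / 81)]
          exact mul_le_mul_of_nonneg_left (sum_le_sum fun S _ => hind S) (by positivity)
      _ ≤ l / 81 := by
          rw [← mul_sum]
          exact mul_le_of_le_one_right (by positivity) hsum
  have hT : (0 : ℝ) < (Nat.log 2 k : ℝ) + 1 := by positivity
  rw [inv_mul_le_iff₀ hT]
  linarith
end

section
/- (Pinning lemma.) Let X₁, …, X_m be {±1}-valued random variables and let ℓ ∈ {1, …, m}. If t is chosen uniformly at random from {0, 1, …, ℓ} and, given t, S is a uniformly random subset of [m] of size t, then E_t E_S E_{X_S}[ Σ_{i ≠ j ∈ [m]} Cov(X_i, X_j | X_S)² ] ≤ 8 m² log 2 / ℓ. -/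
open MeasureTheory ProbabilityTheory Real Finset

/-- The conditional covariance `Cov(X_i, X_j ∣ X_S)` of the coordinates `i, j` of `X` given
the coordinates of `X` in `S`, as a random variable on `Ω`. -/
noncomputable def condCov {Ω : Type*} [MeasurableSpace Ω] (μ : Measure Ω) {m : ℕ}
    (X : Ω → Fin m → ℝ) (S : Finset (Fin m)) (i j : Fin m) : Ω → ℝ :=
  fun ω => (μ[fun ω' => X ω' i * X ω' j | coordSigma X S]) ω
    - (μ[fun ω' => X ω' i | coordSigma X S]) ω * (μ[fun ω' => X ω' j | coordSigma X S]) ω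

/-- Pythagoras for the conditional expectation. -/
lemma aux_pyth {Ω : Type*} {m1 m0 : MeasurableSpace Ω} (μ : Measure[m0] Ω)
    [IsProbabilityMeasure μ] (h1 : m1 ≤ m0) {h : Ω → ℝ} (hh : MemLp h 2 μ) :
    ∫ ω, (h ω - (μ[h | m1]) ω) ^ 2 ∂μ = ∫ ω, h ω ^ 2 ∂μ - ∫ ω, ((μ[h | m1]) ω) ^ 2 ∂μ := by
  have e1 : ∫ ω, (Var[h; μ | m1]) ω ∂μ = ∫ ω, (h ω - (μ[h | m1]) ω) ^ 2 ∂μ := by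
    unfold condVar
    rw [integral_condExp h1]
    rfl
  rw [← e1, integral_congr_ae (condVar_ae_eq_condExp_sq_sub_sq_condExp h1 hh),
    integral_sub' integrable_condExp
      (show Integrable (μ[h | m1] ^ 2) μ from (hh.condExp one_le_two).integrable_sq),
    integral_condExp h1]
  rfl

lemma aux_cov_s6 {Ω : Type*} {m1 m2 m0 : MeasurableSpace Ω} (μ : Measure[m0] Ω)
    [IsProbabilityMeasure μ] (h12 : m1 ≤ m2) (h2 : m2 ≤ m0) {f y c : Ω → ℝ}
    (hf : MemLp f 2 μ) (hy : StronglyMeasurable[m2] y) (hy1 : ∀ᵐ ω ∂μ, y ω ^ 2 = 1)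
    (hc : c = fun ω => (μ[f * y | m1]) ω - (μ[f | m1]) ω * (μ[y | m1]) ω) :
    MemLp c 2 μ ∧
      ∫ ω, c ω ^ 2 ∂μ ≤ ∫ ω, ((μ[f | m2]) ω) ^ 2 ∂μ - ∫ ω, ((μ[f | m1]) ω) ^ 2 ∂μ := by
  have h1 : m1 ≤ m0 := h12.trans h2
  have hybd : ∀ᵐ ω ∂μ, ‖y ω‖ ≤ 1 := by
    filter_upwards [hy1] with ω hω
    rw [Real.norm_eq_abs]
    exact (sq_le_one_iff_abs_le_one _).1 hω.le
  have hyt : MemLp y ⊤ μ :=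
    memLp_top_of_bound (hy.mono h2).aestronglyMeasurable 1 hybd
  have hyi : Integrable y μ := hyt.integrable le_top
  have hg := hf.condExp (m := m2) one_le_two
  have hf1 := hf.condExp (m := m1) one_le_two
  have hmul : ∀ k : Ω → ℝ, MemLp k 2 μ → MemLp (k * y) 2 μ := fun k hk => hyt.mul' hk
  have hfy := hmul f hf
  have hgy := hmul _ hg
  have hf1y := hmul _ hf1
  have hIntg : ∀ k : Ω → ℝ, MemLp k 2 μ → Integrable k μ := fun k hk => hk.integrable one_le_two
  set h : Ω → ℝ := (μ[f | m2]) * y - (μ[f | m1]) * y with hh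
  have hhm : MemLp h 2 μ := hgy.sub hf1y
  have key : c =ᵐ[μ] μ[h | m1] := by
    have a1 : μ[(μ[f | m2]) * y | m1] =ᵐ[μ] μ[f * y | m1] := by
      have b1 : μ[f * y | m2] =ᵐ[μ] (μ[f | m2]) * y :=
        condExp_mul_of_stronglyMeasurable_right hy (hIntg _ hfy) (hIntg _ hf)
      exact (condExp_congr_ae b1.symm).trans (condExp_condExp_of_le h12 h2)
    have a2 : μ[(μ[f | m1]) * y | m1] =ᵐ[μ] (μ[f | m1]) * μ[y | m1] :=
      condExp_mul_of_stronglyMeasurable_left stronglyMeasurable_condExp (hIntg _ hf1y) hyi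
    have a3 := condExp_sub (m := m1) (hIntg _ hgy) (hIntg _ hf1y)
    filter_upwards [a1, a2, a3] with ω w1 w2 w3
    rw [w3, hc]
    simp only [Pi.sub_apply, Pi.mul_apply] at *
    rw [w1, w2]
  refine ⟨(hhm.condExp one_le_two).ae_eq key.symm, ?_⟩
  have i1 : ∫ ω, c ω ^ 2 ∂μ = ∫ ω, ((μ[h | m1]) ω) ^ 2 ∂μ :=
    integral_congr_ae (by filter_upwards [key] with ω w; rw [w])
  have i2 := aux_pyth μ h1 hhm
  have i3 : 0 ≤ ∫ ω, (h ω - (μ[h | m1]) ω) ^ 2 ∂μ := integral_nonneg fun ω => sq_nonneg _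
  have tower : μ[μ[f | m2] | m1] =ᵐ[μ] μ[f | m1] := condExp_condExp_of_le h12 h2
  have i4 := aux_pyth μ h1 hg
  have i5 : ∫ ω, ((μ[μ[f | m2] | m1]) ω) ^ 2 ∂μ = ∫ ω, ((μ[f | m1]) ω) ^ 2 ∂μ :=
    integral_congr_ae (by filter_upwards [tower] with ω w; rw [w])
  have i6 : ∫ ω, h ω ^ 2 ∂μ = ∫ ω, ((μ[f | m2]) ω - (μ[μ[f | m2] | m1]) ω) ^ 2 ∂μ :=
    integral_congr_ae (by
      filter_upwards [tower, hy1] with ω w1 w2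
      simp only [hh, Pi.sub_apply, Pi.mul_apply]
      rw [w1, ← sub_mul, mul_pow, w2, mul_one])
  linarith

lemma aux_comb {m : ℕ} (F : Finset (Fin m) → ℝ) (t : ℕ) (ht : t ≤ m) :
    ∑ S ∈ powersetCard t (univ : Finset (Fin m)), ∑ j, (F (insert j S) - F S)
      = ((t : ℝ) + 1) * ∑ T ∈ powersetCard (t + 1) (univ : Finset (Fin m)), F T
        - ((m : ℝ) - t) * ∑ S ∈ powersetCard t (univ : Finset (Fin m)), F S := by
  have e1 : ∀ S ∈ powersetCard t (univ : Finset (Fin m)),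
      ∑ j, (F (insert j S) - F S) = ∑ j ∈ Sᶜ, F (insert j S) - ((m : ℝ) - t) * F S := by
    intro S hS
    have hc : #S = t := (mem_powersetCard.1 hS).2
    rw [← sum_add_sum_compl S, sum_eq_zero (s := S), zero_add, sum_sub_distrib, sum_const,
      card_compl, Fintype.card_fin, hc, nsmul_eq_mul, Nat.cast_sub ht]
    intro j hj
    rw [insert_eq_of_mem hj, sub_self]
  rw [sum_congr rfl e1, sum_sub_distrib, ← mul_sum]
  congr 1
  have e2 : ∀ T ∈ powersetCard (t + 1) (univ : Finset (Fin m)),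
      ((t : ℝ) + 1) * F T = ∑ j ∈ T, F T := by
    intro T hT
    rw [sum_const, (mem_powersetCard.1 hT).2, nsmul_eq_mul]
    push_cast
    rfl
  rw [mul_sum, sum_congr rfl e2, sum_sigma', sum_sigma']
  refine sum_bij' (fun p _ => ⟨insert p.2 p.1, p.2⟩) (fun p _ => ⟨p.1.erase p.2, p.2⟩)
    ?_ ?_ ?_ ?_ ?_
  · rintro ⟨S, j⟩ h
    simp only [mem_sigma, mem_powersetCard, mem_compl] at h ⊢
    exact ⟨⟨subset_univ _, by rw [card_insert_of_notMem h.2, h.1.2]⟩, mem_insert_self _ _⟩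
  · rintro ⟨S, j⟩ h
    simp only [mem_sigma, mem_powersetCard, mem_compl] at h ⊢
    exact ⟨⟨subset_univ _, by rw [card_erase_of_mem h.2, h.1.2]; rfl⟩, notMem_erase _ _⟩
  · rintro ⟨S, j⟩ h
    simp only [mem_sigma, mem_powersetCard, mem_compl] at h ⊢
    rw [erase_insert h.2]
  · rintro ⟨S, j⟩ h
    simp only [mem_sigma, mem_powersetCard, mem_compl] at h ⊢
    rw [insert_erase h.2]
  · rintro ⟨S, j⟩ h
    rfl

/-- Telescoping over the sizes of the pinned sets. -/
lemma aux_tele {m : ℕ} (F : Finset (Fin m) → ℝ) (B : ℝ) (h0 : ∀ S, 0 ≤ F S) (hB : ∀ S, F S ≤ B)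
    (hmono : ∀ S j, F S ≤ F (insert j S)) (ℓ : ℕ) (hℓ : ℓ ≤ m) :
    ∑ t ∈ Finset.range (ℓ + 1), ((m.choose t : ℝ))⁻¹ *
      ∑ S ∈ powersetCard t (univ : Finset (Fin m)), ∑ j, (F (insert j S) - F S) ≤ m * B := by
  set q : ℕ → ℝ := fun t =>
    ((m.choose t : ℝ))⁻¹ * ∑ S ∈ powersetCard t (univ : Finset (Fin m)), F S with hq
  set A : ℕ → ℝ := fun t => ((m.choose t : ℝ))⁻¹ *
      ∑ S ∈ powersetCard t (univ : Finset (Fin m)), ∑ j, (F (insert j S) - F S) with hA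
  have hA0 : ∀ t, 0 ≤ A t := fun t => mul_nonneg (by positivity)
    (sum_nonneg fun S _ => sum_nonneg fun j _ => sub_nonneg.2 (hmono S j))
  have hq0 : ∀ t, 0 ≤ q t := fun t => mul_nonneg (by positivity) (sum_nonneg fun S _ => h0 S)
  have hq1 : ∀ t, t ≤ m → q t ≤ B := by
    intro t ht
    have hpos : (0 : ℝ) < m.choose t := by exact_mod_cast Nat.choose_pos ht
    simp only [hq]
    rw [inv_mul_le_iff₀ hpos]
    calc _ ≤ ∑ S ∈ powersetCard t (univ : Finset (Fin m)), B := sum_le_sum fun S _ => hB S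
      _ = _ := by simp
  have step : ∀ t, t < m → A t = ((m : ℝ) - t) * (q (t + 1) - q t) := by
    intro t ht
    have hpos : (0 : ℝ) < m.choose t := by exact_mod_cast Nat.choose_pos ht.le
    have hpos' : (0 : ℝ) < m.choose (t + 1) := by exact_mod_cast Nat.choose_pos ht
    have hrec : (m.choose (t + 1) : ℝ) * (t + 1) = m.choose t * ((m : ℝ) - t) := by
      rw [← Nat.cast_sub ht.le]
      exact_mod_cast Nat.choose_succ_right_eq m t
    simp only [hA, hq]
    rw [aux_comb F t ht.le]
    have : ((m : ℝ) - t) * (m.choose (t + 1) : ℝ)⁻¹ = (m.choose t : ℝ)⁻¹ * (t + 1) := by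
      field_simp
      linarith
    rw [mul_sub, mul_sub, ← mul_assoc ((m : ℝ) - t), this]
    ring
  have stepl : ∀ t, t < m → A t ≤ m * (q (t + 1) - q t) := by
    intro t ht
    have htm : (0 : ℝ) < (m : ℝ) - t := by
      rw [sub_pos]
      exact_mod_cast ht
    have h1 := step t ht
    have h2 : 0 ≤ q (t + 1) - q t := by
      have := hA0 t
      rw [h1] at this
      exact nonneg_of_mul_nonneg_right this htm
    rw [h1]
    exact mul_le_mul_of_nonneg_right (by simp) h2
  have part : ∀ k, k ≤ m → ∑ t ∈ Finset.range k, A t ≤ m * (q k - q 0) := by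
    intro k hk
    rw [← sum_range_sub q k, mul_sum]
    exact sum_le_sum fun t ht => stepl t (lt_of_lt_of_le (Finset.mem_range.1 ht) hk)
  have fin : ∀ k, k ≤ m → (m : ℝ) * (q k - q 0) ≤ m * B := fun k hk =>
    mul_le_mul_of_nonneg_left (by linarith [hq1 k hk, hq0 0]) (by positivity)
  change ∑ t ∈ Finset.range (ℓ + 1), A t ≤ m * B
  rcases hℓ.lt_or_eq with h | h
  · exact (part _ h).trans (fin _ h)
  · rw [sum_range_succ]
    have : A ℓ = 0 := by
      subst h
      simp only [hA]
      rw [aux_comb F ℓ le_rfl, powersetCard_eq_empty.2 (by simp)]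
      simp
    rw [this, add_zero]
    exact (part _ hℓ).trans (fin _ hℓ)

/-- **The pinning lemma** (Montanari; Raghavendra–Tan). For `{±1}`-valued random variables
`X₁, …, X_m` and `ℓ ∈ [m]`, picking `t` uniformly in `{0, 1, …, ℓ}` and then a uniformly
random subset `S ⊆ [m]` with `|S| = t`, the expected average squared conditional covariance
satisfies `𝔼_t 𝔼_S 𝔼_{X_S} [∑_{i ≠ j} Cov(X_i, X_j ∣ X_S)²] ≤ 8 m² log 2 / ℓ`. -/
theorem pinning_lemma
    (Ω : Type) [MeasurableSpace Ω] (μ : Measure Ω) [IsProbabilityMeasure μ]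
    (m : ℕ) (X : Ω → Fin m → ℝ) (hXmeas : Measurable X)
    (hXval : ∀ᵐ ω ∂μ, ∀ i, X ω i = 1 ∨ X ω i = -1)
    (ℓ : ℕ) (hℓ₁ : 1 ≤ ℓ) (hℓ₂ : ℓ ≤ m) :
    ((ℓ : ℝ) + 1)⁻¹ *
        ∑ t ∈ Finset.range (ℓ + 1),
          ((m.choose t : ℝ))⁻¹ *
            ∑ S ∈ Finset.powersetCard t (Finset.univ : Finset (Fin m)),
              ∫ ω, ∑ i, ∑ j, (if i ≠ j then (condCov μ X S i j ω) ^ 2 else 0) ∂μ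
      ≤ 8 * (m : ℝ) ^ 2 * Real.log 2 / ℓ := by
  have hX : ∀ i, Measurable fun ω => X ω i := fun i => (measurable_pi_apply i).comp hXmeas
  have hle : ∀ S, coordSigma X S ≤ ‹MeasurableSpace Ω› := fun S =>
    Measurable.comap_le (measurable_pi_lambda _ fun i => hX i)
  have hcm : ∀ S, ∀ i ∈ S, Measurable[coordSigma X S] fun ω => X ω i := by
    intro S i hi
    exact (measurable_pi_apply (⟨i, hi⟩ : {i // i ∈ S})).comp
      (comap_measurable (fun ω => fun i : {i // i ∈ S} => X ω (i : Fin m)))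
  have hmonoσ : ∀ S j, coordSigma X S ≤ coordSigma X (insert j S) := by
    intro S j
    refine Measurable.comap_le ?_
    exact @measurable_pi_lambda _ _ _ (coordSigma X (insert j S)) _ _
      fun i => hcm _ i (mem_insert_of_mem i.2)
  have hsq : ∀ i, ∀ᵐ ω ∂μ, X ω i ^ 2 = 1 := by
    intro i
    filter_upwards [hXval] with ω h
    rcases h i with h | h <;> rw [h] <;> norm_num
  have hL2 : ∀ i, MemLp (fun ω => X ω i) 2 μ := by
    intro i
    refine MemLp.of_bound (hX i).aestronglyMeasurable 1 ?_
    filter_upwards [hsq i] with ω hω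
    rw [Real.norm_eq_abs]
    exact (sq_le_one_iff_abs_le_one _).1 hω.le
  set Q : Finset (Fin m) → Fin m → ℝ :=
    fun S i => ∫ ω, ((μ[fun ω' => X ω' i | coordSigma X S]) ω) ^ 2 ∂μ with hQ
  have hcov : ∀ S i j, MemLp (condCov μ X S i j) 2 μ ∧
      ∫ ω, condCov μ X S i j ω ^ 2 ∂μ ≤ Q (insert j S) i - Q S i := fun S i j =>
    aux_cov_s6 μ (hmonoσ S j) (hle _) (hL2 i)
      (hcm _ j (mem_insert_self _ _)).stronglyMeasurable (hsq j) rfl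
  have hD0 : ∀ S i j, 0 ≤ Q (insert j S) i - Q S i := fun S i j =>
    (integral_nonneg fun ω => sq_nonneg _).trans (hcov S i j).2
  have hQ0 : ∀ S i, 0 ≤ Q S i := fun S i => integral_nonneg fun ω => sq_nonneg _
  have hQ1 : ∀ S i, Q S i ≤ 1 := by
    intro S i
    have h1 := aux_pyth μ (hle S) (hL2 i)
    have h2 : 0 ≤ ∫ ω, (X ω i - (μ[fun ω' => X ω' i | coordSigma X S]) ω) ^ 2 ∂μ :=
      integral_nonneg fun ω => sq_nonneg _
    have h3 : ∫ ω, X ω i ^ 2 ∂μ = 1 := by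
      rw [integral_congr_ae (g := fun _ => (1 : ℝ)) (hsq i)]
      simp
    simp only [hQ]
    linarith
  have hIntg : ∀ S, ∫ ω, ∑ i, ∑ j, (if i ≠ j then (condCov μ X S i j ω) ^ 2 else 0) ∂μ
      ≤ ∑ j, (∑ i, Q (insert j S) i - ∑ i, Q S i) := by
    intro S
    have hI : ∀ i j, Integrable
        (fun ω => if i ≠ j then (condCov μ X S i j ω) ^ 2 else 0) μ := by
      intro i j
      split_ifs
      · exact (hcov S i j).1.integrable_sq
      · exact integrable_zero _ _ _
    rw [integral_finsetSum _ fun i _ => integrable_finsetSum _ fun j _ => hI i j]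
    simp_rw [← sum_sub_distrib]
    rw [sum_comm (s := univ) (t := univ) (f := fun j i => Q (insert j S) i - Q S i)]
    refine sum_le_sum fun i _ => ?_
    rw [integral_finsetSum _ fun j _ => hI i j]
    refine sum_le_sum fun j _ => ?_
    split_ifs
    · exact (hcov S i j).2
    · simpa using hD0 S i j
  have htele := aux_tele (fun S => ∑ i, Q S i) (m : ℝ) (fun S => sum_nonneg fun i _ => hQ0 S i)
    (fun S => (sum_le_sum fun i _ => hQ1 S i).trans (by simp))
    (fun S j => sum_le_sum fun i _ => sub_nonneg.1 (hD0 S i j)) ℓ hℓ₂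
  have hmain : ∑ t ∈ Finset.range (ℓ + 1), ((m.choose t : ℝ))⁻¹ *
            ∑ S ∈ Finset.powersetCard t (Finset.univ : Finset (Fin m)),
              ∫ ω, ∑ i, ∑ j, (if i ≠ j then (condCov μ X S i j ω) ^ 2 else 0) ∂μ
      ≤ (m : ℝ) * m :=
    le_trans (sum_le_sum fun t _ => mul_le_mul_of_nonneg_left
      (sum_le_sum fun S _ => hIntg S) (by positivity)) htele
  have hℓ : (1 : ℝ) ≤ ℓ := by exact_mod_cast hℓ₁
  have hlog := Real.log_two_gt_d9
  calc _ ≤ ((ℓ : ℝ) + 1)⁻¹ * ((m : ℝ) * m) := mul_le_mul_of_nonneg_left hmain (by positivity)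
    _ ≤ (ℓ : ℝ)⁻¹ * ((m : ℝ) * m) := by gcongr; linarith
    _ ≤ (ℓ : ℝ)⁻¹ * (8 * (m : ℝ) ^ 2 * Real.log 2) := by
      refine mul_le_mul_of_nonneg_left ?_ (by positivity)
      nlinarith [mul_le_mul_of_nonneg_left hlog.le (sq_nonneg (m : ℝ)), sq_nonneg (m : ℝ)]
    _ = _ := by ring
end
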